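/- Let P and Q be joint probability distributions on finite alphabets. Assume the strict inequalities: H_{t,τ}(X|Y)_P < H_{t,τ}(X′|Y′)_Q for all (t,τ) ∈ 𝒟_bulk; H_{−∞,τ}(X|Y)_P < H_{−∞,τ}(X′|Y′)_Q for all τ ∈ 𝒟_{−∞}; H_{0,α}(X|Y)_P < H_{0,α}(X′|Y′)_Q for all α ∈ [0,1]; and H_{+∞,0}(X|Y)_P < H_{+∞,0}(X′|Y′)_Q. Then: (1) there exists N ∈ ℕ such that for all n ≥ N, P^{⊗n} conditionally majorizes Q^{⊗n}; and (2) there exists a joint probability distribution R on finite alphabets such that P ⊗ R conditionally majorizes Q ⊗ R. -/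

import Mathlib

open MeasureTheory
open scoped ENNReal

noncomputable section

/-- Base-2 logarithm. -/
def log2 (x : ℝ) : ℝ := Real.logb 2 x

/-- Base-2 exponential. -/
def exp2 (x : ℝ) : ℝ := (2 : ℝ) ^ x

/-- Rényi entropy of order `α ∈ [0,∞]` of a vector `p` on a finite set. -/
def renyi {X : Type*} [Fintype X] (α : ℝ≥0∞) (p : X → ℝ) : ℝ :=
  if α = 0 then log2 (Nat.card {x : X // 0 < p x})
  else if α = 1 then -∑ x, p x * log2 (p x)
  else if α = ⊤ then -log2 (⨆ x, p x)
  else (1 - α.toReal)⁻¹ * log2 (∑ x, p x ^ α.toReal)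

/-- A probability vector on a finite set. -/
def IsProbVec {X : Type*} [Fintype X] (p : X → ℝ) : Prop :=
  (∀ x, 0 ≤ p x) ∧ ∑ x, p x = 1

/-- A doubly stochastic matrix. -/
def DoublyStochastic {X : Type*} [Fintype X] (S : Matrix X X ℝ) : Prop :=
  (∀ i j, 0 ≤ S i j) ∧ (∀ i, ∑ j, S i j = 1) ∧ (∀ j, ∑ i, S i j = 1)

/-- `Q` is obtained from `P` by a conditionally mixing channel. -/
def CondMixed {X Y Y' : Type*} [Fintype X] [Fintype Y] [Fintype Y']
    (P : Matrix X Y ℝ) (Q : Matrix X Y' ℝ) : Prop :=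
  ∃ (k : ℕ) (S : Fin k → Matrix X X ℝ) (D : Fin k → Matrix Y Y' ℝ),
    (∀ i, DoublyStochastic (S i)) ∧
    (∀ i a b, 0 ≤ D i a b) ∧
    (∀ a, ∑ b, ∑ i, D i a b = 1) ∧
    Q = ∑ i, S i * P * D i

/-- A joint probability distribution on finite alphabets, viewed as a matrix. -/
def IsJointProb {X Y : Type*} [Fintype X] [Fintype Y] (P : Matrix X Y ℝ) : Prop :=
  (∀ x y, 0 ≤ P x y) ∧ ∑ x, ∑ y, P x y = 1

/-- Marginal on the conditioning system: the `y`-th column sum. -/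
def margY {X Y : Type*} [Fintype X] (P : Matrix X Y ℝ) (y : Y) : ℝ := ∑ x, P x y

/-- The conditioned distribution (normalized `y`-th column). -/
def condX {X Y : Type*} [Fintype X] (P : Matrix X Y ℝ) (y : Y) : X → ℝ :=
  fun x => P x y / margY P y

/-- The conditional entropy `H_{t,τ}`. -/
def Hbulk {X Y : Type*} [Fintype X] [Fintype Y] (t : ℝ) (τ : Measure ℝ≥0∞)
    (P : Matrix X Y ℝ) : ℝ :=
  t⁻¹ * log2 (∑ y ∈ Finset.univ.filter (fun y => 0 < margY P y),
    margY P y * exp2 (t * ∫ α, renyi α (condX P y) ∂τ))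

/-- The conditional entropy `H_{0,α}`. -/
def HzeroA {X Y : Type*} [Fintype X] [Fintype Y] (α : ℝ≥0∞) (P : Matrix X Y ℝ) : ℝ :=
  ∑ y ∈ Finset.univ.filter (fun y => 0 < margY P y), margY P y * renyi α (condX P y)

/-- The conditional entropy `H_{-∞,τ}`. -/
def HnegInf {X Y : Type*} [Fintype X] [Fintype Y] (τ : Measure ℝ≥0∞)
    (P : Matrix X Y ℝ) : ℝ :=
  sInf ((fun y => ∫ α, renyi α (condX P y) ∂τ) '' {y | 0 < margY P y})

/-- The conditional entropy `H_{+∞,0}`. -/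
def HposInf {X Y : Type*} [Fintype X] [Fintype Y] (P : Matrix X Y ℝ) : ℝ :=
  sSup ((fun y => renyi 0 (condX P y)) '' {y | 0 < margY P y})

/-- The parameter set `𝒟_bulk`. -/
def Dbulk : Set (ℝ × Measure ℝ≥0∞) :=
  {p | p.1 ≠ 0 ∧ IsProbabilityMeasure p.2 ∧
    ∀ (d n n' : ℕ) (P : Matrix (Fin d) (Fin n) ℝ) (Q : Matrix (Fin d) (Fin n') ℝ),
      IsJointProb P → CondMixed P Q → Hbulk p.1 p.2 P ≤ Hbulk p.1 p.2 Q}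

/-- The parameter set `𝒟_{-∞}`. -/
def DnegInf : Set (Measure ℝ≥0∞) :=
  {τ | IsProbabilityMeasure τ ∧
    ∀ (d n n' : ℕ) (P : Matrix (Fin d) (Fin n) ℝ) (Q : Matrix (Fin d) (Fin n') ℝ),
      IsJointProb P → CondMixed P Q → HnegInf τ P ≤ HnegInf τ Q}

/-- `P'` is obtained from `P` by relabeling (injections) and embedding, with zeros elsewhere. -/
def Embeds {X Y X' Y' : Type*} [Fintype X] [Fintype Y] [Fintype X'] [Fintype Y']
    (P : Matrix X Y ℝ) (P' : Matrix X' Y' ℝ) : Prop :=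
  ∃ (f : X ↪ X') (g : Y ↪ Y'),
    (∀ x y, P' (f x) (g y) = P x y) ∧
    (∀ x' y', P' x' y' ≠ 0 → (∃ x, f x = x') ∧ (∃ y, g y = y'))

/-- Conditional majorization: after a common embedding, a conditionally mixing channel maps
(the embedding of) `P` to (the embedding of) `Q`. -/
def CondMajorizes {X Y X' Y' : Type*} [Fintype X] [Fintype Y] [Fintype X'] [Fintype Y']
    (P : Matrix X Y ℝ) (Q : Matrix X' Y' ℝ) : Prop :=
  ∃ (m n n' : ℕ) (P' : Matrix (Fin m) (Fin n) ℝ) (Q' : Matrix (Fin m) (Fin n') ℝ),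
    Embeds P P' ∧ Embeds Q Q' ∧ CondMixed P' Q'

/-- Kronecker product of matrices. -/
def kron {X Y X' Y' : Type*} (P : Matrix X Y ℝ) (Q : Matrix X' Y' ℝ) :
    Matrix (X × X') (Y × Y') ℝ :=
  Matrix.of fun x y => P x.1 y.1 * Q x.2 y.2

/-- `n`-fold Kronecker power of a matrix. -/
def kronPow {X Y : Type*} (P : Matrix X Y ℝ) (n : ℕ) :
    Matrix (Fin n → X) (Fin n → Y) ℝ :=
  Matrix.of fun x y => ∏ i, P (x i) (y i)

/-- Sum of all entries of a matrix. -/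
def totalMass {X Y : Type*} [Fintype X] [Fintype Y] (P : Matrix X Y ℝ) : ℝ :=
  ∑ x, ∑ y, P x y

/-- `α/(1-α)`, with the convention that it equals `-1` at `α = ∞`. -/
def aRatio (α : ℝ≥0∞) : ℝ := if α = ⊤ then -1 else α.toReal / (1 - α.toReal)

/-- `α/(α-1)`, with the convention that it equals `1` at `α = ∞`. -/
def aRatio' (α : ℝ≥0∞) : ℝ := if α = ⊤ then 1 else α.toReal / (α.toReal - 1)

/-- Rényi relative entropy `D_α(p‖r)`. -/
def relRenyi {X : Type*} [Fintype X] (α : ℝ≥0∞) (p r : X → ℝ) : ℝ :=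
  if α = 1 then ∑ x, p x * log2 (p x / r x)
  else if α = ⊤ then log2 (⨆ x, p x / r x)
  else (α.toReal - 1)⁻¹ * log2 (∑ x, p x ^ α.toReal * r x ^ (1 - α.toReal))

/-- The quantity `I_{t,τ}(P‖R)`. -/
def Ibulk {X Y : Type*} [Fintype X] [Fintype Y] (t : ℝ) (τ : Measure ℝ≥0∞)
    (P : Matrix X Y ℝ) (R : X → ℝ) : ℝ :=
  -t⁻¹ * log2 (∑ y ∈ Finset.univ.filter (fun y => 0 < margY P y),
    margY P y * exp2 (-t * ∫ α, relRenyi α (condX P y) R ∂τ))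

/-- The quantity `I_{-∞,τ}(P‖R)`. -/
def InegInf {X Y : Type*} [Fintype X] [Fintype Y] (τ : Measure ℝ≥0∞)
    (P : Matrix X Y ℝ) (R : X → ℝ) : ℝ :=
  sSup ((fun y => ∫ α, relRenyi α (condX P y) R ∂τ) '' {y | 0 < margY P y})

/-- A conditioned `R`-preserving channel maps `P` to `Q`. -/
def CondPreserving {X Y Y' : Type*} [Fintype X] [Fintype Y] [Fintype Y'] (R : X → ℝ)
    (P : Matrix X Y ℝ) (Q : Matrix X Y' ℝ) : Prop :=
  ∃ (k : ℕ) (G : Fin k → Matrix X X ℝ) (D : Fin k → Matrix Y Y' ℝ),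
    (∀ i a b, 0 ≤ G i a b) ∧
    (∀ i b, ∑ a, G i a b = 1) ∧
    (∀ i, (G i).mulVec R = R) ∧
    (∀ i a b, 0 ≤ D i a b) ∧
    (∀ a, ∑ b, ∑ i, D i a b = 1) ∧
    Q = ∑ i, G i * P * D i

/-- Total variation distance between two matrices. -/
def tvDist {X Y : Type*} [Fintype X] [Fintype Y] (P Q : Matrix X Y ℝ) : ℝ :=
  (1 / 2) * ∑ x, ∑ y, |P x y - Q x y|

namespace CM

open Real Finset

/-! ### Powers with the convention `0 ^ s = 0` -/

/-- Power with `0 ^ s = 0` for every `s`. -/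
def pw (v s : ℝ) : ℝ := if v = 0 then 0 else v ^ s

lemma pw_nonneg {v : ℝ} (hv : 0 ≤ v) (s : ℝ) : 0 ≤ pw v s := by
  unfold pw; split_ifs
  · exact le_rfl
  · exact rpow_nonneg hv s

lemma pw_pos {v : ℝ} (hv : 0 < v) (s : ℝ) : 0 < pw v s := by
  unfold pw; rw [if_neg hv.ne']; exact rpow_pos_of_pos hv s

lemma pw_of_pos {v : ℝ} (hv : 0 < v) (s : ℝ) : pw v s = exp (s * log v) := by
  unfold pw; rw [if_neg hv.ne', rpow_def_of_pos hv, mul_comm]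

@[simp] lemma pw_zero_left (s : ℝ) : pw 0 s = 0 := by simp [pw]

lemma pw_one (v : ℝ) : pw v 1 = v := by
  unfold pw; split_ifs with h
  · exact h.symm
  · simp

lemma pw_of_ne {v s : ℝ} (hs : s ≠ 0) : pw v s = v ^ s := by
  unfold pw; split_ifs with h
  · rw [h, zero_rpow hs]
  · rfl

lemma pw_mul {u v : ℝ} (hu : 0 ≤ u) (hv : 0 ≤ v) (s : ℝ) : pw (u * v) s = pw u s * pw v s := by
  rcases hu.eq_or_lt with h | h
  · simp [← h]
  rcases hv.eq_or_lt with h' | h'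
  · simp [← h']
  · simp [pw, h.ne', h'.ne', mul_rpow hu hv]

lemma pw_prod {ι : Type*} (s : Finset ι) (f : ι → ℝ) (hf : ∀ i, 0 ≤ f i) (t : ℝ) :
    pw (∏ i ∈ s, f i) t = ∏ i ∈ s, pw (f i) t := by
  classical
  induction s using Finset.induction_on with
  | empty => simp [pw]
  | insert a s ha ih =>
    rw [prod_insert ha, prod_insert ha, pw_mul (hf a) (prod_nonneg fun i _ => hf i), ih]

variable {X : Type*} [Fintype X]

/-- Power sum. -/
def Sm (V : X → ℝ) (s : ℝ) : ℝ := ∑ x, pw (V x) s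

/-- Log of the power sum. -/
def psi (V : X → ℝ) (s : ℝ) : ℝ := log (Sm V s)

/-- Tilted mean of `-log V`. -/
def am (V : X → ℝ) (s : ℝ) : ℝ := (∑ x, pw (V x) s * (-log (V x))) / Sm V s

lemma Sm_pos {V : X → ℝ} (hV : ∀ x, 0 ≤ V x) (h0 : ∃ x, 0 < V x) (s : ℝ) : 0 < Sm V s := by
  obtain ⟨x, hx⟩ := h0
  exact sum_pos' (fun x _ => pw_nonneg (hV x) s) ⟨x, mem_univ x, pw_pos hx s⟩

lemma Sm_nonneg {V : X → ℝ} (hV : ∀ x, 0 ≤ V x) (s : ℝ) : 0 ≤ Sm V s :=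
  sum_nonneg (fun x _ => pw_nonneg (hV x) s)

lemma Sm_one (V : X → ℝ) : Sm V 1 = ∑ x, V x := by simp [Sm, pw_one]

lemma exp_psi {V : X → ℝ} (hV : ∀ x, 0 ≤ V x) (h0 : ∃ x, 0 < V x) (s : ℝ) :
    exp (psi V s) = Sm V s := exp_log (Sm_pos hV h0 s)

/-! ### Head and tail sums -/

/-- Largest sum of `k` entries. -/
def headk (V : X → ℝ) (k : ℕ) : ℝ :=
  ((univ : Finset (Finset X)).filter (fun A => A.card ≤ k)).sup' ⟨∅, by simp⟩
    (fun A => ∑ x ∈ A, V x)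

lemma le_headk (V : X → ℝ) {k : ℕ} (A : Finset X) (hA : A.card ≤ k) :
    ∑ x ∈ A, V x ≤ headk V k :=
  Finset.le_sup' (fun A => ∑ x ∈ A, V x) (by simp [hA])

lemma headk_le {V : X → ℝ} {k : ℕ} {c : ℝ} (h : ∀ A : Finset X, A.card ≤ k → ∑ x ∈ A, V x ≤ c) :
    headk V k ≤ c :=
  Finset.sup'_le _ _ (fun A hA => h A (by simpa using hA))

lemma headk_mono (V : X → ℝ) {k l : ℕ} (h : k ≤ l) : headk V k ≤ headk V l :=
  headk_le fun A hA => le_headk V A (hA.trans h)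

lemma headk_nonneg (V : X → ℝ) (k : ℕ) : 0 ≤ headk V k := by
  simpa using le_headk V (k := k) ∅ (by simp)

lemma headk_zero (V : X → ℝ) : headk V 0 = 0 :=
  le_antisymm (headk_le fun A hA => by
    have : A = ∅ := by simpa using hA
    simp [this]) (headk_nonneg V 0)

lemma headk_le_sum {V : X → ℝ} (hV : ∀ x, 0 ≤ V x) (k : ℕ) : headk V k ≤ ∑ x, V x :=
  headk_le fun A _ => sum_le_univ_sum_of_nonneg hV

lemma headk_full {V : X → ℝ} (hV : ∀ x, 0 ≤ V x) {k : ℕ} (hk : Fintype.card X ≤ k) :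
    headk V k = ∑ x, V x :=
  le_antisymm (headk_le_sum hV k) (le_headk V univ (by simpa using hk))

lemma headk_smul (V : X → ℝ) {c : ℝ} (hc : 0 ≤ c) (k : ℕ) :
    headk (fun x => c * V x) k = c * headk V k := by
  apply le_antisymm
  · exact headk_le fun A hA => by
      rw [← mul_sum]; exact mul_le_mul_of_nonneg_left (le_headk V A hA) hc
  · rcases hc.eq_or_lt with h | h
    · rw [← h, zero_mul]; exact headk_nonneg _ _
    · rw [← le_div_iff₀' h]
      exact headk_le fun A hA => by
        rw [le_div_iff₀' h, mul_sum]; exact le_headk (fun x => c * V x) A hA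

/-- Sum of all but the `k` largest entries. -/
def tailk (V : X → ℝ) (k : ℕ) : ℝ := ∑ x, V x - headk V k

lemma tailk_nonneg {V : X → ℝ} (hV : ∀ x, 0 ≤ V x) (k : ℕ) : 0 ≤ tailk V k :=
  sub_nonneg.2 (headk_le_sum hV k)

lemma tailk_le_sum (V : X → ℝ) (k : ℕ) : tailk V k ≤ ∑ x, V x :=
  sub_le_self _ (headk_nonneg V k)

lemma tailk_anti (V : X → ℝ) {k l : ℕ} (h : k ≤ l) : tailk V l ≤ tailk V k :=
  sub_le_sub_left (headk_mono V h) _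

/-- B1: upper bound on tails. -/
lemma tailk_le {V : X → ℝ} (hV : ∀ x, 0 ≤ V x) (h0 : ∃ x, 0 < V x) {k : ℕ} (hk : 1 ≤ k)
    {s : ℝ} (hs : 0 < s) (hs1 : s ≤ 1) :
    tailk V k ≤ exp ((psi V s - (1 - s) * log k) / s) := by
  classical
  have hS := Sm_pos hV h0 s
  have hk0 : (0 : ℝ) < k := by exact_mod_cast hk
  set c0 : ℝ := exp ((psi V s - log k) / s) with hc0
  have hc0p : 0 < c0 := exp_pos _
  have hc0s : c0 ^ s = Sm V s / k := by
    rw [hc0, ← exp_mul, div_mul_cancel₀ _ hs.ne', exp_sub, exp_psi hV h0, exp_log hk0]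
  set A := univ.filter (fun x => c0 ≤ V x) with hA
  have hcard : A.card ≤ k := by
    have h1 : (A.card : ℝ) * (Sm V s / k) ≤ Sm V s := by
      calc (A.card : ℝ) * (Sm V s / k) = ∑ x ∈ A, Sm V s / k := by simp
        _ ≤ ∑ x ∈ A, pw (V x) s := by
          refine sum_le_sum fun x hx => ?_
          have hx' : c0 ≤ V x := by simpa [hA] using hx
          rw [pw_of_ne hs.ne', ← hc0s]
          exact rpow_le_rpow hc0p.le hx' hs.le
        _ ≤ Sm V s := sum_le_univ_sum_of_nonneg fun x => pw_nonneg (hV x) s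
    have h2 : (A.card : ℝ) ≤ k := by
      have : (A.card : ℝ) * (Sm V s / k) = (A.card / k) * Sm V s := by ring
      rw [this] at h1
      have := (mul_le_iff_le_one_left hS).1 h1
      rwa [div_le_one hk0] at this
    exact_mod_cast h2
  have h3 : tailk V k ≤ ∑ x ∈ univ.filter (fun x => ¬ c0 ≤ V x), V x := by
    have := le_headk V A hcard
    have h4 := sum_filter_add_sum_filter_not univ (fun x => c0 ≤ V x) V
    unfold tailk; linarith
  refine h3.trans ?_
  have h5 : ∀ x ∈ univ.filter (fun x => ¬ c0 ≤ V x), V x ≤ c0 ^ (1 - s) * pw (V x) s := by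
    intro x hx
    have hx' : V x < c0 := by simpa using hx
    rcases (hV x).eq_or_lt with h | h
    · rw [← h]; simp
    · have : V x = V x ^ (1 - s) * pw (V x) s := by
        rw [pw_of_ne hs.ne', ← rpow_add h]; simp
      conv_lhs => rw [this]
      exact mul_le_mul_of_nonneg_right (rpow_le_rpow h.le hx'.le (by linarith)) (pw_nonneg h.le s)
  refine (sum_le_sum h5).trans ?_
  rw [← mul_sum]
  have h6 : ∑ x ∈ univ.filter (fun x => ¬ c0 ≤ V x), pw (V x) s ≤ Sm V s :=
    sum_le_univ_sum_of_nonneg fun x => pw_nonneg (hV x) s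
  refine (mul_le_mul_of_nonneg_left h6 (rpow_nonneg hc0p.le _)).trans (le_of_eq ?_)
  rw [← exp_psi hV h0 s, hc0, ← exp_mul, ← exp_add]
  congr 1
  field_simp
  ring

lemma tailk_eq_zero {V : X → ℝ} (hV : ∀ x, 0 ≤ V x) {k : ℕ}
    (hk : Sm V 0 ≤ k) : tailk V k = 0 := by
  classical
  have h1 : Sm V 0 = ((univ.filter (fun x => V x ≠ 0)).card : ℝ) := by
    unfold Sm pw
    rw [card_filter]; push_cast
    exact sum_congr rfl fun x _ => by by_cases h : V x = 0 <;> simp [h]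
  rw [h1] at hk
  have hk' : (univ.filter (fun x => V x ≠ 0)).card ≤ k := by exact_mod_cast hk
  have h2 := le_headk V _ hk'
  rw [sum_filter_ne_zero] at h2
  exact le_antisymm (sub_nonpos.2 h2) (tailk_nonneg hV k)

/-- B2. -/
lemma le_tailk {V : X → ℝ} (hV : ∀ x, 0 ≤ V x) (W : Finset X) {m : ℝ} (hm : 0 ≤ m)
    (hW : ∀ x ∈ W, m ≤ V x) (k : ℕ) : ((W.card : ℝ) - k) * m ≤ tailk V k := by
  classical
  unfold tailk
  have : headk V k ≤ ∑ x, V x - ((W.card : ℝ) - k) * m := by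
    refine headk_le fun A hA => ?_
    have h1 : ((W \ A).card : ℝ) * m ≤ ∑ x ∈ W \ A, V x := by
      rw [← nsmul_eq_mul]
      exact card_nsmul_le_sum _ _ _ fun x hx => hW x (mem_sdiff.1 hx).1
    have h2 : ∑ x ∈ W \ A, V x + ∑ x ∈ A, V x ≤ ∑ x, V x := by
      rw [← sum_union sdiff_disjoint]
      exact sum_le_univ_sum_of_nonneg hV
    have h3 : (W.card : ℝ) - k ≤ ((W \ A).card : ℝ) := by
      have := le_card_sdiff A W
      have h4 : W.card ≤ (W \ A).card + k := by omega
      have : (W.card : ℝ) ≤ (W \ A).card + k := by exact_mod_cast h4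
      linarith
    nlinarith
  linarith

/-- B3. -/
lemma le_headk' {V : X → ℝ} (W : Finset X) {m : ℝ} (hm : 0 ≤ m)
    (hW : ∀ x ∈ W, m ≤ V x) (k : ℕ) {r : ℝ} (hr : r ≤ W.card) (hrk : r ≤ k) :
    r * m ≤ headk V k := by
  classical
  obtain ⟨A, hA, hAc⟩ := exists_subset_card_eq (s := W) (n := min k W.card) (min_le_right _ _)
  refine le_trans ?_ (le_headk V A (by rw [hAc]; exact min_le_left _ _))
  have h1 : (A.card : ℝ) * m ≤ ∑ x ∈ A, V x := by
    rw [← nsmul_eq_mul]; exact card_nsmul_le_sum _ _ _ fun x hx => hW x (hA hx)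
  refine le_trans (mul_le_mul_of_nonneg_right ?_ hm) h1
  rw [hAc]; push_cast; exact le_min hrk hr

/-- B4 for `β < 1`. -/
lemma headk_le_rpow {V : X → ℝ} (hV : ∀ x, 0 ≤ V x) (h0 : ∃ x, 0 < V x) {k : ℕ} (hk : 1 ≤ k)
    {β : ℝ} (hβ : 0 ≤ β) (hβ1 : β < 1) :
    headk V k ≤ exp ((1 - β) * psi V (1 / (1 - β)) + β * log k) := by
  have hk0 : (0 : ℝ) < k := by exact_mod_cast hk
  refine headk_le fun A hA => ?_
  rcases hβ.eq_or_lt with rfl | hβ0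
  · have : psi V 1 = log (∑ x, V x) := by simp [psi, Sm_one]
    have hp : 0 < ∑ x, V x := by rw [← Sm_one]; exact Sm_pos hV h0 1
    simp only [sub_zero, div_one, one_mul, this, zero_mul, add_zero, exp_log hp]
    exact sum_le_univ_sum_of_nonneg hV
  · have hpq : (1 / (1 - β)).HolderConjugate (1 / β) := by
      rw [Real.holderConjugate_iff]
      refine ⟨?_, by simp⟩
      rw [lt_div_iff₀ (by linarith)]; linarith
    have h1 := Real.inner_le_Lp_mul_Lq_of_nonneg A hpq (f := V) (g := fun _ => 1)
      (fun i _ => hV i) (fun i _ => zero_le_one)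
    simp only [mul_one, one_rpow, sum_const, nsmul_eq_mul, one_div, inv_inv] at h1
    refine h1.trans ?_
    have hu : (1 - β)⁻¹ ≠ 0 := by
      have : 0 < (1 - β)⁻¹ := inv_pos.2 (by linarith)
      exact this.ne'
    have h2 : ∑ x ∈ A, V x ^ (1 - β)⁻¹ ≤ Sm V (1 - β)⁻¹ := by
      unfold Sm
      simp_rw [pw_of_ne hu]
      exact sum_le_univ_sum_of_nonneg fun x => rpow_nonneg (hV x) _
    rw [exp_add, one_div]
    have h3 : exp ((1 - β) * psi V (1 - β)⁻¹) = (Sm V (1 - β)⁻¹) ^ (1 - β) := by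
      rw [rpow_def_of_pos (Sm_pos hV h0 _), psi, mul_comm]
    have h4 : exp (β * log k) = (k : ℝ) ^ β := by rw [rpow_def_of_pos hk0, mul_comm]
    rw [h3, h4]
    refine mul_le_mul ?_ ?_ (rpow_nonneg (by positivity) _) (rpow_nonneg (Sm_nonneg hV _) _)
    · exact rpow_le_rpow (sum_nonneg fun x _ => rpow_nonneg (hV x) _) h2 (by linarith)
    · exact rpow_le_rpow (by positivity) (by exact_mod_cast hA) hβ

/-- B4 for `β = 1`. -/
lemma headk_le_max {V : X → ℝ} {C : ℝ} (hC : 0 ≤ C) (hV : ∀ x, V x ≤ C) (k : ℕ) :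
    headk V k ≤ k * C := by
  refine headk_le fun A hA => ?_
  calc ∑ x ∈ A, V x ≤ A.card • C := sum_le_card_nsmul _ _ _ fun x _ => hV x
    _ ≤ k * C := by
      rw [nsmul_eq_mul]; exact mul_le_mul_of_nonneg_right (by exact_mod_cast hA) hC

/-- Window lemma. -/
lemma window {V : X → ℝ} (hV : ∀ x, 0 ≤ V x) (h0 : ∃ x, 0 < V x) {s δ c e h : ℝ} (hδ : 0 < δ)
    (hs : 0 ≤ s)
    (h1 : psi V (s + δ) ≤ psi V s - δ * c + e) (h2 : psi V (s - δ) ≤ psi V s + δ * c + e)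
    (h3 : e - δ * h ≤ -log 4) :
    ∃ W : Finset X, (∀ x ∈ W, exp (-c - h) ≤ V x) ∧
      exp (psi V s + s * c - s * h - log 2) ≤ W.card := by
  classical
  set W := univ.filter (fun x => V x ≠ 0 ∧ |-log (V x) - c| ≤ h) with hW
  have hpos : ∀ x, V x ≠ 0 → 0 < V x := fun x hx => lt_of_le_of_ne (hV x) hx.symm
  have hS := Sm_pos hV h0 s
  have key : ∀ x, pw (V x) s ≤ (if x ∈ W then pw (V x) s else 0)
      + pw (V x) (s + δ) * exp (δ * c - δ * h) + pw (V x) (s - δ) * exp (- (δ * c) - δ * h) := by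
    intro x
    have n1 : 0 ≤ pw (V x) (s + δ) * exp (δ * c - δ * h) :=
      mul_nonneg (pw_nonneg (hV x) _) (exp_pos _).le
    have n2 : 0 ≤ pw (V x) (s - δ) * exp (- (δ * c) - δ * h) :=
      mul_nonneg (pw_nonneg (hV x) _) (exp_pos _).le
    by_cases hx : x ∈ W
    · rw [if_pos hx]; linarith
    rw [if_neg hx]
    by_cases hv : V x = 0
    · simp [hv]
    have hv' := hpos x hv
    have : ¬ |-log (V x) - c| ≤ h := fun h' => hx (by simp [hW, hv, h'])
    rw [not_le, lt_abs] at this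
    rcases this with h' | h'
    · have : pw (V x) s ≤ pw (V x) (s - δ) * exp (- (δ * c) - δ * h) := by
        rw [pw_of_pos hv', pw_of_pos hv', ← exp_add]
        apply exp_le_exp.2; nlinarith
      linarith
    · have : pw (V x) s ≤ pw (V x) (s + δ) * exp (δ * c - δ * h) := by
        rw [pw_of_pos hv', pw_of_pos hv', ← exp_add]
        apply exp_le_exp.2; nlinarith
      linarith
  have sumkey := sum_le_sum (fun x (_ : x ∈ univ) => key x)
  rw [sum_add_distrib, sum_add_distrib, ← sum_mul, ← sum_mul] at sumkey
  simp only [sum_ite_mem, univ_inter] at sumkey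
  change Sm V s ≤ ∑ x ∈ W, pw (V x) s + Sm V (s + δ) * _ + Sm V (s - δ) * _ at sumkey
  have e4 : exp (-log 4) = 1 / 4 := by rw [exp_neg, exp_log (by norm_num)]; norm_num
  have b1 : Sm V (s + δ) * exp (δ * c - δ * h) ≤ Sm V s * (1 / 4) := by
    rw [← exp_psi hV h0, ← exp_psi hV h0, ← e4, ← exp_add, ← exp_add]
    apply exp_le_exp.2; linarith
  have b2 : Sm V (s - δ) * exp (-(δ * c) - δ * h) ≤ Sm V s * (1 / 4) := by
    rw [← exp_psi hV h0, ← exp_psi hV h0, ← e4, ← exp_add, ← exp_add]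
    apply exp_le_exp.2; linarith
  have b3 : Sm V s / 2 ≤ ∑ x ∈ W, pw (V x) s := by linarith
  have b4 : ∑ x ∈ W, pw (V x) s ≤ W.card * exp (- s * c + s * h) := by
    rw [← nsmul_eq_mul]
    refine sum_le_card_nsmul _ _ _ fun x hx => ?_
    have hx' : V x ≠ 0 ∧ |-log (V x) - c| ≤ h := by simpa [hW] using hx
    rw [pw_of_pos (hpos x hx'.1)]
    apply exp_le_exp.2
    have := (abs_le.1 hx'.2).1
    nlinarith
  refine ⟨W, fun x hx => ?_, ?_⟩
  · have hx' : V x ≠ 0 ∧ |-log (V x) - c| ≤ h := by simpa [hW] using hx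
    have := (abs_le.1 hx'.2).2
    rw [← exp_log (hpos x hx'.1)]
    apply exp_le_exp.2; linarith
  · have b5 := b3.trans b4
    rw [exp_sub, exp_log (by norm_num : (0:ℝ) < 2)]
    have : psi V s + s * c - s * h = psi V s - (- s * c + s * h) := by ring
    rw [this, exp_sub, exp_psi hV h0, div_div, div_le_iff₀ (by positivity)]
    nlinarith

end CM

namespace CM

open Real Finset

/-! ### Hardy-Littlewood-Polya and the majorization criterion -/

lemma abel_nonneg {m : ℕ} (c d : Fin m → ℝ) (hc : Antitone c)
    (hd : ∀ k ≤ m, 0 ≤ ∑ i ∈ univ.filter (fun i : Fin m => i.val < k), d i)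
    (hd0 : ∑ i, d i = 0) : 0 ≤ ∑ i, c i * d i := by
  set f : ℕ → ℝ := fun i => if h : i < m then c ⟨i, h⟩ else 0 with hf
  set g : ℕ → ℝ := fun i => if h : i < m then d ⟨i, h⟩ else 0 with hg
  have hfi : ∀ i : Fin m, f i = c i := fun i => by simp [hf]
  have hgi : ∀ i : Fin m, g i = d i := fun i => by simp [hg]
  have h1 : ∑ i, c i * d i = ∑ i ∈ range m, f i * g i := by
    rw [Finset.sum_range]; simp only [hfi, hgi]
  have hG : ∀ k ≤ m, ∑ i ∈ range k, g i = ∑ i ∈ univ.filter (fun i : Fin m => i.val < k), d i := by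
    intro k hk
    rw [sum_filter]
    have : ∑ i : Fin m, (if i.val < k then d i else 0)
        = ∑ i ∈ range m, (if i < k then g i else 0) := by
      rw [Finset.sum_range]; simp only [hgi]
    rw [this, ← sum_filter]
    congr 1; ext i; simp; omega
  rw [h1]
  have := Finset.sum_range_by_parts f g m
  simp only [smul_eq_mul] at this
  rw [this]
  have h0 : ∑ i ∈ range m, g i = 0 := by
    rw [Finset.sum_range]; simp only [hgi]; exact hd0
  rw [h0, mul_zero, zero_sub, neg_nonneg]
  refine sum_nonpos fun i hi => ?_
  have hi' : i + 1 < m := by have := mem_range.1 hi; omega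
  refine mul_nonpos_of_nonpos_of_nonneg ?_ ?_
  · have h2 : f (i + 1) = c ⟨i + 1, hi'⟩ := by simp [hf, hi']
    have h3 : f i = c ⟨i, by omega⟩ := by simp [hf, show i < m by omega]
    rw [h2, h3, sub_nonpos]
    exact hc (by simp [Fin.le_def])
  · rw [hG _ hi'.le]; exact hd _ hi'.le

lemma hlp {m : ℕ} (u v : Fin m → ℝ)
    (h : ∀ A : Finset (Fin m), ∑ i ∈ A, u i ≤ ∑ i ∈ univ.filter (fun i : Fin m => i.val < A.card), v i)
    (ht : ∑ i, u i = ∑ i, v i) :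
    ∃ S ∈ doublyStochastic ℝ (Fin m), u = S.mulVec v := by
  set R := Set.range (fun σ : Equiv.Perm (Fin m) => v ∘ σ) with hR
  have hsub : convexHull ℝ R ⊆ {u | ∃ S ∈ doublyStochastic ℝ (Fin m), u = S.mulVec v} := by
    refine convexHull_min ?_ ?_
    · rintro _ ⟨σ, rfl⟩
      exact ⟨_, permMatrix_mem_doublyStochastic (σ := σ), (Matrix.permMatrix_mulVec σ).symm⟩
    · rintro _ ⟨S, hS, rfl⟩ _ ⟨T, hT, rfl⟩ a b ha hb hab
      refine ⟨a • S + b • T, convex_doublyStochastic hS hT ha hb hab, ?_⟩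
      rw [Matrix.add_mulVec, Matrix.smul_mulVec, Matrix.smul_mulVec]
  apply hsub
  by_contra hu
  obtain ⟨f, r, hf1, hf2⟩ := geometric_hahn_banach_closed_point (convex_convexHull ℝ R)
    ((Set.finite_range _).isClosed_convexHull ℝ) hu
  set c : Fin m → ℝ := fun i => f (fun j => if i = j then 1 else 0) with hc
  have hfc : ∀ x, f x = ∑ i, c i * x i := by
    intro x
    have := LinearMap.pi_apply_eq_sum_univ (f : (Fin m → ℝ) →ₗ[ℝ] ℝ) x
    simp only [ContinuousLinearMap.coe_coe, smul_eq_mul] at this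
    rw [this]; exact sum_congr rfl fun i _ => mul_comm _ _
  set σ := Tuple.sort (fun i => - c i) with hσ
  have hmono : Antitone (c ∘ σ) := by
    intro i j hij
    have := Tuple.monotone_sort (fun i => - c i) hij
    simp only [Function.comp] at this ⊢
    linarith
  have h1 : f (v ∘ σ.symm) = ∑ j, (c ∘ σ) j * v j := by
    rw [hfc, ← Equiv.sum_comp σ]; simp
  have h2 : f u = ∑ j, (c ∘ σ) j * (u ∘ σ) j := by
    rw [hfc, ← Equiv.sum_comp σ]; simp
  have h3 : f (v ∘ σ.symm) < f u :=
    (hf1 _ (subset_convexHull ℝ R ⟨σ.symm, rfl⟩)).trans hf2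
  have h4 := abel_nonneg (c ∘ σ) (fun j => v j - u (σ j)) hmono ?_ ?_
  · simp only [mul_sub, sum_sub_distrib] at h4
    rw [h1, h2] at h3
    simp only [Function.comp] at *
    linarith
  · intro k hk
    rw [sum_sub_distrib, sub_nonneg]
    have hh := h ((univ.filter (fun i : Fin m => i.val < k)).map σ.toEmbedding)
    rw [sum_map, card_map] at hh
    have hcard : (univ.filter (fun i : Fin m => i.val < k)).card = k := by
      rw [Fin.card_filter_val_lt]; exact min_eq_right hk
    rw [hcard] at hh
    exact hh
  · rw [sum_sub_distrib, Equiv.sum_comp σ u]; linarith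

lemma sum_le_sorted {m : ℕ} (v : Fin m → ℝ) (hv : Antitone v) (h0 : ∀ i, 0 ≤ v i)
    (A : Finset (Fin m)) {k : ℕ} (hA : A.card ≤ k) :
    ∑ i ∈ A, v i ≤ ∑ i ∈ univ.filter (fun i : Fin m => i.val < k), v i := by
  set I := univ.filter (fun i : Fin m => i.val < k) with hI
  by_cases hk : k < m
  · have hIc : I.card = k := by rw [hI, Fin.card_filter_val_lt]; exact min_eq_right hk.le
    set c := v ⟨k, hk⟩ with hc
    have hc0 : 0 ≤ c := h0 _
    have e1 : ∑ i ∈ A \ I, v i ≤ (A \ I).card • c := by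
      refine sum_le_card_nsmul _ _ _ fun i hi => hv ?_
      have := (mem_sdiff.1 hi).2
      simp [hI] at this
      exact this
    have e2 : (I \ A).card • c ≤ ∑ i ∈ I \ A, v i := by
      refine card_nsmul_le_sum _ _ _ fun i hi => hv ?_
      have := (mem_sdiff.1 hi).1
      simp [hI] at this
      exact this.le
    have e3 : (A \ I).card ≤ (I \ A).card := by
      have a1 := card_sdiff_add_card_inter A I
      have a2 := card_sdiff_add_card_inter I A
      rw [inter_comm] at a2
      omega
    have e4 : ((A \ I).card : ℝ) * c ≤ (I \ A).card * c :=
      mul_le_mul_of_nonneg_right (by exact_mod_cast e3) hc0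
    rw [nsmul_eq_mul] at e1 e2
    have a1 := sum_inter_add_sum_sdiff A I v
    have a2 := sum_inter_add_sum_sdiff I A v
    rw [inter_comm] at a2
    linarith
  · have : I = univ := by ext i; simp [hI]; omega
    rw [this]; exact sum_le_univ_sum_of_nonneg h0

lemma condMixed_of_fintype {X Y Y' ι : Type*} [Fintype X] [Fintype Y] [Fintype Y'] [Fintype ι]
    (P : Matrix X Y ℝ) (Q : Matrix X Y' ℝ) (S : ι → Matrix X X ℝ) (D : ι → Matrix Y Y' ℝ)
    (h1 : ∀ i, DoublyStochastic (S i)) (h2 : ∀ i a b, 0 ≤ D i a b)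
    (h3 : ∀ a, ∑ b, ∑ i, D i a b = 1) (h4 : Q = ∑ i, S i * P * D i) : CondMixed P Q := by
  let e := (Fintype.equivFin ι).symm
  refine ⟨Fintype.card ι, fun i => S (e i), fun i => D (e i), fun i => h1 _, fun i => h2 _, ?_, ?_⟩
  · intro a
    rw [← h3 a]
    exact sum_congr rfl fun b _ => Equiv.sum_comp e (fun i => D i a b)
  · rw [h4]; exact (Equiv.sum_comp e (fun i => S i * P * D i)).symm

lemma condMixed_of_head {m : ℕ} {Y Y' : Type*} [Fintype Y] [Fintype Y']
    (P : Matrix (Fin m) Y ℝ) (Q : Matrix (Fin m) Y' ℝ) (hP : ∀ x y, 0 ≤ P x y)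
    (w : Y → Y' → ℝ) (hw : ∀ y y', 0 ≤ w y y') (hw1 : ∀ y, ∑ y', w y y' = 1)
    (htot : ∀ y', ∑ y, w y y' * ∑ x, P x y = ∑ x, Q x y')
    (hh : ∀ y' k, headk (fun x => Q x y') k ≤ ∑ y, w y y' * headk (fun x => P x y) k) :
    CondMixed P Q := by
  classical
  set σ : Y → Equiv.Perm (Fin m) := fun y => Tuple.sort (fun i => - P i y) with hσ
  have hanti : ∀ y, Antitone (fun i => P (σ y i) y) := by
    intro y i j hij
    have := Tuple.monotone_sort (fun i => - P i y) hij
    simp only [Function.comp] at this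
    show P (σ y j) y ≤ P (σ y i) y
    simp only [hσ]; linarith
  have hhead : ∀ y k, headk (fun x => P x y) k
      ≤ ∑ i ∈ univ.filter (fun i : Fin m => i.val < k), P (σ y i) y := by
    intro y k
    refine headk_le fun A hA => ?_
    have := sum_le_sorted (fun i => P (σ y i) y) (hanti y) (fun i => hP _ _)
      (A.map (σ y).symm.toEmbedding) (k := k) (by rwa [card_map])
    rw [sum_map] at this
    simpa using this
  have key : ∀ y', ∃ S ∈ doublyStochastic ℝ (Fin m),
      (fun x => Q x y') = S.mulVec (fun i => ∑ y, w y y' * P (σ y i) y) := by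
    intro y'
    refine hlp _ _ (fun A => ?_) ?_
    · refine (le_headk (fun x => Q x y') A le_rfl).trans ((hh y' _).trans ?_)
      rw [sum_comm]
      refine sum_le_sum fun y _ => ?_
      rw [← mul_sum]
      exact mul_le_mul_of_nonneg_left (hhead y _) (hw y y')
    · rw [← htot, sum_comm]
      refine sum_congr rfl fun y _ => ?_
      rw [← mul_sum]
      congr 1
      exact (Equiv.sum_comp (σ y) (fun i => P i y)).symm
  choose S hS hQ using key
  refine condMixed_of_fintype P Q (ι := Y × Y')
    (fun i => S i.2 * Equiv.Perm.permMatrix ℝ (σ i.1))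
    (fun i => Matrix.of fun a b => if a = i.1 ∧ b = i.2 then w a b else 0) ?_ ?_ ?_ ?_
  · intro i
    have := mul_mem (hS i.2) (permMatrix_mem_doublyStochastic (σ := σ i.1) (R := ℝ))
    exact mem_doublyStochastic_iff_sum.1 this
  · intro i a b
    simp only [Matrix.of_apply]
    split_ifs
    · exact hw _ _
    · exact le_rfl
  · intro a
    rw [← hw1 a]
    refine sum_congr rfl fun b _ => ?_
    rw [Fintype.sum_eq_single (a, b)]
    · simp
    · rintro ⟨y, y'⟩ hne
      simp only [Matrix.of_apply]
      rw [if_neg]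
      rintro ⟨rfl, rfl⟩; exact hne rfl
  · ext x b
    have hq : Q x b = (S b).mulVec (fun i => ∑ y, w y b * P (σ y i) y) x := congrFun (hQ b) x
    rw [hq, Matrix.sum_apply]
    have hterm : ∀ i : Y × Y', ((S i.2 * Equiv.Perm.permMatrix ℝ (σ i.1)) * P *
        Matrix.of (fun a b => if a = i.1 ∧ b = i.2 then w a b else 0)) x b
        = if b = i.2 then w i.1 i.2 * (S i.2).mulVec (fun j => P (σ i.1 j) i.1) x else 0 := by
      intro i
      rw [Matrix.mul_apply]
      rw [Fintype.sum_eq_single i.1]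
      · simp only [Matrix.of_apply, true_and]
        split_ifs with hb
        · rw [hb, mul_comm, Matrix.mul_assoc, Matrix.mul_apply_eq_vecMul]
          congr 1
          rw [← Matrix.mul_apply_eq_vecMul, Matrix.mul_apply, Matrix.mulVec, dotProduct]
          refine sum_congr rfl fun j _ => ?_
          congr 1
          have := congrFun (Matrix.permMatrix_mulVec (σ i.1) (v := fun x => P x i.1)) j
          simpa [Matrix.mulVec, dotProduct, Matrix.mul_apply] using this
        · simp
      · intro a ha
        simp [ha]
    rw [sum_congr rfl fun i _ => hterm i, Fintype.sum_prod_type]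
    simp only [sum_ite_eq, mem_univ, if_true]
    simp only [Matrix.mulVec, dotProduct, mul_sum]
    rw [sum_comm]
    refine sum_congr rfl fun y _ => sum_congr rfl fun i _ => ?_
    ring

lemma headk_extend {X Z : Type*} [Fintype X] [Fintype Z] (f : X → Z) (hf : Function.Injective f)
    (V : X → ℝ) (V' : Z → ℝ) (h1 : ∀ x, V' (f x) = V x) (h2 : ∀ z, (¬ ∃ x, f x = z) → V' z = 0)
    (k : ℕ) : headk V' k = headk V k := by
  classical
  apply le_antisymm
  · refine headk_le fun A hA => ?_
    have hB : ((univ.filter (fun x => f x ∈ A))).card ≤ k := by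
      refine le_trans ?_ hA
      exact card_le_card_of_injOn f (fun x hx => by simpa using hx) hf.injOn
    refine le_trans (le_of_eq ?_) (le_headk V _ hB)
    have : ∑ x ∈ univ.filter (fun x => f x ∈ A), V x
        = ∑ z ∈ (univ.filter (fun x => f x ∈ A)).image f, V' z := by
      rw [sum_image hf.injOn]; exact sum_congr rfl fun x _ => (h1 x).symm
    rw [this]
    symm
    refine sum_subset ?_ ?_
    · intro z hz
      obtain ⟨x, hx, rfl⟩ := mem_image.1 hz
      simpa using hx
    · intro z hz hz'
      apply h2
      rintro ⟨x, rfl⟩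
      exact hz' (mem_image_of_mem f (by simpa using hz))
  · refine headk_le fun A hA => ?_
    refine le_trans (le_of_eq ?_) (le_headk V' (A.image f) (card_image_le.trans hA))
    rw [sum_image hf.injOn]; exact sum_congr rfl fun x _ => (h1 x).symm

lemma sum_extend {X Z : Type*} [Fintype X] [Fintype Z] (f : X → Z) (hf : Function.Injective f)
    (V : X → ℝ) (V' : Z → ℝ) (h1 : ∀ x, V' (f x) = V x)
    (h2 : ∀ z, (¬ ∃ x, f x = z) → V' z = 0) : ∑ z, V' z = ∑ x, V x := by
  classical
  have : ∑ x, V x = ∑ z ∈ univ.image f, V' z := by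
    rw [sum_image hf.injOn]; exact sum_congr rfl fun x _ => (h1 x).symm
  rw [this]; symm
  refine sum_subset (subset_univ _) fun z _ hz => h2 z ?_
  rintro ⟨x, rfl⟩; exact hz (mem_image_of_mem f (mem_univ x))

theorem criterion0 {X Y X' Y' : Type*} [Fintype X] [Fintype Y] [Fintype X'] [Fintype Y']
    (P : Matrix X Y ℝ) (Q : Matrix X' Y' ℝ) (hP : ∀ x y, 0 ≤ P x y)
    (w : Y → Y' → ℝ) (hw : ∀ y y', 0 ≤ w y y') (hw1 : ∀ y, ∑ y', w y y' = 1)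
    (htot : ∀ y', ∑ y, w y y' * ∑ x, P x y = ∑ x, Q x y')
    (hh : ∀ y' k, headk (fun x => Q x y') k ≤ ∑ y, w y y' * headk (fun x => P x y) k) :
    CondMajorizes P Q := by
  classical
  let e := Fintype.equivFin (X ⊕ X')
  let eY := Fintype.equivFin Y
  let eY' := Fintype.equivFin Y'
  let f : X ↪ Fin (Fintype.card (X ⊕ X')) := ⟨fun x => e (Sum.inl x), fun a b h => by simpa using h⟩
  let f' : X' ↪ Fin (Fintype.card (X ⊕ X')) := ⟨fun x => e (Sum.inr x), fun a b h => by simpa using h⟩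
  let P' : Matrix (Fin (Fintype.card (X ⊕ X'))) (Fin (Fintype.card Y)) ℝ :=
    fun i j => Function.extend f (fun x => P x (eY.symm j)) 0 i
  let Q' : Matrix (Fin (Fintype.card (X ⊕ X'))) (Fin (Fintype.card Y')) ℝ :=
    fun i j => Function.extend f' (fun x => Q x (eY'.symm j)) 0 i
  have a1 : ∀ x j, P' (f x) j = P x (eY.symm j) := fun x j => f.injective.extend_apply _ _ _
  have a2 : ∀ i j, (¬ ∃ x, f x = i) → P' i j = 0 := fun i j h => Function.extend_apply' _ _ _ h
  have b1 : ∀ x j, Q' (f' x) j = Q x (eY'.symm j) := fun x j => f'.injective.extend_apply _ _ _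
  have b2 : ∀ i j, (¬ ∃ x, f' x = i) → Q' i j = 0 := fun i j h => Function.extend_apply' _ _ _ h
  refine ⟨_, _, _, P', Q', ⟨f, eY.toEmbedding, ?_, ?_⟩, ⟨f', eY'.toEmbedding, ?_, ?_⟩, ?_⟩
  · intro x y; rw [a1]; simp
  · intro i j hne
    refine ⟨?_, eY.symm j, by simp⟩
    by_contra h; exact hne (a2 i j h)
  · intro x y; rw [b1]; simp
  · intro i j hne
    refine ⟨?_, eY'.symm j, by simp⟩
    by_contra h; exact hne (b2 i j h)
  · have hPs : ∀ j, ∑ i, P' i j = ∑ x, P x (eY.symm j) := fun j =>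
      sum_extend f f.injective (fun x => P x (eY.symm j)) (fun i => P' i j) (fun x => a1 x j)
        (fun i hi => a2 i j hi)
    have hQs : ∀ j, ∑ i, Q' i j = ∑ x, Q x (eY'.symm j) := fun j =>
      sum_extend f' f'.injective (fun x => Q x (eY'.symm j)) (fun i => Q' i j) (fun x => b1 x j)
        (fun i hi => b2 i j hi)
    have hPh : ∀ j k, headk (fun i => P' i j) k = headk (fun x => P x (eY.symm j)) k := fun j =>
      headk_extend f f.injective (fun x => P x (eY.symm j)) (fun i => P' i j) (fun x => a1 x j)
        (fun i hi => a2 i j hi)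
    have hQh : ∀ j k, headk (fun i => Q' i j) k = headk (fun x => Q x (eY'.symm j)) k := fun j =>
      headk_extend f' f'.injective (fun x => Q x (eY'.symm j)) (fun i => Q' i j) (fun x => b1 x j)
        (fun i hi => b2 i j hi)
    refine condMixed_of_head P' Q' ?_ (fun j j' => w (eY.symm j) (eY'.symm j')) (fun _ _ => hw _ _)
      ?_ ?_ ?_
    · intro i j
      by_cases h : ∃ x, f x = i
      · obtain ⟨x, rfl⟩ := h; rw [a1]; exact hP _ _
      · rw [a2 i j h]
    · intro j
      rw [← hw1 (eY.symm j)]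
      exact Equiv.sum_comp eY'.symm (fun y' => w (eY.symm j) y')
    · intro j'
      rw [hQs, ← htot]
      simp only [hPs]
      exact Equiv.sum_comp eY.symm (fun y => w y (eY'.symm j') * ∑ x, P x y)
    · intro j' k
      rw [hQh]
      refine (hh _ k).trans (le_of_eq ?_)
      simp only [hPh]
      exact (Equiv.sum_comp eY.symm (fun y => w y (eY'.symm j') * headk (fun x => P x y) k)).symm

/-- Data-level form of the criterion: heads `h` and totals `t` of the columns. -/
def CritF {Y Y' : Type*} [Fintype Y] [Fintype Y'] (h : Y → ℕ → ℝ) (t : Y → ℝ)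
    (h' : Y' → ℕ → ℝ) (t' : Y' → ℝ) : Prop :=
  ∃ w : Y → Y' → ℝ, (∀ y y', 0 ≤ w y y') ∧ (∀ y, ∑ y', w y y' = 1) ∧
    (∀ y', ∑ y, w y y' * t y = t' y') ∧ (∀ y' k, h' y' k ≤ ∑ y, w y y' * h y k)

/-- The criterion for matrices. -/
def Crit {X Y X' Y' : Type*} [Fintype X] [Fintype Y] [Fintype X'] [Fintype Y']
    (P : Matrix X Y ℝ) (Q : Matrix X' Y' ℝ) : Prop :=
  CritF (fun y k => headk (fun x => P x y) k) (fun y => ∑ x, P x y)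
    (fun y k => headk (fun x => Q x y) k) (fun y => ∑ x, Q x y)

theorem Crit.condMajorizes {X Y X' Y' : Type*} [Fintype X] [Fintype Y] [Fintype X'] [Fintype Y']
    {P : Matrix X Y ℝ} {Q : Matrix X' Y' ℝ} (hP : ∀ x y, 0 ≤ P x y) (h : Crit P Q) :
    CondMajorizes P Q := by
  obtain ⟨w, h1, h2, h3, h4⟩ := h
  exact criterion0 P Q hP w h1 h2 h3 h4

lemma CritF.ext {Y Y' Y0 Y0' : Type*} [Fintype Y] [Fintype Y']
    [Fintype Y0] [Fintype Y0'] [Nonempty Y0'] {h0 : Y0 → ℕ → ℝ} {t0 : Y0 → ℝ}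
    {h0' : Y0' → ℕ → ℝ} {t0' : Y0' → ℝ} {h : Y → ℕ → ℝ} {t : Y → ℝ}
    {h' : Y' → ℕ → ℝ} {t' : Y' → ℝ}
    (g : Y0 → Y) (hg : Function.Injective g) (g' : Y0' → Y') (hg' : Function.Injective g')
    (ht : ∀ y, t (g y) = t0 y) (ht' : ∀ y, t' (g' y) = t0' y)
    (hh : ∀ y k, h (g y) k = h0 y k) (hh' : ∀ y k, h' (g' y) k = h0' y k)
    (hsum0 : ∀ y, (¬ ∃ y0, g y0 = y) → t y = 0)
    (hsum0' : ∀ y, (¬ ∃ y0, g' y0 = y) → t' y = 0)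
    (hhead0 : ∀ y k, (¬ ∃ y0, g y0 = y) → h y k = 0)
    (hhead0' : ∀ y k, (¬ ∃ y0, g' y0 = y) → h' y k = 0)
    (hc : CritF h0 t0 h0' t0') : CritF h t h' t' := by
  classical
  obtain ⟨w, hw, hw1, htot, hhd⟩ := hc
  obtain ⟨y1⟩ := (inferInstance : Nonempty Y0')
  set w' : Y → Y' → ℝ := fun y => Function.extend g' (fun y0' =>
    Function.extend g (fun y0 => w y0 y0') (fun _ => if y0' = y1 then 1 else 0) y) 0 with hw'
  have e1 : ∀ y y0', w' y (g' y0') = Function.extend g (fun y0 => w y0 y0')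
      (fun _ => if y0' = y1 then 1 else 0) y := fun y y0' => hg'.extend_apply _ _ _
  have e2 : ∀ y0 y0', w' (g y0) (g' y0') = w y0 y0' := fun y0 y0' => by
    rw [e1]; exact hg.extend_apply _ _ _
  have e3 : ∀ y y0', (¬ ∃ y0, g y0 = y) → w' y (g' y0') = if y0' = y1 then 1 else 0 :=
    fun y y0' h => by rw [e1]; exact Function.extend_apply' _ _ _ h
  have e4 : ∀ y y', (¬ ∃ y0', g' y0' = y') → w' y y' = 0 := fun y y' h =>
    Function.extend_apply' _ _ _ h
  refine ⟨w', ?_, ?_, ?_, ?_⟩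
  · intro y y'
    by_cases h' : ∃ y0', g' y0' = y'
    · obtain ⟨y0', rfl⟩ := h'
      by_cases h : ∃ y0, g y0 = y
      · obtain ⟨y0, rfl⟩ := h; rw [e2]; exact hw _ _
      · rw [e3 _ _ h]; split_ifs <;> norm_num
    · rw [e4 _ _ h']
  · intro y
    rw [sum_extend g' hg' (fun y0' => w' y (g' y0')) (w' y) (fun _ => rfl) (fun z hz => e4 y z hz)]
    by_cases h : ∃ y0, g y0 = y
    · obtain ⟨y0, rfl⟩ := h; simp only [e2]; exact hw1 _
    · simp only [e3 _ _ h]; simp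
  · intro y'
    by_cases h' : ∃ y0', g' y0' = y'
    · obtain ⟨y0', rfl⟩ := h'
      rw [ht', ← htot]
      refine sum_extend g hg _ _ (fun y0 => by rw [e2, ht])
        (fun y hy => by rw [hsum0 y hy, mul_zero])
    · simp [e4 _ _ h', hsum0' _ h']
  · intro y' k
    by_cases h' : ∃ y0', g' y0' = y'
    · obtain ⟨y0', rfl⟩ := h'
      rw [hh']
      refine (hhd y0' k).trans (le_of_eq ?_)
      symm
      refine sum_extend g hg _ _ (fun y0 => by rw [e2, hh])
        (fun y hy => by rw [hhead0 y k hy, mul_zero])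
    · simp [e4 _ _ h', hhead0' _ k h']

lemma Embeds.heads {X Y X' Y' : Type*} [Fintype X] [Fintype Y] [Fintype X'] [Fintype Y']
    {P : Matrix X Y ℝ} {P' : Matrix X' Y' ℝ} (h : Embeds P P') :
    ∃ g : Y → Y', Function.Injective g ∧ (∀ y, ∑ x, P' x (g y) = ∑ x, P x y) ∧
      (∀ y k, headk (fun x => P' x (g y)) k = headk (fun x => P x y) k) ∧
      (∀ y, (¬ ∃ y0, g y0 = y) → ∑ x, P' x y = 0) ∧
      (∀ y k, (¬ ∃ y0, g y0 = y) → headk (fun x => P' x y) k = 0) := by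
  obtain ⟨f, g, h1, h2⟩ := h
  have hz : ∀ x' y', (¬ ∃ x, f x = x') → P' x' y' = 0 := fun x' y' h => by
    by_contra hne; exact h (h2 x' y' hne).1
  have hz' : ∀ x' y', (¬ ∃ y, g y = y') → P' x' y' = 0 := fun x' y' h => by
    by_contra hne; exact h (h2 x' y' hne).2
  refine ⟨g, g.injective, fun y => ?_, fun y k => ?_, fun y hy => ?_, fun y k hy => ?_⟩
  · exact sum_extend f f.injective _ _ (fun x => h1 x y) (fun z hz1 => hz z _ hz1)
  · exact headk_extend f f.injective _ _ (fun x => h1 x y) (fun z hz1 => hz z _ hz1) k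
  · exact sum_eq_zero fun x _ => hz' x y hy
  · exact le_antisymm (headk_le fun A _ => by simp [hz' _ y hy]) (headk_nonneg _ _)

theorem Crit.embeds {X Y X' Y' A B A' B' : Type*} [Fintype X] [Fintype Y] [Fintype X'] [Fintype Y']
    [Fintype A] [Fintype B] [Fintype A'] [Fintype B'] [Nonempty B]
    {P : Matrix X Y ℝ} {P' : Matrix X' Y' ℝ} {Q : Matrix A B ℝ} {Q' : Matrix A' B' ℝ}
    (h : Embeds P P') (h' : Embeds Q Q') (hc : Crit P Q) : Crit P' Q' := by
  obtain ⟨g, g1, g2, g3, g4, g5⟩ := Embeds.heads h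
  obtain ⟨f, f1, f2, f3, f4, f5⟩ := Embeds.heads h'
  exact CritF.ext g g1 f f1 g2 f2 g3 f3 g4 f4 g5 f5 hc

theorem Embeds.trans {X Y X' Y' A B : Type*} [Fintype X] [Fintype Y] [Fintype X']
    [Fintype Y'] [Fintype A] [Fintype B]
    {P : Matrix X Y ℝ} {P' : Matrix X' Y' ℝ} {P'' : Matrix A B ℝ}
    (h : Embeds P P') (h' : Embeds P' P'') : Embeds P P'' := by
  obtain ⟨f, g, h1, h2⟩ := h
  obtain ⟨f', g', h1', h2'⟩ := h'
  refine ⟨f.trans f', g.trans g', fun x y => ?_, fun x y hne => ?_⟩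
  · simp [h1, h1']
  · obtain ⟨⟨x', rfl⟩, ⟨y', rfl⟩⟩ := h2' x y hne
    rw [h1'] at hne
    obtain ⟨⟨x', rfl⟩, ⟨y', rfl⟩⟩ := h2 _ _ hne
    exact ⟨⟨x', rfl⟩, ⟨y', rfl⟩⟩

theorem CondMajorizes.of_embeds {X Y X' Y' A B A' B' : Type*} [Fintype X] [Fintype Y] [Fintype X']
    [Fintype Y'] [Fintype A] [Fintype B] [Fintype A'] [Fintype B']
    {P : Matrix X Y ℝ} {P' : Matrix X' Y' ℝ} {Q : Matrix A B ℝ} {Q' : Matrix A' B' ℝ}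
    (h : Embeds P P') (h' : Embeds Q Q') (hc : CondMajorizes P' Q') : CondMajorizes P Q := by
  obtain ⟨m, n, n', P2, Q2, e1, e2, e3⟩ := hc
  exact ⟨m, n, n', P2, Q2, Embeds.trans h e1, Embeds.trans h' e2, e3⟩

lemma Embeds.kronPow {X Y X' Y' : Type*} [Fintype X] [Fintype Y] [Fintype X'] [Fintype Y']
    {P : Matrix X Y ℝ} {P' : Matrix X' Y' ℝ} (h : Embeds P P') (n : ℕ) :
    Embeds (kronPow P n) (kronPow P' n) := by
  obtain ⟨f, g, h1, h2⟩ := h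
  refine ⟨⟨fun x i => f (x i), fun a b hab => ?_⟩, ⟨fun x i => g (x i), fun a b hab => ?_⟩, ?_, ?_⟩
  · funext i; exact f.injective (congrFun hab i)
  · funext i; exact g.injective (congrFun hab i)
  · intro x y
    simp only [_root_.kronPow, Matrix.of_apply]
    exact prod_congr rfl fun i _ => h1 _ _
  · intro x y hne
    have hne' : ∀ i, P' (x i) (y i) ≠ 0 := by
      simp only [_root_.kronPow, Matrix.of_apply, prod_ne_zero_iff] at hne
      exact fun i => hne i (mem_univ i)
    choose a ha using fun i => (h2 _ _ (hne' i)).1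
    choose b hb using fun i => (h2 _ _ (hne' i)).2
    exact ⟨⟨a, funext ha⟩, ⟨b, funext hb⟩⟩

lemma Embeds.kron {X Y X' Y' A B : Type*} [Fintype X] [Fintype Y] [Fintype X'] [Fintype Y']
    [Fintype A] [Fintype B]
    {P : Matrix X Y ℝ} {P' : Matrix X' Y' ℝ} (h : Embeds P P') (R : Matrix A B ℝ) :
    Embeds (kron P R) (kron P' R) := by
  obtain ⟨f, g, h1, h2⟩ := h
  refine ⟨f.prodMap (Function.Embedding.refl A), g.prodMap (Function.Embedding.refl B), ?_, ?_⟩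
  · intro x y; simp [_root_.kron, h1]
  · intro x y hne
    simp only [_root_.kron, Matrix.of_apply] at hne
    obtain ⟨⟨a, ha⟩, ⟨b, hb⟩⟩ := h2 _ _ (left_ne_zero_of_mul hne)
    exact ⟨⟨(a, x.2), by ext <;> simp [ha]⟩, ⟨(b, y.2), by ext <;> simp [hb]⟩⟩

/-! ### From large samples to catalysts -/

section catalytic
variable {Z W : Type*} [Fintype Z] [Fintype W]

/-- Mixed tensor power. -/
def mixT (P Q : Matrix Z W ℝ) (N k : ℕ) : Matrix (Fin N → Z) (Fin N → W) ℝ :=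
  Matrix.of fun x y => ∏ i, if i.val < k then P (x i) (y i) else Q (x i) (y i)

/-- The catalyst. -/
def catR (P Q : Matrix Z W ℝ) (N : ℕ) : Matrix (Fin N → Z) (Fin (N + 1) × (Fin N → W)) ℝ :=
  Matrix.of fun x y => ((N : ℝ) + 1)⁻¹ * mixT P Q N y.1.val x y.2

lemma catalytic_crit (P Q : Matrix Z W ℝ) (N : ℕ)
    (h : Crit (kronPow P (N + 1)) (kronPow Q (N + 1))) :
    Crit (kron P (catR P Q N)) (kron Q (catR P Q N)) := by
  classical
  set c : ℝ := ((N : ℝ) + 1)⁻¹ with hc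
  have hc0 : 0 ≤ c := by positivity
  -- intermediate criterion
  have hT1 : mixT P Q (N + 1) (N + 1) = kronPow P (N + 1) := by
    ext x y; simp only [mixT, kronPow, Fin.is_lt, if_true]
  have hT0 : mixT P Q (N + 1) 0 = kronPow Q (N + 1) := by
    ext x y; simp [mixT, kronPow]
  have hmid : CritF (Y := Fin (N + 1) × (Fin (N + 1) → W)) (Y' := Fin (N + 1) × (Fin (N + 1) → W))
      (fun y k => c * headk (fun x => mixT P Q (N + 1) (y.1.val + 1) x y.2) k)
      (fun y => c * ∑ x, mixT P Q (N + 1) (y.1.val + 1) x y.2)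
      (fun y k => c * headk (fun x => mixT P Q (N + 1) y.1.val x y.2) k)
      (fun y => c * ∑ x, mixT P Q (N + 1) y.1.val x y.2) := by
    obtain ⟨w, h1, h2, h3, h4⟩ := h
    rw [← hT1, ← hT0] at h3 h4
    replace h3 : ∀ z, ∑ y, w y z * ∑ x, mixT P Q (N + 1) (N + 1) x y
      = ∑ x, mixT P Q (N + 1) 0 x z := h3
    replace h4 : ∀ z k, headk (fun x => mixT P Q (N + 1) 0 x z) k ≤
      ∑ y, w y z * headk (fun x => mixT P Q (N + 1) (N + 1) x y) k := h4
    refine ⟨fun y y' => if y.1.val = N then (if y'.1.val = 0 then w y.2 y'.2 else 0) else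
      (if y'.1.val = y.1.val + 1 ∧ y'.2 = y.2 then 1 else 0), ?_, ?_, ?_, ?_⟩
    · intro y y'
      dsimp only
      split_ifs
      · exact h1 _ _
      all_goals norm_num
    · rintro ⟨k, y⟩
      by_cases hk : k.val = N
      · simp only [hk, if_true]
        rw [Fintype.sum_prod_type, Fintype.sum_eq_single 0]
        · simpa using h2 y
        · intro l hl
          have : l.val ≠ 0 := fun h => hl (Fin.ext h)
          simp [this]
      · have hk' : k.val + 1 < N + 1 := by have := k.2; omega
        simp only [hk, if_false]
        rw [Fintype.sum_eq_single (⟨k.val + 1, hk'⟩, y)]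
        · simp
        · rintro ⟨l, z⟩ hne
          rw [if_neg]
          rintro ⟨e1, e2⟩
          exact hne (Prod.ext (Fin.ext e1) e2)
    all_goals
      rintro ⟨l, z⟩
    · rw [Fintype.sum_prod_type]
      by_cases hl : l.val = 0
      · rw [Fintype.sum_eq_single (Fin.last N)]
        · simp only [Fin.val_last, hl, if_true]
          rw [← h3, mul_sum]
          exact sum_congr rfl fun y _ => by ring
        · intro k hk
          have : k.val ≠ N := fun h => hk (Fin.ext h)
          simp [this, hl]
      · have hl1 : l.val - 1 < N + 1 := by omega
        have hl2 : l.val - 1 ≠ N := by have := l.2; omega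
        have hl3 : l.val = l.val - 1 + 1 := by omega
        rw [Fintype.sum_eq_single ⟨l.val - 1, hl1⟩, Fintype.sum_eq_single z]
        · simp only [hl2, if_false, ← hl3, true_and, if_true, one_mul]
        · intro z' hz'
          simp [hl2, hz'.symm]
        · intro k hk
          have : ¬ l.val = k.val + 1 := fun h => hk (Fin.ext (by simp; omega))
          simp [this, hl]
    · intro k
      rw [Fintype.sum_prod_type]
      by_cases hl : l.val = 0
      · rw [Fintype.sum_eq_single (Fin.last N)]
        · simp only [Fin.val_last, hl, if_true]
          refine (mul_le_mul_of_nonneg_left (h4 z k) hc0).trans (le_of_eq ?_)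
          rw [mul_sum]
          exact sum_congr rfl fun y _ => by ring
        · intro k hk
          have : k.val ≠ N := fun h => hk (Fin.ext h)
          simp [this, hl]
      · have hl1 : l.val - 1 < N + 1 := by omega
        have hl2 : l.val - 1 ≠ N := by have := l.2; omega
        have hl3 : l.val = l.val - 1 + 1 := by omega
        rw [Fintype.sum_eq_single ⟨l.val - 1, hl1⟩, Fintype.sum_eq_single z]
        · simp only [hl2, if_false, ← hl3, true_and, if_true, one_mul]
          exact le_rfl
        · intro z' hz'
          simp [hl2, hz'.symm]
        · intro k hk
          have : ¬ l.val = k.val + 1 := fun h => hk (Fin.ext (by simp; omega))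
          simp [this, hl]
  -- column identifications
  let eC : (Fin (N + 1) → Z) ≃ Z × (Fin N → Z) := (Fin.consEquiv (fun _ => Z)).symm
  let eS : (Fin (N + 1) → Z) ≃ Z × (Fin N → Z) := (Fin.snocEquiv (fun _ => Z)).symm
  let gC : (Fin (N + 1) × (Fin (N + 1) → W)) ≃ W × (Fin (N + 1) × (Fin N → W)) :=
    ⟨fun y => (y.2 0, (y.1, Fin.tail y.2)), fun y => (y.2.1, Fin.cons y.1 y.2.2),
      fun y => by simp, fun y => by simp⟩
  let gS : (Fin (N + 1) × (Fin (N + 1) → W)) ≃ W × (Fin (N + 1) × (Fin N → W)) :=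
    ⟨fun y => (y.2 (Fin.last N), (y.1, Fin.init y.2)), fun y => (y.2.1, Fin.snoc y.2.2 y.1),
      fun y => by simp, fun y => by simp⟩
  have vC : ∀ (y : Fin (N + 1) × (Fin (N + 1) → W)) (x : Fin (N + 1) → Z),
      kron P (catR P Q N) (eC x) (gC y) = c * mixT P Q (N + 1) (y.1.val + 1) x y.2 := by
    intro y x
    simp only [kron, catR, mixT, Matrix.of_apply, eC, gC, Equiv.coe_fn_mk]
    rw [Fin.prod_univ_succ]
    simp only [Fin.consEquiv, Equiv.coe_fn_symm_mk, Fin.tail, Fin.val_zero, Nat.zero_lt_succ,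
      if_true, Fin.val_succ, Nat.succ_lt_succ_iff]
    ring
  have vS : ∀ (y : Fin (N + 1) × (Fin (N + 1) → W)) (x : Fin (N + 1) → Z),
      kron Q (catR P Q N) (eS x) (gS y) = c * mixT P Q (N + 1) y.1.val x y.2 := by
    intro y x
    simp only [kron, catR, mixT, Matrix.of_apply, eS, gS, Equiv.coe_fn_mk]
    rw [Fin.prod_univ_castSucc]
    have : ¬ (N < y.1.val) := by have := y.1.2; omega
    simp only [Fin.snocEquiv, Equiv.coe_fn_symm_mk, Fin.init, Fin.val_last, this, if_false,
      Fin.val_castSucc]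
    ring
  have : Nonempty (Fin (N + 1) × (Fin (N + 1) → W)) ∨ IsEmpty W := by
    rcases isEmpty_or_nonempty W with h | h
    · exact Or.inr h
    · exact Or.inl inferInstance
  rcases this with hne | hemp
  · refine CritF.ext gC gC.injective gS gS.injective ?_ ?_ ?_ ?_ ?_ ?_ ?_ ?_ hmid
    · intro y; rw [mul_sum, ← Equiv.sum_comp eC]; exact sum_congr rfl fun x _ => vC y x
    · intro y; rw [mul_sum, ← Equiv.sum_comp eS]; exact sum_congr rfl fun x _ => vS y x
    · intro y k
      rw [← headk_smul _ hc0]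
      exact headk_extend eC eC.injective _ _ (fun x => vC y x)
        (fun z hz => absurd ⟨_, eC.apply_symm_apply z⟩ hz) k
    · intro y k
      rw [← headk_smul _ hc0]
      exact headk_extend eS eS.injective _ _ (fun x => vS y x)
        (fun z hz => absurd ⟨_, eS.apply_symm_apply z⟩ hz) k
    · intro y hy; exact absurd ⟨_, gC.apply_symm_apply y⟩ hy
    · intro y hy; exact absurd ⟨_, gS.apply_symm_apply y⟩ hy
    · intro y k hy; exact absurd ⟨_, gC.apply_symm_apply y⟩ hy
    · intro y k hy; exact absurd ⟨_, gS.apply_symm_apply y⟩ hy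
  · exact ⟨fun _ _ => 0, fun _ _ => le_rfl, fun y => (hemp.false y.1).elim,
      fun y => (hemp.false y.1).elim, fun y => (hemp.false y.1).elim⟩

lemma sum_kronlike {N : ℕ} (F : Fin N → Z → W → ℝ) :
    ∑ x : Fin N → Z, ∑ y : Fin N → W, ∏ i, F i (x i) (y i) = ∏ i, ∑ a, ∑ b, F i a b := by
  classical
  have h1 : ∀ x : Fin N → Z, ∑ y : Fin N → W, ∏ i, F i (x i) (y i)
      = ∏ i, ∑ b, F i (x i) b := fun x => by
    rw [Finset.prod_univ_sum]; simp [Fintype.piFinset_univ]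
  simp only [h1]
  rw [Finset.prod_univ_sum]; simp [Fintype.piFinset_univ]

lemma catR_prob (P Q : Matrix Z W ℝ) (hP : IsJointProb P) (hQ : IsJointProb Q) (N : ℕ) :
    IsJointProb (catR P Q N) := by
  refine ⟨fun x y => ?_, ?_⟩
  · simp only [catR, mixT, Matrix.of_apply]
    refine mul_nonneg (by positivity) (prod_nonneg fun i _ => ?_)
    split_ifs
    · exact hP.1 _ _
    · exact hQ.1 _ _
  · simp only [catR, mixT, Matrix.of_apply, Fintype.sum_prod_type]
    rw [sum_comm]
    have : ∀ k : Fin (N + 1), ∑ x : Fin N → Z, ∑ y : Fin N → W, ((N : ℝ) + 1)⁻¹ *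
        ∏ i, (if i.val < k.val then P (x i) (y i) else Q (x i) (y i)) = ((N : ℝ) + 1)⁻¹ := by
      intro k
      simp only [← mul_sum]
      rw [sum_kronlike (fun (i : Fin N) a b => if i.val < k.val then P a b else Q a b)]
      rw [prod_eq_one, mul_one]
      intro i _
      by_cases hi : i.val < k.val
      · simp only [hi, if_true]; exact hP.2
      · simp only [hi, if_false]; exact hQ.2
    simp only [this, sum_const, card_univ, Fintype.card_fin, nsmul_eq_mul]
    push_cast
    exact mul_inv_cancel₀ (by positivity)

end catalytic

/-- Zero padding into a common size. -/
lemma exists_common {X Y X' Y' : Type} [Fintype X] [Fintype Y] [Fintype X'] [Fintype Y']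
    (P : Matrix X Y ℝ) (Q : Matrix X' Y' ℝ) (hP : IsJointProb P) (hQ : IsJointProb Q) :
    ∃ (P' Q' : Matrix (X ⊕ X') (Y ⊕ Y') ℝ), IsJointProb P' ∧ IsJointProb Q' ∧
      Embeds P P' ∧ Embeds Q Q' := by
  refine ⟨Matrix.fromBlocks P 0 0 0, Matrix.fromBlocks 0 0 0 Q, ⟨?_, ?_⟩, ⟨?_, ?_⟩,
    ⟨Function.Embedding.inl, Function.Embedding.inl, ?_, ?_⟩,
    ⟨Function.Embedding.inr, Function.Embedding.inr, ?_, ?_⟩⟩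
  · rintro (x | x) (y | y) <;> simp [hP.1]
  · simpa using hP.2
  · rintro (x | x) (y | y) <;> simp [hQ.1]
  · simpa using hQ.2
  · intro x y; simp
  · rintro (x | x) (y | y) <;> simp
  · intro x y; simp
  · rintro (x | x) (y | y) <;> simp

theorem catalytic_of_crit {X Y X' Y' : Type} [Fintype X] [Fintype Y] [Fintype X'] [Fintype Y']
    [Nonempty Y']
    (P : Matrix X Y ℝ) (Q : Matrix X' Y' ℝ) (hP : IsJointProb P) (hQ : IsJointProb Q) (N : ℕ)
    (h : Crit (kronPow P (N + 1)) (kronPow Q (N + 1))) :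
    ∃ (dR nR : ℕ) (R : Matrix (Fin dR) (Fin nR) ℝ), IsJointProb R ∧
      CondMajorizes (kron P R) (kron Q R) := by
  classical
  obtain ⟨P', Q', hP', hQ', eP, eQ⟩ := exists_common P Q hP hQ
  have h1 : Crit (kronPow P' (N + 1)) (kronPow Q' (N + 1)) :=
    Crit.embeds (Embeds.kronPow eP _) (Embeds.kronPow eQ _) h
  have h2 := catalytic_crit P' Q' N h1
  have hR := catR_prob P' Q' hP' hQ' N
  set R0 := catR P' Q' N with hR0
  have h3 : CondMajorizes (kron P' R0) (kron Q' R0) := h2.condMajorizes fun x y => by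
    simp only [kron, Matrix.of_apply]; exact mul_nonneg (hP'.1 _ _) (hR.1 _ _)
  have h4 : CondMajorizes (kron P R0) (kron Q R0) :=
    CondMajorizes.of_embeds (Embeds.kron eP R0) (Embeds.kron eQ R0) h3
  let e1 := Fintype.equivFin (Fin N → X ⊕ X')
  let e2 := Fintype.equivFin (Fin (N + 1) × (Fin N → Y ⊕ Y'))
  refine ⟨_, _, R0.reindex e1 e2, ⟨fun x y => hR.1 _ _, ?_⟩, ?_⟩
  · rw [← hR.2, ← Equiv.sum_comp e1]
    refine sum_congr rfl fun x _ => ?_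
    rw [← Equiv.sum_comp e2]
    simp
  · have emb : ∀ {A B : Type} [Fintype A] [Fintype B] (T : Matrix A B ℝ),
        Embeds (kron T (R0.reindex e1 e2)) (kron T R0) := by
      intro A B _ _ T
      refine ⟨(Function.Embedding.refl A).prodMap e1.symm.toEmbedding,
        (Function.Embedding.refl B).prodMap e2.symm.toEmbedding, ?_, ?_⟩
      · intro x y; simp [kron]
      · intro x y _
        exact ⟨⟨(x.1, e1 x.2), by simp⟩, ⟨(y.1, e2 y.2), by simp⟩⟩
    exact CondMajorizes.of_embeds (emb P) (emb Q) h4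

end CM

namespace CM

open Real Finset

/-! ### The finite linear program -/

section LP
variable {T T' J : Type*} [Fintype T] [Fintype T'] [Fintype J]

/-- A theorem of alternatives. -/
lemma lp_alternative (P : T → ℝ) (Q : T' → ℝ) (a : J → T → ℝ) (b : J → T' → ℝ)
    (hno : ¬ ∃ v : T → T' → ℝ, (∀ x, v x ∈ stdSimplex ℝ T') ∧
      ∀ y j, ∑ x, v x y * P x * a j x ≤ Q y * b j y) :
    ∃ l : T' → J → ℝ, (∀ y j, 0 ≤ l y j) ∧ ∀ v : T → T' → ℝ, (∀ x, v x ∈ stdSimplex ℝ T') →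
      ∑ y, ∑ j, l y j * (Q y * b j y) < ∑ x, ∑ y, v x y * (P x * ∑ j, l y j * a j x) := by
  classical
  set C : Set (T → T' → ℝ) := Set.univ.pi (fun _ => stdSimplex ℝ T') with hC
  have hCc : IsCompact C := isCompact_univ_pi fun _ => isCompact_stdSimplex ℝ T'
  have hCv : Convex ℝ C := convex_pi fun _ _ => convex_stdSimplex ℝ T'
  set F : (T → T' → ℝ) → (T' × J → ℝ) := fun v q => ∑ x, v x q.1 * P x * a q.2 x - Q q.1 * b q.2 q.1
    with hF
  have hFc : Continuous F := by
    refine continuous_pi fun q => ?_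
    simp only [hF]
    fun_prop
  have hIv : Convex ℝ (F '' C) := by
    rintro _ ⟨v, hv, rfl⟩ _ ⟨w, hw, rfl⟩ s t hs ht hst
    refine ⟨s • v + t • w, hCv hv hw hs ht hst, ?_⟩
    funext q
    simp only [hF, Pi.add_apply, Pi.smul_apply, smul_eq_mul]
    have : ∀ x, (s * v x q.1 + t * w x q.1) * P x * a q.2 x
        = s * (v x q.1 * P x * a q.2 x) + t * (w x q.1 * P x * a q.2 x) := fun x => by ring
    simp only [this, sum_add_distrib, ← mul_sum]
    have ht' : t = 1 - s := by linarith
    rw [ht']; ring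
  set Ng : Set (T' × J → ℝ) := Set.Iic 0 with hNg
  have hdisj : Disjoint (F '' C) Ng := by
    rw [Set.disjoint_left]
    rintro _ ⟨v, hv, rfl⟩ h0
    refine hno ⟨v, fun x => hv x (Set.mem_univ x), fun y j => ?_⟩
    have := h0 (y, j)
    simp only [hF, Pi.zero_apply, sub_nonpos] at this
    exact this
  obtain ⟨f, u, r, h1, h2, h3⟩ := geometric_hahn_banach_compact_closed hIv (hCc.image hFc)
    (convex_Iic (0 : T' × J → ℝ)) isClosed_Iic hdisj
  have hr : r < 0 := by simpa using h3 0 (by simp)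
  set e : T' × J → ℝ := fun q => f (fun q' => if q = q' then 1 else 0) with he
  have hfe : ∀ z, f z = ∑ q, z q * e q := by
    intro z
    have := LinearMap.pi_apply_eq_sum_univ (f : (T' × J → ℝ) →ₗ[ℝ] ℝ) z
    simpa using this
  have he0 : ∀ q, e q ≤ 0 := by
    intro q
    by_contra hpos
    push Not at hpos
    have h4 := h3 ((r / e q) • (fun q' => if q = q' then (1 : ℝ) else 0)) (by
      intro q'
      simp only [Pi.smul_apply, smul_eq_mul, Pi.zero_apply]
      have : r / e q ≤ 0 := div_nonpos_of_nonpos_of_nonneg hr.le hpos.le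
      split_ifs <;> simp [this])
    rw [map_smul, smul_eq_mul] at h4
    change r < r / e q * e q at h4
    rw [div_mul_cancel₀ _ hpos.ne'] at h4
    exact lt_irrefl _ h4
  refine ⟨fun y j => - e (y, j), fun y j => by have := he0 (y, j); simpa using this, fun v hv => ?_⟩
  have h4 := h1 (F v) ⟨v, fun x _ => hv x, rfl⟩
  rw [hfe, Fintype.sum_prod_type] at h4
  have h5 : ∑ y, ∑ j, F v (y, j) * e (y, j) < 0 := by linarith
  have h6 : ∑ x, ∑ y, v x y * (P x * ∑ j, -e (y, j) * a j x)
      = ∑ y, ∑ j, ∑ x, - (v x y * P x * a j x * e (y, j)) := by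
    rw [sum_comm]
    refine sum_congr rfl fun y _ => ?_
    rw [sum_comm]
    refine sum_congr rfl fun x _ => ?_
    rw [mul_sum, mul_sum]
    exact sum_congr rfl fun j _ => by ring
  rw [h6, ← sub_pos, ← sum_sub_distrib]
  have h7 : ∀ y, ∑ j, ∑ x, - (v x y * P x * a j x * e (y, j)) - ∑ j, -e (y, j) * (Q y * b j y)
      = - ∑ j, F v (y, j) * e (y, j) := by
    intro y
    rw [← sum_sub_distrib, ← sum_neg_distrib]
    refine sum_congr rfl fun j _ => ?_
    simp only [hF, sub_mul, sum_mul, sum_neg_distrib]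
    ring
  rw [sum_congr rfl fun y _ => h7 y, sum_neg_distrib]
  linarith

set_option maxHeartbeats 2000000 in
/-- The numeric lemma. -/
theorem lp_main [Nonempty T'] (P : T → ℝ) (Q : T' → ℝ) (a : J → T → ℝ) (b : J → T' → ℝ)
    (hd : T' → J → Prop) (K E : ℝ) (hK : 0 ≤ K)
    (hE : 4 * ((Fintype.card T : ℝ) + 1) * ((Fintype.card J : ℝ) + 1) *
      ((Fintype.card T' : ℝ) * ((Fintype.card J : ℝ) + 1)) ≤ E)
    (hP : ∀ x, 0 ≤ P x) (hP1 : ∑ x, P x = 1) (hQ : ∀ y, 0 < Q y) (hQ1 : ∑ y, Q y = 1)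
    (ha0 : ∀ j x, 0 ≤ a j x) (ha1 : ∀ j x, a j x ≤ 1)
    (hb0 : ∀ j y, 0 ≤ b j y) (hb1 : ∀ j y, b j y ≤ 1)
    (ha : ∀ x, ∃ y, P x ≤ K * Q y ∧ ∀ j, ¬ hd y j → P x * a j x ≤ K * (Q y * b j y))
    (hA : ∀ y j, hd y j → ∃ x c, 0 ≤ c ∧ c ≤ 1 ∧ E * K * (Q y * (1 - b j y)) ≤ c * P x * (1 - a j x)
      ∧ c * P x ≤ K * Q y ∧ ∀ i, ¬ hd y i → c * P x * a i x ≤ K * (Q y * b i y))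
    (hBC : ∀ y, (∃ x, E * K * Q y ≤ P x ∧ ∀ i, ¬ hd y i → E * a i x ≤ b i y) ∨
      (∃ Near : T → Prop, (∃ s : Finset T, (∀ x ∈ s, Near x) ∧ 1 / 2 ≤ ∑ x ∈ s, P x) ∧
        (∀ x, Near x → ∀ i, ¬ hd y i → E * a i x ≤ b i y) ∧
        (∀ x, ¬ Near x → ∃ z, E * P x ≤ Q z ∧ ∀ j, ¬ hd z j → E * (P x * a j x) ≤ Q z * b j z))) :
    ∃ v : T → T' → ℝ, (∀ x y, 0 ≤ v x y) ∧ (∀ x, ∑ y, v x y = 1) ∧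
      (∀ y, ∑ x, v x y * P x = Q y) ∧ ∀ y j, ∑ x, v x y * P x * a j x ≤ Q y * b j y := by
  classical
  by_contra hcon
  set a' : Option J → T → ℝ := fun j x => j.elim 1 (fun j => a j x) with ha'
  set b' : Option J → T' → ℝ := fun j y => j.elim 1 (fun j => b j y) with hb'
  obtain ⟨l, hl, hlv⟩ := lp_alternative P Q a' b' (by
    rintro ⟨v, hv, hv2⟩
    refine hcon ⟨v, fun x y => (hv x).1 y, fun x => (hv x).2, ?_, fun y j => hv2 y (some j)⟩
    have h1 : ∀ y ∈ univ, ∑ x, v x y * P x ≤ Q y := fun y _ => by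
      simpa [ha', hb'] using hv2 y none
    have h2 : ∑ y, ∑ x, v x y * P x = ∑ y, Q y := by
      rw [sum_comm, hQ1, ← hP1]
      refine sum_congr rfl fun x _ => ?_
      rw [← sum_mul, (hv x).2, one_mul]
    exact fun y => (sum_eq_sum_iff_of_le h1).1 h2 y (mem_univ y))
  set N := ∑ y, ∑ j, l y j * (Q y * b' j y) with hN
  -- the functions
  set m : T' → J → ℝ := fun y j => l y (some j) with hm
  have hm0 : ∀ y j, 0 ≤ m y j := fun y j => hl _ _
  set G : T' → T → ℝ := fun y x => ∑ j, l y j * a' j x - N with hG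
  have hpos : ∀ v : T → T' → ℝ, (∀ x, v x ∈ stdSimplex ℝ T') →
      0 < ∑ x, ∑ y, v x y * (P x * G y x) := by
    intro v hv
    have h1 := hlv v hv
    have h2 : ∑ x, ∑ y, v x y * (P x * N) = N := by
      have : ∀ x, ∑ y, v x y * (P x * N) = P x * N := fun x => by
        rw [← sum_mul, (hv x).2, one_mul]
      simp only [this, ← sum_mul, hP1, one_mul]
    have h3 : ∑ x, ∑ y, v x y * (P x * G y x) = ∑ x, ∑ y, v x y * (P x * ∑ j, l y j * a' j x)
        - ∑ x, ∑ y, v x y * (P x * N) := by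
      rw [← sum_sub_distrib]; refine sum_congr rfl fun x _ => ?_
      rw [← sum_sub_distrib]; refine sum_congr rfl fun y _ => ?_
      simp only [hG]; ring
    rw [h3, h2]; linarith
  set A : T' → ℝ := fun y => l y none + ∑ j, (if hd y j then m y j else 0) - N with hAdef
  have hGe : ∀ y x, G y x = A y + ∑ j, (if hd y j then - (m y j * (1 - a j x)) else m y j * a j x) := by
    intro y x
    simp only [hG, hAdef, Fintype.sum_option, ha', Option.elim]
    have : ∑ j, m y j * a j x = ∑ j, (if hd y j then m y j else 0) +
        ∑ j, (if hd y j then - (m y j * (1 - a j x)) else m y j * a j x) := by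
      rw [← sum_add_distrib]; refine sum_congr rfl fun j _ => ?_
      split_ifs <;> ring
    simp only [hm] at this ⊢
    rw [this]; ring
  -- positive and negative parts
  set pos : T' → ℝ := fun y => Q y * max (A y) 0 + ∑ j, (if hd y j then 0 else Q y * (m y j * b j y))
    with hposd
  set ng : T' → ℝ := fun y => Q y * max (-A y) 0 +
    ∑ j, (if hd y j then Q y * (m y j * (1 - b j y)) else 0) with hngd
  have hbal : ∑ y, pos y = ∑ y, ng y := by
    rw [← sub_eq_zero, ← sum_sub_distrib]
    have h1 : ∀ y, pos y - ng y = ∑ j, l y j * (Q y * b' j y) - Q y * N := by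
      intro y
      simp only [hposd, hngd, Fintype.sum_option, hb', Option.elim]
      have e1 : max (A y) 0 - max (-A y) 0 = A y := max_zero_sub_max_neg_zero_eq_self (A y)
      have e2 : ∑ j, m y j * (Q y * b j y) = Q y * ∑ j, (if hd y j then m y j else 0) +
          ∑ j, (if hd y j then 0 else Q y * (m y j * b j y)) -
          ∑ j, (if hd y j then Q y * (m y j * (1 - b j y)) else 0) := by
        rw [mul_sum, ← sum_add_distrib, ← sum_sub_distrib]
        refine sum_congr rfl fun j _ => ?_
        split_ifs <;> ring
      simp only [hm] at e2 ⊢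
      rw [e2]
      have e3 : A y = l y none + ∑ j, (if hd y j then l y (some j) else 0) - N := rfl
      have e4 : Q y * max (A y) 0 - Q y * max (-A y) 0 = Q y * A y := by rw [← mul_sub, e1]
      rw [e3] at e4
      simp only [hm] at *
      linarith
    simp only [h1, sum_sub_distrib, ← sum_mul, hQ1, one_mul]
    rw [← hN]; ring
  have hpos1 : ∀ y j, 0 ≤ (if hd y j then 0 else Q y * (m y j * b j y)) := fun y j => by
    split_ifs
    · exact le_rfl
    · exact mul_nonneg (hQ y).le (mul_nonneg (hm0 y j) (hb0 j y))
  have hng1 : ∀ y j, 0 ≤ (if hd y j then Q y * (m y j * (1 - b j y)) else 0) := fun y j => by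
    split_ifs
    · exact mul_nonneg (hQ y).le (mul_nonneg (hm0 y j) (sub_nonneg.2 (hb1 j y)))
    · exact le_rfl
  have hpos0 : ∀ y, 0 ≤ pos y := fun y =>
    add_nonneg (mul_nonneg (hQ y).le (le_max_right _ _)) (sum_nonneg fun j _ => hpos1 y j)
  set M := ∑ y, pos y with hM
  have hM0 : 0 ≤ M := sum_nonneg fun y _ => hpos0 y
  have hposM : ∀ y, pos y ≤ M := fun y => single_le_sum (fun y _ => hpos0 y) (mem_univ y)
  set t : ℝ := (Fintype.card T : ℝ) with ht
  set jj : ℝ := (Fintype.card J : ℝ) + 1 with hjj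
  set L : ℝ := (Fintype.card T' : ℝ) * jj with hLd
  have ht0 : 0 ≤ t := by positivity
  have hjj1 : 1 ≤ jj := by simp [hjj]
  have hT'1 : (1 : ℝ) ≤ Fintype.card T' := by
    exact_mod_cast Nat.succ_le_of_lt Fintype.card_pos
  have hL1 : 1 ≤ L := by rw [hLd]; nlinarith
  -- bound for a point sent with weight `c`
  have hsend : ∀ y x c, 0 ≤ c → c * P x ≤ K * Q y →
      (∀ i, ¬ hd y i → c * P x * a i x ≤ K * (Q y * b i y)) →
      ∀ r : ℝ, (∃ j, hd y j ∧ r ≤ c * P x * (m y j * (1 - a j x))) ∨ r ≤ 0 →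
      c * (P x * G y x) ≤ K * M - r := by
    intro y x c hc h1 h2 r hr
    have h3 : c * (P x * G y x) ≤ K * pos y - ∑ j, (if hd y j then c * P x * (m y j * (1 - a j x)) else 0) := by
      rw [hGe]
      have e1 : c * (P x * (A y + ∑ j, (if hd y j then - (m y j * (1 - a j x)) else m y j * a j x)))
          = c * P x * A y + ∑ j, (if hd y j then 0 else c * P x * (m y j * a j x))
            - ∑ j, (if hd y j then c * P x * (m y j * (1 - a j x)) else 0) := by
        rw [add_sub_assoc, ← sum_sub_distrib, ← mul_assoc, mul_add, mul_sum]
        congr 1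
        refine sum_congr rfl fun j _ => ?_
        split_ifs <;> ring
      rw [e1]
      have e2 : c * P x * A y ≤ K * (Q y * max (A y) 0) := by
        calc c * P x * A y ≤ c * P x * max (A y) 0 :=
              mul_le_mul_of_nonneg_left (le_max_left _ _) (mul_nonneg hc (hP x))
          _ ≤ K * Q y * max (A y) 0 := mul_le_mul_of_nonneg_right h1 (le_max_right _ _)
          _ = _ := by ring
      have e3 : ∑ j, (if hd y j then 0 else c * P x * (m y j * a j x)) ≤
          K * ∑ j, (if hd y j then 0 else Q y * (m y j * b j y)) := by
        rw [mul_sum]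
        refine sum_le_sum fun j _ => ?_
        split_ifs with h
        · simp
        · have := mul_le_mul_of_nonneg_left (h2 j h) (hm0 y j)
          nlinarith
      simp only [hposd]; rw [mul_add]; linarith
    have h4 : r ≤ ∑ j, (if hd y j then c * P x * (m y j * (1 - a j x)) else 0) := by
      have nn : ∀ j, 0 ≤ (if hd y j then c * P x * (m y j * (1 - a j x)) else 0) := fun j => by
        split_ifs
        · exact mul_nonneg (mul_nonneg hc (hP x)) (mul_nonneg (hm0 y j) (sub_nonneg.2 (ha1 j x)))
        · exact le_rfl
      rcases hr with ⟨j, hj, hj2⟩ | hr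
      · refine hj2.trans ?_
        have := single_le_sum (fun j _ => nn j) (mem_univ j)
        rwa [if_pos hj] at this
      · exact hr.trans (sum_nonneg fun j _ => nn j)
    have := mul_le_mul_of_nonneg_left (hposM y) hK
    linarith
  choose f hf1 hf2 using ha
  have hfs : ∀ x, P x * G (f x) x ≤ K * M := fun x => by
    have := hsend (f x) x 1 zero_le_one (by simpa using hf1 x) (by simpa using hf2 x) 0
      (Or.inr le_rfl)
    simpa using this
  -- deterministic and one-point modified strategies
  have hsimp : ∀ y, (Pi.single y 1 : T' → ℝ) ∈ stdSimplex ℝ T' := fun y => single_mem_stdSimplex ℝ y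
  have hsingle : ∀ y (g : T' → ℝ), ∑ z, (Pi.single y (1 : ℝ) : T' → ℝ) z * g z = g y := by
    intro y g
    rw [Fintype.sum_eq_single y]
    · simp
    · intro z hz; simp [Pi.single_apply, hz]
  have hdet : ∀ c : T → T', 0 < ∑ x, P x * G (c x) x := by
    intro c
    have := hpos (fun x => Pi.single (c x) 1) (fun x => hsimp _)
    simpa only [hsingle _ (fun z => _)] using this
  have hone : ∀ x0 y0 c, 0 ≤ c → c ≤ 1 → c * (P x0 * G y0 x0) + t * (K * M) > 0 := by
    intro x0 y0 c hc0 hc1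
    set v : T → T' → ℝ := fun x => if x = x0 then c • Pi.single y0 1 + (1 - c) • Pi.single (f x) 1
      else Pi.single (f x) 1 with hv
    have h1 := hpos v (fun x => by
      simp only [hv]; split_ifs
      · exact convex_stdSimplex ℝ T' (hsimp _) (hsimp _) hc0 (by linarith) (by ring)
      · exact hsimp _)
    have h2 : ∀ x, ∑ y, v x y * (P x * G y x) ≤ (if x = x0 then c * (P x0 * G y0 x0) else 0) + K * M := by
      intro x
      by_cases hx : x = x0
      · subst hx
        simp only [hv, if_true, Pi.add_apply, Pi.smul_apply, smul_eq_mul, add_mul, sum_add_distrib,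
          mul_assoc, ← mul_sum, hsingle]
        have := hfs x
        have hKM : 0 ≤ K * M := mul_nonneg hK hM0
        nlinarith
      · simp only [hv, hx, if_false, hsingle]
        have := hfs x; linarith
    have h3 := h1.trans_le (sum_le_sum fun x _ => h2 x)
    rw [sum_add_distrib] at h3
    simpa [ht] using h3
  -- the largest negative term
  have hMpos : 0 < M := by
    rcases hM0.eq_or_lt with h | h
    · have h1 := hdet f
      have h2 : ∑ x, P x * G (f x) x ≤ ∑ x : T, K * M := sum_le_sum fun x _ => hfs x
      rw [← h] at h2; simp at h2; linarith
    · exact h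
  obtain ⟨y0, hy0⟩ : ∃ y, M ≤ (Fintype.card T' : ℝ) * ng y := by
    by_contra hlt
    push Not at hlt
    have h1 : ∑ y, (Fintype.card T' : ℝ) * ng y < ∑ y : T', M :=
      sum_lt_sum_of_nonempty univ_nonempty fun y _ => hlt y
    rw [← mul_sum, ← hbal] at h1
    simp at h1
  have hT'0 : (0 : ℝ) < Fintype.card T' := by linarith
  have hcases : M ≤ L * (Q y0 * max (-A y0) 0) ∨
      ∃ j, hd y0 j ∧ M ≤ L * (Q y0 * (m y0 j * (1 - b j y0))) := by
    by_contra hlt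
    push Not at hlt
    obtain ⟨h1, h2⟩ := hlt
    have h3 : ∀ j, L * (if hd y0 j then Q y0 * (m y0 j * (1 - b j y0)) else 0) ≤ M := fun j => by
      split_ifs with h
      · exact (h2 j h).le
      · simpa using hM0
    have h4 : L * ng y0 < jj * M := by
      simp only [hngd]
      rw [mul_add, mul_sum]
      have : ∑ j, L * (if hd y0 j then Q y0 * (m y0 j * (1 - b j y0)) else 0) ≤ ∑ j : J, M :=
        sum_le_sum fun j _ => h3 j
      simp only [sum_const, card_univ, nsmul_eq_mul] at this
      rw [hjj]; linarith
    have h5 : L * ng y0 = jj * ((Fintype.card T' : ℝ) * ng y0) := by rw [hLd]; ring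
    rw [h5] at h4
    have := lt_of_mul_lt_mul_left h4 (by linarith)
    linarith
  have hE1 : 4 * (t + 1) * jj * L ≤ E := hE
  have hE0 : 0 < E := by
    have : 0 < 4 * (t + 1) * jj * L := by positivity
    linarith
  have htL : 4 * (t + 1) * L ≤ E := by
    have : 0 ≤ 4 * (t + 1) * L := by positivity
    nlinarith
  have hKM : 0 ≤ K * M := mul_nonneg hK hM0
  -- key bound for sending points to `y0` in the negative case
  have hneg : M ≤ L * (Q y0 * max (-A y0) 0) → 0 < -A y0 ∧ M ≤ L * (Q y0 * (-A y0)) := by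
    intro h
    have : 0 < max (-A y0) 0 := by
      rcases (le_max_right (-A y0) 0).eq_or_lt with h' | h'
      · rw [← h'] at h; simp at h; linarith
      · exact h'
    have h2 : 0 < -A y0 := by
      rcases lt_max_iff.1 this with h | h
      · exact h
      · exact absurd h (lt_irrefl _)
    exact ⟨h2, by rwa [max_eq_left h2.le] at h⟩
  have hnegG : M ≤ L * (Q y0 * max (-A y0) 0) → ∀ x, (∀ i, ¬ hd y0 i → E * a i x ≤ b i y0) →
      P x * G y0 x ≤ - (P x * (-A y0) / 2) := by
    intro h x hx
    obtain ⟨h1, h2⟩ := hneg h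
    have h3 : ∀ j, (if hd y0 j then - (m y0 j * (1 - a j x)) else m y0 j * a j x) ≤
        L * (-A y0) / E := by
      intro j
      split_ifs with hj
      · have : 0 ≤ m y0 j * (1 - a j x) := mul_nonneg (hm0 _ _) (sub_nonneg.2 (ha1 _ _))
        have h5 : 0 ≤ L * (-A y0) / E := by positivity
        linarith
      · rw [le_div_iff₀ hE0]
        have e1 : Q y0 * (m y0 j * b j y0) ≤ M := by
          refine le_trans ?_ (hposM y0)
          have := single_le_sum (fun j _ => hpos1 y0 j) (mem_univ j)
          rw [if_neg hj] at this
          have e2 : 0 ≤ Q y0 * max (A y0) 0 := mul_nonneg (hQ y0).le (le_max_right _ _)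
          simp only [hposd]; linarith
        have e3 : Q y0 * (m y0 j * b j y0) ≤ Q y0 * (L * (-A y0)) := by
          calc _ ≤ M := e1
            _ ≤ L * (Q y0 * (-A y0)) := h2
            _ = _ := by ring
        have e4 := le_of_mul_le_mul_left e3 (hQ y0)
        have e5 := mul_le_mul_of_nonneg_left (hx j hj) (hm0 y0 j)
        nlinarith
    have h6 : G y0 x ≤ A y0 + (Fintype.card J : ℝ) * (L * (-A y0) / E) := by
      rw [hGe]
      have := sum_le_sum fun j (_ : j ∈ univ) => h3 j
      simp only [sum_const, card_univ, nsmul_eq_mul] at this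
      linarith
    have h7 : (Fintype.card J : ℝ) * (L * (-A y0) / E) ≤ -A y0 / 2 := by
      rw [mul_div_assoc', div_le_div_iff₀ hE0 two_pos]
      have e1 : (Fintype.card J : ℝ) * 2 * L ≤ E := by
        have e2 : (Fintype.card J : ℝ) ≤ jj := by simp [hjj]
        have e3 : (Fintype.card J : ℝ) * L ≤ jj * L := mul_le_mul_of_nonneg_right e2 (by linarith)
        have e4 : 0 ≤ jj * L := by positivity
        have e5 : 0 ≤ t * (jj * L) := by positivity
        nlinarith
      have := mul_le_mul_of_nonneg_right e1 h1.le
      linarith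
    have h8 : G y0 x ≤ -((-A y0) / 2) := by linarith
    have := mul_le_mul_of_nonneg_left h8 (hP x)
    linarith
  rcases hcases with hA1 | ⟨j, hj, hj2⟩
  · obtain ⟨hA2, hA3⟩ := hneg hA1
    rcases hBC y0 with ⟨x, hx1, hx2⟩ | ⟨Near, ⟨s, hs1, hs2⟩, hn, hfar⟩
    · have h1 := hone x y0 1 zero_le_one le_rfl
      have h2 := hnegG hA1 x hx2
      have h3 : E * K * M ≤ L * (P x * (-A y0)) := by
        calc E * K * M ≤ E * K * (L * (Q y0 * (-A y0))) :=
              mul_le_mul_of_nonneg_left hA3 (by positivity)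
          _ = L * ((E * K * Q y0) * (-A y0)) := by ring
          _ ≤ _ := mul_le_mul_of_nonneg_left (mul_le_mul_of_nonneg_right hx1 hA2.le) (by linarith)
      have h4 : 4 * (t + 1) * L * (K * M) ≤ E * (K * M) := mul_le_mul_of_nonneg_right htL hKM
      have h5 : 4 * (t + 1) * (K * M) ≤ P x * (-A y0) := by
        have : L * (4 * (t + 1) * (K * M)) ≤ L * (P x * (-A y0)) := by linarith
        exact le_of_mul_le_mul_left this (by linarith)
      nlinarith
    · choose! g hg1 hg2 using hfar
      have h1 := hdet (fun x => if Near x then y0 else g x)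
      have h2 : ∀ x, P x * G (if Near x then y0 else g x) x ≤
          (if x ∈ s then - (P x * (-A y0) / 2) else 0) + E⁻¹ * M := by
        intro x
        have nn : 0 ≤ E⁻¹ * M := by positivity
        by_cases hx : Near x
        · rw [if_pos hx]
          have h3 := hnegG hA1 x (hn x hx)
          split_ifs
          · linarith
          · have : 0 ≤ P x * (-A y0) := mul_nonneg (hP x) hA2.le
            linarith
        · rw [if_neg hx, if_neg (fun h => hx (hs1 x h)), zero_add]
          have e1 : P x ≤ E⁻¹ * Q (g x) := by
            rw [inv_mul_eq_div, le_div_iff₀ hE0]; linarith [hg1 x hx]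
          have e2 : ∀ i, ¬ hd (g x) i → P x * a i x ≤ E⁻¹ * (Q (g x) * b i (g x)) := fun i hi => by
            rw [inv_mul_eq_div, le_div_iff₀ hE0]; linarith [hg2 x hx i hi]
          -- same computation as `hsend` with constant `E⁻¹`
          rw [hGe]
          have e3 : ∀ j, P x * (if hd (g x) j then - (m (g x) j * (1 - a j x)) else m (g x) j * a j x)
              ≤ E⁻¹ * (if hd (g x) j then 0 else Q (g x) * (m (g x) j * b j (g x))) := by
            intro j
            split_ifs with hj
            · have : 0 ≤ P x * (m (g x) j * (1 - a j x)) :=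
                mul_nonneg (hP x) (mul_nonneg (hm0 _ _) (sub_nonneg.2 (ha1 _ _)))
              simp only [mul_zero]; linarith
            · have := mul_le_mul_of_nonneg_left (e2 j hj) (hm0 (g x) j)
              linarith
          have e4 : P x * A (g x) ≤ E⁻¹ * (Q (g x) * max (A (g x)) 0) := by
            calc P x * A (g x) ≤ P x * max (A (g x)) 0 :=
                  mul_le_mul_of_nonneg_left (le_max_left _ _) (hP x)
              _ ≤ E⁻¹ * Q (g x) * max (A (g x)) 0 := mul_le_mul_of_nonneg_right e1 (le_max_right _ _)
              _ = _ := by ring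
          have e5 := sum_le_sum fun j (_ : j ∈ univ) => e3 j
          rw [← mul_sum, ← mul_sum] at e5
          have e6 := mul_le_mul_of_nonneg_left (hposM (g x)) (inv_nonneg.2 hE0.le)
          simp only [hposd] at e6
          rw [mul_add] at e6 ⊢
          linarith
      have h3 := h1.trans_le (sum_le_sum fun x _ => h2 x)
      rw [sum_add_distrib] at h3
      simp only [sum_ite_mem, univ_inter, sum_const, card_univ, nsmul_eq_mul] at h3
      rw [sum_neg_distrib, ← sum_div, ← sum_mul] at h3
      have h4 : 1 / 2 * (-A y0) ≤ (∑ x ∈ s, P x) * (-A y0) := mul_le_mul_of_nonneg_right hs2 hA2.le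
      have hQ1' : Q y0 ≤ 1 := by
        rw [← hQ1]; exact single_le_sum (fun y _ => (hQ y).le) (mem_univ y0)
      have h5 : M ≤ L * (-A y0) := by
        refine hA3.trans (mul_le_mul_of_nonneg_left ?_ (by linarith))
        nlinarith
      have h6 : t * (E⁻¹ * M) ≤ (-A y0) / 4 := by
        have : t * (E⁻¹ * M) = t * M / E := by ring
        rw [this, div_le_div_iff₀ hE0 (by norm_num)]
        have e1 : t * M ≤ t * (L * (-A y0)) := mul_le_mul_of_nonneg_left h5 ht0
        have e2 : 4 * (t + 1) * L * (-A y0) ≤ E * (-A y0) := mul_le_mul_of_nonneg_right htL hA2.le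
        have e3 : 0 ≤ L * (-A y0) := by positivity
        nlinarith
      rw [← ht] at h3
      linarith
  · obtain ⟨x, c, hc0, hc1, e1, e2, e3⟩ := hA y0 j hj
    have h1 := hone x y0 c hc0 hc1
    have h2 := hsend y0 x c hc0 e2 e3 (c * P x * (m y0 j * (1 - a j x))) (Or.inl ⟨j, hj, le_rfl⟩)
    have h3 : E * (K * M) ≤ L * (c * P x * (m y0 j * (1 - a j x))) := by
      calc E * (K * M) ≤ E * (K * (L * (Q y0 * (m y0 j * (1 - b j y0))))) := by gcongr
        _ = L * m y0 j * (E * K * (Q y0 * (1 - b j y0))) := by ring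
        _ ≤ L * m y0 j * (c * P x * (1 - a j x)) :=
            mul_le_mul_of_nonneg_left e1 (mul_nonneg (by linarith) (hm0 _ _))
        _ = _ := by ring
    have h4 : 4 * (t + 1) * L * (K * M) ≤ E * (K * M) := mul_le_mul_of_nonneg_right htL hKM
    have h5 : 4 * (t + 1) * (K * M) ≤ c * P x * (m y0 j * (1 - a j x)) := by
      have : L * (4 * (t + 1) * (K * M)) ≤ L * (c * P x * (m y0 j * (1 - a j x))) := by linarith
      exact le_of_mul_le_mul_left this (by linarith)
    nlinarith

end LP
end CM

set_option linter.unusedSectionVars false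
namespace CM
open Real Finset

/-! ### Types -/
section Types
variable {Y : Type} [Fintype Y] [DecidableEq Y] {n : ℕ}

/-- Letter counts. -/
def cnt (y : Fin n → Y) (b : Y) : ℕ := (univ.filter fun i => y i = b).card

/-- Types of sequences of length `n`. -/
abbrev Tp (Y : Type) [Fintype Y] (n : ℕ) : Type := {k : Y → Fin (n + 1) // ∑ b, (k b : ℕ) = n}

lemma prod_cnt {M : Type*} [CommMonoid M] (f : Y → M) (y : Fin n → Y) :
    ∏ i, f (y i) = ∏ b, f b ^ cnt y b := by
  rw [← prod_fiberwise univ y]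
  refine prod_congr rfl fun b _ => ?_
  rw [prod_congr rfl (g := fun _ => f b) (by intro i hi; rw [(mem_filter.1 hi).2]), prod_const]
  rfl

lemma sum_cnt (y : Fin n → Y) : ∑ b, cnt y b = n := by
  have := card_eq_sum_card_fiberwise (s := (univ : Finset (Fin n))) (t := (univ : Finset Y))
    (f := y) (fun _ _ => by simp)
  simpa [cnt] using this.symm

lemma cnt_lt (y : Fin n → Y) (b : Y) : cnt y b < n + 1 := by
  have : cnt y b ≤ ∑ b, cnt y b := single_le_sum (fun _ _ => Nat.zero_le _) (mem_univ b)
  rw [sum_cnt] at this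
  omega

/-- The type of a sequence. -/
def ty (y : Fin n → Y) : Tp Y n := ⟨fun b => ⟨cnt y b, cnt_lt y b⟩, sum_cnt y⟩

/-- The frequencies of a type. -/
def fr (k : Tp Y n) (b : Y) : ℝ := (k.1 b : ℕ) / (n : ℝ)

lemma fr_mem (hn : 0 < n) (k : Tp Y n) : fr k ∈ stdSimplex ℝ Y := by
  have hn' : (0 : ℝ) < n := by exact_mod_cast hn
  refine ⟨fun b => by unfold fr; positivity, ?_⟩
  unfold fr
  rw [← sum_div, div_eq_one_iff_eq hn'.ne']
  exact_mod_cast k.2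

lemma sum_letters (hn : 0 < n) (f : Y → ℝ) (y : Fin n → Y) :
    ∑ i, f (y i) = n * ∑ b, fr (ty y) b * f b := by
  have hn' : (n : ℝ) ≠ 0 := by exact_mod_cast hn.ne'
  rw [← sum_fiberwise univ y, mul_sum]
  refine sum_congr rfl fun b _ => ?_
  rw [sum_congr rfl (g := fun _ => f b) (by intro i hi; rw [(mem_filter.1 hi).2]), sum_const]
  simp only [nsmul_eq_mul, fr, ty, cnt]
  field_simp

lemma card_class (k : Y → ℕ) (hk : ∑ b, k b = n) :
    (univ.filter fun y : Fin n → Y => cnt y = k).card = Nat.multinomial univ k := by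
  have h1 := Fintype.sum_pow (fun b : Y => (MvPolynomial.X b : MvPolynomial Y ℕ)) n
  rw [sum_pow_eq_sum_piAntidiag] at h1
  have h2 := congrArg (MvPolynomial.coeff (Finsupp.equivFunOnFinite.symm k)) h1
  have hm : ∀ k' : Y → ℕ, ∏ b, (MvPolynomial.X b : MvPolynomial Y ℕ) ^ k' b
      = MvPolynomial.monomial (Finsupp.equivFunOnFinite.symm k') 1 := by
    intro k'
    rw [MvPolynomial.monomial_eq]
    simp [Finsupp.prod_fintype]
  simp only [prod_cnt, hm] at h2
  rw [MvPolynomial.coeff_sum, MvPolynomial.coeff_sum] at h2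
  have hc : ∀ k' : Y → ℕ, ((Nat.multinomial univ k' : ℕ) : MvPolynomial Y ℕ)
      = MvPolynomial.C (Nat.multinomial univ k') := fun k' => by simp
  simp only [hc, MvPolynomial.coeff_C_mul, MvPolynomial.coeff_monomial,
    Equiv.apply_eq_iff_eq] at h2
  rw [card_filter]
  rw [show (∑ y : Fin n → Y, if cnt y = k then 1 else 0) = _ from h2.symm]
  simp [hk]

lemma card_Tp : (Fintype.card (Tp Y n) : ℝ) ≤ ((n : ℝ) + 1) ^ Fintype.card Y := by
  have h := Fintype.card_subtype_le (fun k : Y → Fin (n + 1) => ∑ b, (k b : ℕ) = n)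
  rw [Fintype.card_fun, Fintype.card_fin] at h
  exact_mod_cast h

/-- Probability of a type class. -/
def cp (pr : Y → ℝ) (k : Tp Y n) : ℝ := ∑ y ∈ univ.filter (fun y : Fin n → Y => ty y = k), ∏ i, pr (y i)

/-- Relative entropy exponent. -/
def Dv (pr θ : Y → ℝ) : ℝ := ∑ b, (θ b * log (θ b) - θ b * log (pr b))

lemma sum_cp (pr : Y → ℝ) (h1 : ∑ b, pr b = 1) : ∑ k : Tp Y n, cp pr k = 1 := by
  unfold cp
  rw [sum_fiberwise, ← Fintype.sum_pow, h1, one_pow]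

lemma cp_nonneg (pr : Y → ℝ) (h0 : ∀ b, 0 ≤ pr b) (k : Tp Y n) : 0 ≤ cp pr k :=
  sum_nonneg fun _ _ => prod_nonneg fun _ _ => h0 _

lemma ty_eq_iff (y : Fin n → Y) (k : Tp Y n) : ty y = k ↔ cnt y = fun b => (k.1 b : ℕ) := by
  constructor
  · rintro rfl; rfl
  · intro h
    apply Subtype.ext
    funext b
    exact Fin.ext (congrFun h b)

lemma exists_ty (k : Tp Y n) : ∃ y : Fin n → Y, ty y = k := by
  have := card_class (fun b => (k.1 b : ℕ)) k.2
  have h0 : 0 < (univ.filter fun y : Fin n → Y => cnt y = fun b => (k.1 b : ℕ)).card := by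
    rw [this]; exact Nat.multinomial_pos _ _
  obtain ⟨y, hy⟩ := card_pos.1 h0
  exact ⟨y, (ty_eq_iff y k).2 (mem_filter.1 hy).2⟩

lemma cp_eq (pr : Y → ℝ) (k : Tp Y n) :
    cp pr k = Nat.multinomial univ (fun b => (k.1 b : ℕ)) * ∏ b, pr b ^ (k.1 b : ℕ) := by
  unfold cp
  rw [sum_congr rfl (g := fun _ => ∏ b, pr b ^ (k.1 b : ℕ)), sum_const,
    ← card_class _ k.2, nsmul_eq_mul]
  · simp only [ty_eq_iff]
  · intro y hy
    have := (ty_eq_iff y k).1 (mem_filter.1 hy).2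
    rw [prod_cnt, this]

lemma fact_ineq (k k' : ℕ) : k.factorial * k ^ k' ≤ k'.factorial * k ^ k := by
  rcases le_total k k' with h | h
  · calc k.factorial * k ^ k' = (k.factorial * k ^ (k' - k)) * k ^ k := by
          rw [mul_assoc, ← pow_add]; congr 2; omega
      _ ≤ _ := Nat.mul_le_mul_right _ (Nat.factorial_mul_pow_sub_le_factorial h)
  · have h1 : k.factorial ≤ k'.factorial * k ^ (k - k') := by
      have := Nat.factorial_mul_descFactorial (n := k) (k := k - k') (by omega)
      rw [← this]
      have h2 : k - (k - k') = k' := by omega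
      rw [h2]
      exact Nat.mul_le_mul_left _ (Nat.descFactorial_le_pow _ _)
    calc k.factorial * k ^ k' ≤ k'.factorial * k ^ (k - k') * k ^ k' := Nat.mul_le_mul_right _ h1
      _ = _ := by rw [mul_assoc, ← pow_add]; congr 2; omega

lemma cp_own (k k' : Tp Y n) : cp (fr k) k' ≤ cp (fr k) k := by
  rcases Nat.eq_zero_or_pos n with rfl | hn
  · apply le_of_eq
    congr 1
    apply Subtype.ext
    funext b
    apply Fin.ext
    have h1 := k.2
    have h2 := k'.2
    simp only [sum_eq_zero_iff, mem_univ, true_implies] at h1 h2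
    rw [h1, h2]
  have hn' : (0 : ℝ) < n := by exact_mod_cast hn
  rw [cp_eq, cp_eq]
  have hp : ∀ l : Tp Y n, ∏ b, fr k b ^ (l.1 b : ℕ)
      = (∏ b, ((k.1 b : ℕ) : ℝ) ^ (l.1 b : ℕ)) / (n : ℝ) ^ n := by
    intro l
    unfold fr
    simp only [div_pow]
    rw [prod_div_distrib]
    congr 1
    rw [prod_pow_eq_pow_sum, l.2]
  rw [hp, hp, ← mul_div_assoc, ← mul_div_assoc]
  apply div_le_div_of_nonneg_right _ (by positivity)
  have hs : ∀ l : Tp Y n, (∏ b, ((l.1 b : ℕ).factorial : ℝ)) *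
      (Nat.multinomial univ (fun b => (l.1 b : ℕ)) : ℝ) = n.factorial := by
    intro l
    have := Nat.multinomial_spec univ (fun b => (l.1 b : ℕ))
    rw [l.2] at this
    exact_mod_cast this
  set A := ∏ b, ((k.1 b : ℕ).factorial : ℝ)
  set A' := ∏ b, ((k'.1 b : ℕ).factorial : ℝ)
  have hA : 0 < A := prod_pos fun b _ => by exact_mod_cast Nat.factorial_pos _
  have hA' : 0 < A' := prod_pos fun b _ => by exact_mod_cast Nat.factorial_pos _
  have e1 := hs k
  have e2 := hs k'
  set m := (Nat.multinomial univ (fun b => (k.1 b : ℕ)) : ℝ)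
  set m' := (Nat.multinomial univ (fun b => (k'.1 b : ℕ)) : ℝ)
  have key : A * ∏ b, ((k.1 b : ℕ) : ℝ) ^ (k'.1 b : ℕ) ≤ A' * ∏ b, ((k.1 b : ℕ) : ℝ) ^ (k.1 b : ℕ) := by
    rw [← prod_mul_distrib, ← prod_mul_distrib]
    refine prod_le_prod (fun b _ => by positivity) fun b _ => ?_
    exact_mod_cast fact_ineq (k.1 b) (k'.1 b)
  have hm : m = n.factorial / A := by rw [eq_div_iff hA.ne', mul_comm]; exact e1
  have hm' : m' = n.factorial / A' := by rw [eq_div_iff hA'.ne', mul_comm]; exact e2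
  rw [hm, hm', div_mul_eq_mul_div, div_mul_eq_mul_div, div_le_div_iff₀ hA' hA]
  have hf : (0 : ℝ) ≤ n.factorial := by positivity
  nlinarith [mul_le_mul_of_nonneg_left key hf]

lemma cp_shift (hn : 0 < n) (pr : Y → ℝ) (hpr : ∀ b, 0 < pr b) (k : Tp Y n) :
    cp pr k = exp (-(n * Dv pr (fr k))) * cp (fr k) k := by
  unfold cp
  rw [mul_sum]
  refine sum_congr rfl fun y hy => ?_
  have hk := (mem_filter.1 hy).2
  have hn' : (0 : ℝ) < n := by exact_mod_cast hn
  have hpos : ∀ i, 0 < fr k (y i) := by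
    intro i
    rw [← hk]
    unfold fr ty cnt
    refine div_pos ?_ hn'
    have : 0 < (univ.filter fun j => y j = y i).card := card_pos.2 ⟨i, by simp⟩
    exact_mod_cast this
  have h1 : ∏ i, pr (y i) = exp (∑ i, log (pr (y i))) := by
    rw [exp_sum]; exact prod_congr rfl fun i _ => (exp_log (hpr _)).symm
  have h2 : ∏ i, fr k (y i) = exp (∑ i, log (fr k (y i))) := by
    rw [exp_sum]; exact prod_congr rfl fun i _ => (exp_log (hpos _)).symm
  rw [h1, h2, ← exp_add]
  congr 1
  rw [sum_letters hn (fun b => log (pr b)), sum_letters hn (fun b => log (fr k b)), hk]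
  unfold Dv
  rw [sum_sub_distrib]; ring

lemma cp_le (hn : 0 < n) (pr : Y → ℝ) (hpr : ∀ b, 0 < pr b) (k : Tp Y n) :
    cp pr k ≤ exp (-(n * Dv pr (fr k))) := by
  rw [cp_shift hn pr hpr]
  have h := sum_cp (n := n) (fr k) (fr_mem hn k).2
  have h1 : cp (fr k) k ≤ 1 := by
    rw [← h]
    exact single_le_sum (fun l _ => cp_nonneg (fr k) (fr_mem hn k).1 l) (mem_univ k)
  exact mul_le_of_le_one_right (exp_pos _).le h1

lemma le_cp (hn : 0 < n) (pr : Y → ℝ) (hpr : ∀ b, 0 < pr b) (k : Tp Y n) :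
    exp (-(n * Dv pr (fr k))) ≤ ((n : ℝ) + 1) ^ Fintype.card Y * cp pr k := by
  rw [cp_shift hn pr hpr]
  have h := sum_cp (n := n) (fr k) (fr_mem hn k).2
  have h1 : 1 ≤ (Fintype.card (Tp Y n) : ℝ) * cp (fr k) k := by
    calc (1 : ℝ) = ∑ l : Tp Y n, cp (fr k) l := h.symm
      _ ≤ ∑ l : Tp Y n, cp (fr k) k := sum_le_sum fun l _ => cp_own k l
      _ = _ := by simp
  have h2 : 1 ≤ ((n : ℝ) + 1) ^ Fintype.card Y * cp (fr k) k :=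
    h1.trans (mul_le_mul_of_nonneg_right card_Tp (cp_nonneg _ (fr_mem hn k).1 _))
  nlinarith [exp_pos (-(n * Dv pr (fr k)))]

/-- Rounding to types. -/
lemma round_type (hn : 0 < n) (θ : Y → ℝ) (hθ : θ ∈ stdSimplex ℝ Y) :
    ∃ k : Tp Y n, dist (fr k) θ ≤ ((Fintype.card Y : ℝ) + 1) / n := by
  have hn' : (0 : ℝ) < n := by exact_mod_cast hn
  have hne : Nonempty Y := by
    by_contra h
    rw [not_nonempty_iff] at h
    have := hθ.2
    simp at this
  obtain ⟨b0⟩ := hne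
  set fl : Y → ℕ := fun b => ⌊(n : ℝ) * θ b⌋₊ with hfl
  have hle : ∀ b, (fl b : ℝ) ≤ n * θ b := fun b => Nat.floor_le (mul_nonneg hn'.le (hθ.1 b))
  have hlt : ∀ b, (n : ℝ) * θ b < fl b + 1 := fun b => Nat.lt_floor_add_one _
  have hs : (∑ b, (fl b : ℝ)) ≤ n := by
    calc ∑ b, (fl b : ℝ) ≤ ∑ b, n * θ b := sum_le_sum fun b _ => hle b
      _ = n := by rw [← mul_sum, hθ.2, mul_one]
  have hs2 : (n : ℝ) ≤ (∑ b, (fl b : ℝ)) + Fintype.card Y := by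
    calc (n : ℝ) = ∑ b, n * θ b := by rw [← mul_sum, hθ.2, mul_one]
      _ ≤ ∑ b, ((fl b : ℝ) + 1) := sum_le_sum fun b _ => (hlt b).le
      _ = _ := by rw [sum_add_distrib]; simp
  have hsN : ∑ b, fl b ≤ n := by exact_mod_cast hs
  set k : Y → ℕ := fun b => fl b + if b = b0 then n - ∑ b, fl b else 0 with hk
  have hks : ∑ b, k b = n := by
    simp only [hk, sum_add_distrib, sum_ite_eq', mem_univ, if_true]
    omega
  have hkl : ∀ b, k b < n + 1 := fun b => by
    have : k b ≤ ∑ b, k b := single_le_sum (fun _ _ => Nat.zero_le _) (mem_univ b)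
    omega
  refine ⟨⟨fun b => ⟨k b, hkl b⟩, hks⟩, ?_⟩
  rw [dist_pi_le_iff (by positivity)]
  intro b
  rw [Real.dist_eq]
  have hcard : (0 : ℝ) ≤ Fintype.card Y := by positivity
  have e1 : fr (⟨fun b => ⟨k b, hkl b⟩, hks⟩ : Tp Y n) b - θ b = ((k b : ℝ) - n * θ b) / n := by
    unfold fr
    simp only
    field_simp
  rw [e1, abs_div, abs_of_pos hn']
  apply div_le_div_of_nonneg_right _ hn'.le
  have hr : ((if b = b0 then n - ∑ b, fl b else 0 : ℕ) : ℝ) ≤ Fintype.card Y := by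
    split_ifs
    · rw [Nat.cast_sub hsN]; push_cast; linarith
    · simp
  have hr0 : (0 : ℝ) ≤ ((if b = b0 then n - ∑ b, fl b else 0 : ℕ) : ℝ) := by positivity
  have hkb : (k b : ℝ) = fl b + ((if b = b0 then n - ∑ b, fl b else 0 : ℕ) : ℝ) := by
    simp only [hk]; rw [Nat.cast_add]
  rw [abs_le]
  constructor
  · linarith [hlt b]
  · linarith [hle b]

end Types

section Assembly
variable {X Y X' Y' : Type} [Fintype X] [Fintype Y] [DecidableEq Y] [Fintype X'] [Fintype Y']
  [DecidableEq Y'] {n : ℕ}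

/-- Product vector of a sequence of letters. -/
def col (p : Y → X → ℝ) (y : Fin n → Y) : (Fin n → X) → ℝ := fun x => ∏ i, p (y i) (x i)

/-- Matrix of a family. -/
def fmat (pr : Y → ℝ) (p : Y → X → ℝ) : Matrix X Y ℝ := Matrix.of fun x y => pr y * p y x

lemma kronPow_fmat (pr : Y → ℝ) (p : Y → X → ℝ) (y : Fin n → Y) :
    (fun x => kronPow (fmat pr p) n x y) = fun x => (∏ i, pr (y i)) * col p y x := by
  funext x
  simp [kronPow, fmat, col, prod_mul_distrib]

lemma sum_col (p : Y → X → ℝ) (hp : ∀ y, ∑ x, p y x = 1) (y : Fin n → Y) :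
    ∑ x, col p y x = 1 := by
  unfold col
  rw [← Fintype.prod_sum (fun i x => p (y i) x)]
  simp [hp]

lemma col_nonneg (p : Y → X → ℝ) (hp : ∀ y x, 0 ≤ p y x) (y : Fin n → Y) (x : Fin n → X) :
    0 ≤ col p y x := prod_nonneg fun _ _ => hp _ _

lemma grid_find (kk : ℕ → ℕ) (J k : ℕ) (h0 : kk 0 ≤ k) (hJ : k < kk J) :
    ∃ j < J, kk j ≤ k ∧ k < kk (j + 1) := by
  induction J with
  | zero => omega
  | succ J ih =>
    rcases lt_or_ge k (kk J) with h | h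
    · obtain ⟨j, hj, h1⟩ := ih h
      exact ⟨j, by omega, h1⟩
    · exact ⟨J, by omega, h, hJ⟩

theorem crit_of_types (pr : Y → ℝ) (p : Y → X → ℝ) (qr : Y' → ℝ) (q : Y' → X' → ℝ)
    (hpr : ∀ y, 0 < pr y) (hqr : ∀ y, 0 < qr y)
    (hp : ∀ y x, 0 ≤ p y x) (hp1 : ∀ y, ∑ x, p y x = 1)
    (hq : ∀ y x, 0 ≤ q y x) (hq1 : ∀ y, ∑ x, q y x = 1)
    (kk : ℕ → ℕ) (J : ℕ) (hk0 : kk 0 = 1) (hkJ : Fintype.card (Fin n → X) ≤ kk J)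
    (a : Fin J → Tp Y n → ℝ) (b : Fin J → Tp Y' n → ℝ)
    (ha : ∀ (j : Fin J) y, tailk (col p y) (kk j) ≤ a j (ty y))
    (hb : ∀ (j : Fin J) y, b j (ty y) ≤ tailk (col q y) (kk (j.1 + 1)))
    (v : Tp Y n → Tp Y' n → ℝ) (hv : ∀ k l, 0 ≤ v k l) (hv1 : ∀ k, ∑ l, v k l = 1)
    (hvt : ∀ l, ∑ k, v k l * cp pr k = cp qr l)
    (hvj : ∀ l j, ∑ k, v k l * cp pr k * a j k ≤ cp qr l * b j l) :
    Crit (kronPow (fmat pr p) n) (kronPow (fmat qr q) n) := by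
  unfold Crit
  simp only [kronPow_fmat]
  have hprod : ∀ y : Fin n → Y, 0 ≤ ∏ i, pr (y i) := fun y => prod_nonneg fun i _ => (hpr _).le
  have hqrod : ∀ y : Fin n → Y', 0 < ∏ i, qr (y i) := fun y => prod_pos fun i _ => (hqr _)
  have hcq : ∀ y : Fin n → Y', 0 < cp qr (ty y) := fun y =>
    sum_pos (fun z _ => hqrod z) ⟨y, by simp⟩
  simp only [headk_smul _ (hprod _), headk_smul _ (hqrod _).le, ← mul_sum, sum_col p hp1,
    sum_col q hq1, mul_one]
  -- the weights
  set r : (Fin n → Y') → ℝ := fun y => (∏ i, qr (y i)) / cp qr (ty y) with hr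
  have hr0 : ∀ y, 0 ≤ r y := fun y => div_nonneg (hqrod y).le (hcq y).le
  have hfib : ∀ f : Tp Y n → ℝ, ∑ y : Fin n → Y, f (ty y) * ∏ i, pr (y i) = ∑ k, f k * cp pr k := by
    intro f
    rw [← sum_fiberwise univ (fun y : Fin n → Y => ty y)]
    refine sum_congr rfl fun k _ => ?_
    rw [cp, mul_sum]
    exact sum_congr rfl fun y hy => by rw [(mem_filter.1 hy).2]
  have htot : ∀ y', ∑ y, r y' * v (ty y) (ty y') * ∏ i, pr (y i) = ∏ i, qr (y' i) := by
    intro y'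
    have : ∀ y : Fin n → Y, r y' * v (ty y) (ty y') * ∏ i, pr (y i)
        = r y' * (v (ty y) (ty y') * ∏ i, pr (y i)) := fun y => by ring
    simp only [this]
    rw [← mul_sum, hfib (fun k => v k (ty y')), hvt, hr]
    exact div_mul_cancel₀ _ (hcq y').ne'
  refine ⟨fun y y' => r y' * v (ty y) (ty y'), fun y y' => mul_nonneg (hr0 _) (hv _ _), ?_, htot, ?_⟩
  · intro y
    rw [← sum_fiberwise univ (fun y' : Fin n → Y' => ty y')]
    rw [← hv1 (ty y)]
    refine sum_congr rfl fun l _ => ?_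
    have h1 : ∀ y' ∈ univ.filter (fun y' : Fin n → Y' => ty y' = l),
        r y' * v (ty y) (ty y') = (∏ i, qr (y' i)) * (v (ty y) l / cp qr l) := by
      intro y' hy'
      rw [hr]; simp only [(mem_filter.1 hy').2]; ring
    rw [sum_congr rfl h1, ← sum_mul]
    obtain ⟨y', rfl⟩ := exists_ty l
    exact mul_div_cancel₀ _ (hcq y').ne'
  · intro y' k
    have hw : ∀ y, 0 ≤ r y' * v (ty y) (ty y') := fun y => mul_nonneg (hr0 _) (hv _ _)
    -- reduce to total when k is large
    rcases Nat.eq_zero_or_pos k with rfl | hk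
    · simp [headk_zero]
    rcases lt_or_ge k (kk J) with hlt | hge
    · obtain ⟨j, hj, h1, h2⟩ := grid_find kk J k (by omega) hlt
      have step : headk (col q y') (kk (j + 1)) * (∏ i, qr (y' i)) ≤
          ∑ y, r y' * v (ty y) (ty y') * ((∏ i, pr (y i)) * headk (col p y) (kk j)) := by
        have hh : ∀ y : Fin n → Y, headk (col p y) (kk j) = 1 - tailk (col p y) (kk j) := fun y => by
          rw [tailk, sum_col p hp1]; ring
        have hh' : headk (col q y') (kk (j+1)) = 1 - tailk (col q y') (kk (j+1)) := by
          rw [tailk, sum_col q hq1]; ring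
        have e1 : ∀ y : Fin n → Y, r y' * v (ty y) (ty y') * ((∏ i, pr (y i)) * headk (col p y) (kk j))
            = r y' * v (ty y) (ty y') * (∏ i, pr (y i))
              - r y' * (v (ty y) (ty y') * tailk (col p y) (kk j) * (∏ i, pr (y i))) := fun y => by
          rw [hh]; ring
        simp only [e1, sum_sub_distrib, htot]
        rw [hh', ← mul_sum]
        have e2 : ∑ y : Fin n → Y, v (ty y) (ty y') * tailk (col p y) (kk j) * (∏ i, pr (y i))
            ≤ ∑ y : Fin n → Y, (v (ty y) (ty y') * a ⟨j, hj⟩ (ty y)) * (∏ i, pr (y i)) :=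
          sum_le_sum fun y _ => mul_le_mul_of_nonneg_right
            (mul_le_mul_of_nonneg_left (ha ⟨j, hj⟩ y) (hv _ _)) (hprod y)
        rw [hfib (fun k => v k (ty y') * a ⟨j, hj⟩ k)] at e2
        have e3 : ∑ k, v k (ty y') * a ⟨j, hj⟩ k * cp pr k ≤ cp qr (ty y') * b ⟨j, hj⟩ (ty y') := by
          refine le_trans (le_of_eq ?_) (hvj (ty y') ⟨j, hj⟩)
          exact sum_congr rfl fun k _ => by ring
        have e4 := mul_le_mul_of_nonneg_left (hb ⟨j, hj⟩ y') (hcq y').le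
        have e5 : r y' * ∑ y : Fin n → Y, v (ty y) (ty y') * tailk (col p y) (kk j) * (∏ i, pr (y i))
            ≤ r y' * (cp qr (ty y') * tailk (col q y') (kk (j + 1))) :=
          mul_le_mul_of_nonneg_left (e2.trans (e3.trans e4)) (hr0 _)
        have e6 : r y' * (cp qr (ty y') * tailk (col q y') (kk (j + 1)))
            = (∏ i, qr (y' i)) * tailk (col q y') (kk (j + 1)) := by
          rw [hr, ← mul_assoc]; simp only; rw [div_mul_cancel₀ _ (hcq y').ne']
        nlinarith [e5, e6]
      calc (∏ i, qr (y' i)) * headk (col q y') k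
          ≤ (∏ i, qr (y' i)) * headk (col q y') (kk (j + 1)) :=
            mul_le_mul_of_nonneg_left (headk_mono _ h2.le) (hqrod y').le
        _ ≤ _ := by rw [mul_comm]; exact step
        _ ≤ _ := sum_le_sum fun y _ => mul_le_mul_of_nonneg_left
            (mul_le_mul_of_nonneg_left (headk_mono _ h1) (hprod y)) (hw y)
    · have : ∀ y : Fin n → Y, headk (col p y) k = 1 := fun y => by
        rw [headk_full (col_nonneg p hp y) (hkJ.trans hge), sum_col p hp1]
      simp only [this, mul_one, htot]
      refine mul_le_of_le_one_right (hqrod y').le ?_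
      rw [← sum_col q hq1 y']
      exact headk_le_sum (col_nonneg q hq y') k

end Assembly
end CM

namespace CM
open Real Finset

/-! ### Minimax -/
section Minimax
open Topology

lemma cont_integrable {K : Type*} [TopologicalSpace K] [CompactSpace K] [MeasurableSpace K]
    [BorelSpace K] (ν : Measure K) [IsFiniteMeasure ν] {f : K → ℝ} (hf : Continuous f) :
    Integrable f ν := by
  obtain ⟨C, hC⟩ := (isCompact_range hf).isBounded.exists_norm_le
  exact Integrable.of_bound hf.aestronglyMeasurable C (ae_of_all _ fun x => hC _ ⟨x, rfl⟩)

/-- Representation of nonnegative functionals by probability measures. -/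
lemma exists_prob {K : Type*} [TopologicalSpace K] [CompactSpace K] [T2Space K] [MeasurableSpace K]
    [BorelSpace K] (f : C(K, ℝ) →L[ℝ] ℝ) (hf : ∀ g, (∀ k, 0 ≤ g k) → 0 ≤ f g) (h1 : 0 < f 1) :
    ∃ ν : Measure K, IsProbabilityMeasure ν ∧ ∀ g : C(K, ℝ), ∫ k, g k ∂ν = (f 1)⁻¹ * f g := by
  let L : CompactlySupportedContinuousMap K ℝ →ₚ[ℝ] ℝ :=
  { toFun g := (f 1)⁻¹ * f g.toContinuousMap
    map_add' g g' := by
      rw [← mul_add, ← map_add]; rfl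
    map_smul' c g := by
      have : (c • g).toContinuousMap = c • g.toContinuousMap := rfl
      rw [this, map_smul]; simp; ring
    monotone' g g' hgg' := by
      have h2 : 0 ≤ f (g'.toContinuousMap - g.toContinuousMap) := hf _ fun k => by
        have := hgg' k
        simpa using this
      rw [map_sub] at h2
      exact mul_le_mul_of_nonneg_left (by linarith) (by positivity) }
  have hI : ∀ g : C(K, ℝ), ∫ k, g k ∂(RealRMK.rieszMeasure L) = (f 1)⁻¹ * f g := by
    intro g
    let g' : CompactlySupportedContinuousMap K ℝ :=
    { toFun := g
      hasCompactSupport' := HasCompactSupport.of_compactSpace _ }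
    exact RealRMK.integral_rieszMeasure L g'
  refine ⟨RealRMK.rieszMeasure L, ?_, hI⟩
  have h2 := hI 1
  rw [inv_mul_cancel₀ h1.ne'] at h2
  simp only [ContinuousMap.one_apply, integral_const, smul_eq_mul, mul_one] at h2
  constructor
  have h3 : (RealRMK.rieszMeasure L).real Set.univ = 1 := h2
  rw [Measure.real, ENNReal.toReal_eq_one_iff] at h3
  exact h3

lemma minimax_pt {E K : Type*} [NormedAddCommGroup E] [NormedSpace ℝ E]
    [TopologicalSpace K] [CompactSpace K] [T2Space K] [MeasurableSpace K]
    [BorelSpace K] (Θ : Set E) (hΘ : Convex ℝ Θ) (hne : Θ.Nonempty) (F : E → K → ℝ)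
    (hF : ∀ θ, Continuous (F θ)) (hconv : ∀ k, ConvexOn ℝ Θ (fun θ => F θ k))
    (h : ∀ ν : Measure K, IsProbabilityMeasure ν → ∃ θ ∈ Θ, ∫ k, F θ k ∂ν < 0) :
    ∃ θ ∈ Θ, ∀ k, F θ k < 0 := by
  by_contra hno
  push Not at hno
  set S : Set C(K, ℝ) := {g | ∀ k, g k < 0} with hS
  set T : Set C(K, ℝ) := {g | ∃ θ ∈ Θ, ∀ k, F θ k ≤ g k} with hT
  have hSo : IsOpen S := by
    have : S = {g : C(K, ℝ) | Set.MapsTo g Set.univ (Set.Iio 0)} := by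
      ext g; simp [hS, Set.MapsTo]
    rw [this]
    exact ContinuousMap.isOpen_setOfPred_mapsTo isCompact_univ isOpen_Iio
  have hSc : Convex ℝ S := by
    intro g hg g' hg' a b ha hb hab k
    have h1 := hg k
    have h2 := hg' k
    simp only [ContinuousMap.add_apply, ContinuousMap.smul_apply, smul_eq_mul]
    rcases eq_or_lt_of_le ha with rfl | ha'
    · have : b = 1 := by linarith
      subst this; simpa using h2
    · nlinarith
  have hTc : Convex ℝ T := by
    rintro g ⟨θ, hθ, hg⟩ g' ⟨θ', hθ', hg'⟩ a b ha hb hab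
    refine ⟨a • θ + b • θ', hΘ hθ hθ' ha hb hab, fun k => ?_⟩
    have h1 := (hconv k).2 hθ hθ' ha hb hab
    simp only [smul_eq_mul] at h1
    simp only [ContinuousMap.add_apply, ContinuousMap.smul_apply, smul_eq_mul]
    nlinarith [mul_le_mul_of_nonneg_left (hg k) ha, mul_le_mul_of_nonneg_left (hg' k) hb]
  have hd : Disjoint S T := by
    rw [Set.disjoint_left]
    rintro g hg ⟨θ, hθ, hg'⟩
    obtain ⟨k, hk⟩ := hno θ hθ
    have := hg k
    linarith [hg' k]
  obtain ⟨f, u, h1, h2⟩ := geometric_hahn_banach_open hSc hSo hTc hd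
  have hm1 : (-1 : C(K, ℝ)) ∈ S := fun k => by simp
  -- f ≤ 0 on S
  have hfS : ∀ g ∈ S, f g ≤ 0 := by
    intro g hg
    by_contra hpos
    push Not at hpos
    have hc : 0 < (|u| + 1) / f g := by positivity
    have h3 := h1 (((|u| + 1) / f g) • g) (fun k => by
      have := hg k
      simp only [ContinuousMap.smul_apply, smul_eq_mul]
      exact mul_neg_of_pos_of_neg hc this)
    rw [map_smul, smul_eq_mul, div_mul_cancel₀ _ hpos.ne'] at h3
    linarith [le_abs_self u]
  have hu : 0 ≤ u := by
    by_contra hneg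
    push Not at hneg
    have h3 := hfS _ hm1
    have h4 := h1 _ hm1
    have h5 : f (-1) < 0 := by linarith
    have hc : 0 < u / f (-1) / 2 := by
      have := div_pos_of_neg_of_neg hneg h5
      positivity
    have h3 := h1 ((u / f (-1) / 2) • (-1)) (fun k => by
      simp only [ContinuousMap.smul_apply, ContinuousMap.neg_apply, ContinuousMap.one_apply,
        smul_eq_mul]
      linarith)
    rw [map_smul, smul_eq_mul] at h3
    have : u / f (-1) / 2 * f (-1) = u / 2 := by
      rw [div_mul_eq_mul_div, div_mul_cancel₀ _ h5.ne]
    linarith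
  have hf1 : 0 ≤ f 1 := by
    have := hfS _ hm1
    rw [map_neg] at this
    linarith
  have hpos : ∀ g : C(K, ℝ), (∀ k, 0 ≤ g k) → 0 ≤ f g := by
    intro g hg
    have h3 : ∀ e : ℝ, 0 < e → - (e * f 1) ≤ f g := by
      intro e he
      have := hfS (-g - e • 1) (fun k => by
        simp only [ContinuousMap.sub_apply, ContinuousMap.neg_apply, ContinuousMap.smul_apply,
          ContinuousMap.one_apply, smul_eq_mul]
        linarith [hg k])
      rw [map_sub, map_neg, map_smul, smul_eq_mul] at this
      linarith
    by_contra hneg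
    push Not at hneg
    have h4 := h3 (-(f g) / (2 * (f 1 + 1))) (div_pos (by linarith) (by linarith))
    have h5 : -(f g) / (2 * (f 1 + 1)) * f 1 ≤ -(f g) / 2 := by
      rw [div_mul_eq_mul_div, div_le_div_iff₀ (by linarith) (by norm_num)]
      nlinarith
    linarith
  have hf1' : 0 < f 1 := by
    rcases hf1.eq_or_lt with h0 | h0
    · exfalso
      obtain ⟨θ, hθ⟩ := hne
      set g : C(K, ℝ) := ⟨F θ, hF θ⟩
      have h3 := h2 g ⟨θ, hθ, fun k => le_rfl⟩
      have h4 := hpos (‖g‖ • 1 - g) (fun k => by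
        have := (le_abs_self _).trans (g.norm_coe_le_norm k)
        simp only [ContinuousMap.sub_apply, ContinuousMap.smul_apply,
          ContinuousMap.one_apply, smul_eq_mul]
        linarith)
      rw [map_sub, map_smul, ← h0] at h4
      have h5 := h1 _ hm1
      rw [map_neg, ← h0] at h5
      simp only [smul_eq_mul, mul_zero] at h4
      linarith
    · exact h0
  obtain ⟨ν, hν, hI⟩ := exists_prob f hpos hf1'
  obtain ⟨θ, hθ, hlt⟩ := h ν hν
  have h3 := h2 ⟨F θ, hF θ⟩ ⟨θ, hθ, fun k => le_rfl⟩
  have h4 := hI ⟨F θ, hF θ⟩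
  simp only [ContinuousMap.coe_mk] at h4
  rw [h4] at hlt
  have : 0 ≤ (f 1)⁻¹ * f ⟨F θ, hF θ⟩ := mul_nonneg (by positivity) (by linarith)
  linarith

theorem minimax {Z E K : Type*} [TopologicalSpace Z] [CompactSpace Z]
    [NormedAddCommGroup E] [NormedSpace ℝ E]
    [TopologicalSpace K] [CompactSpace K] [Nonempty K] [T2Space K] [MeasurableSpace K]
    [BorelSpace K] (Θ : Set E) (hΘ : Convex ℝ Θ) (hne : Θ.Nonempty) (F : Z → E → K → ℝ)
    (hF : Continuous (fun q : (Z × E) × K => F q.1.1 q.1.2 q.2))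
    (hconv : ∀ z k, ConvexOn ℝ Θ (fun θ => F z θ k))
    (h : ∀ z, ∀ ν : Measure K, IsProbabilityMeasure ν → ∃ θ ∈ Θ, ∫ k, F z θ k ∂ν < 0) :
    ∃ ε > 0, ∀ z, ∃ θ ∈ Θ, ∀ θ', dist θ' θ < ε → ∀ k, F z θ' k ≤ -ε := by
  set G : Z × E → ℝ := fun q => sSup ((fun k => F q.1 q.2 k) '' Set.univ) with hG
  have hGc : Continuous G :=
    IsCompact.continuous_sSup (f := fun (q : Z × E) k => F q.1 q.2 k) isCompact_univ hF
  have hcont : ∀ z θ, Continuous (fun k => F z θ k) := fun z θ =>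
    hF.comp (by fun_prop : Continuous fun k : K => ((z, θ), k))
  have hGle : ∀ q k, F q.1 q.2 k ≤ G q := fun q k =>
    le_csSup (isCompact_univ.image (hcont q.1 q.2)).bddAbove ⟨k, trivial, rfl⟩
  have hpt : ∀ z, ∃ θ ∈ Θ, G (z, θ) < 0 := by
    intro z
    obtain ⟨θ, hθ, hlt⟩ := minimax_pt Θ hΘ hne (F z) (fun θ => hcont z θ) (hconv z) (h z)
    refine ⟨θ, hθ, ?_⟩
    obtain ⟨k, -, hk⟩ := (isCompact_univ.image (hcont z θ)).sSup_mem
      (Set.image_nonempty.2 Set.univ_nonempty)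
    rw [hG]; simp only; rw [← hk]; exact hlt k
  have := isCompact_univ (X := Z) |>.induction_on
    (p := fun S => ∃ ε > 0, ∀ z ∈ S, ∃ θ ∈ Θ, ∀ θ', dist θ' θ < ε → ∀ k, F z θ' k ≤ -ε)
    ⟨1, one_pos, by simp⟩
    (by
      rintro S T hST ⟨ε, hε, hh⟩
      exact ⟨ε, hε, fun z hz => hh z (hST hz)⟩)
    (by
      rintro S T ⟨ε, hε, hh⟩ ⟨ε', hε', hh'⟩
      refine ⟨min ε ε', lt_min hε hε', ?_⟩
      rintro z (hz | hz)
      · obtain ⟨θ, hθ, h3⟩ := hh z hz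
        exact ⟨θ, hθ, fun θ' hd k => (h3 θ' (hd.trans_le (min_le_left _ _)) k).trans
          (neg_le_neg (min_le_left _ _))⟩
      · obtain ⟨θ, hθ, h3⟩ := hh' z hz
        exact ⟨θ, hθ, fun θ' hd k => (h3 θ' (hd.trans_le (min_le_right _ _)) k).trans
          (neg_le_neg (min_le_right _ _))⟩)
    (by
      intro z _
      obtain ⟨θ, hθ, hlt⟩ := hpt z
      have hev : ∀ᶠ q in 𝓝 (z, θ), G q < G (z, θ) / 2 :=
        hGc.continuousAt.eventually (gt_mem_nhds (by linarith))
      rw [nhds_prod_eq, Filter.eventually_prod_iff] at hev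
      obtain ⟨pa, hpa, pb, hpb, hab⟩ := hev
      rw [Metric.eventually_nhds_iff] at hpb
      obtain ⟨r, hr, hrb⟩ := hpb
      refine ⟨{z' | pa z'}, mem_nhdsWithin_of_mem_nhds hpa, min r (-(G (z, θ) / 2)), lt_min hr (by linarith), ?_⟩
      intro z' hz'
      refine ⟨θ, hθ, fun θ' hd k => ?_⟩
      have h4 := hab hz' (hrb (hd.trans_le (min_le_left _ _)))
      have h5 := hGle (z', θ') k
      have h6 := min_le_right r (-(G (z, θ) / 2))
      simp only at h5
      linarith)
  obtain ⟨ε, hε, hh⟩ := this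
  exact ⟨ε, hε, fun z => hh z trivial⟩

end Minimax
end CM

set_option linter.unusedSectionVars false
namespace CM
open Real Finset

/-! ### Analytic facts about power sums -/
section Analytic
open Topology
variable {X : Type*} [Fintype X] {V : X → ℝ}

lemma pw_hasDerivAt {v : ℝ} (hv : 0 ≤ v) (s : ℝ) : HasDerivAt (pw v) (pw v s * log v) s := by
  rcases hv.eq_or_lt with h | h
  · have : pw v = fun _ => 0 := by funext s; simp [pw, ← h]
    rw [this, zero_mul]; exact hasDerivAt_const _ _
  · have : pw v = fun s => exp (s * log v) := by funext s; exact pw_of_pos h s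
    rw [this]
    have := ((hasDerivAt_id s).mul_const (log v)).exp
    simpa using this

lemma Sm_hasDerivAt (hV : ∀ x, 0 ≤ V x) (s : ℝ) :
    HasDerivAt (Sm V) (∑ x, pw (V x) s * log (V x)) s := by
  have : Sm V = fun s => ∑ x, pw (V x) s := rfl
  rw [this]
  exact HasDerivAt.fun_sum fun x _ => pw_hasDerivAt (hV x) s

lemma psi_hasDerivAt (hV : ∀ x, 0 ≤ V x) (h0 : ∃ x, 0 < V x) (s : ℝ) :
    HasDerivAt (psi V) (- am V s) s := by
  have h := (Sm_hasDerivAt hV s).log (Sm_pos hV h0 s).ne'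
  refine h.congr_deriv ?_
  unfold am
  simp only [mul_neg, sum_neg_distrib]
  ring

lemma psi_cont (hV : ∀ x, 0 ≤ V x) (h0 : ∃ x, 0 < V x) : Continuous (psi V) :=
  continuous_iff_continuousAt.2 fun s => (psi_hasDerivAt hV h0 s).continuousAt

lemma am_cont (hV : ∀ x, 0 ≤ V x) (h0 : ∃ x, 0 < V x) : Continuous (am V) := by
  unfold am
  refine Continuous.div ?_ ?_ fun s => (Sm_pos hV h0 s).ne'
  · refine continuous_finsetSum _ fun x _ => ?_
    have : Continuous (pw (V x)) :=
      continuous_iff_continuousAt.2 fun s => (pw_hasDerivAt (hV x) s).continuousAt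
    exact this.mul continuous_const
  · exact continuous_iff_continuousAt.2 fun s => (Sm_hasDerivAt hV s).continuousAt

lemma pw_add {v : ℝ} (hv : 0 ≤ v) (s δ : ℝ) : pw v (s + δ) = pw v s * exp (δ * log v) := by
  rcases hv.eq_or_lt with h | h
  · simp [pw, ← h]
  · rw [pw_of_pos h, pw_of_pos h, ← exp_add]; ring_nf

/-- Supporting line. -/
lemma psi_support (hV : ∀ x, 0 ≤ V x) (h0 : ∃ x, 0 < V x) (s s' : ℝ) :
    psi V s - am V s * (s' - s) ≤ psi V s' := by
  have hS := Sm_pos hV h0 s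
  set m := - am V s * (s' - s) with hm
  have h1 : Sm V s * exp m ≤ Sm V s' := by
    have h2 : ∀ x, pw (V x) s * (exp m * (1 + ((s' - s) * log (V x) - m))) ≤ pw (V x) s' := by
      intro x
      have : s' = s + (s' - s) := by ring
      rw [this, pw_add (hV x), ← this]
      apply mul_le_mul_of_nonneg_left _ (pw_nonneg (hV x) s)
      have h3 := add_one_le_exp ((s' - s) * log (V x) - m)
      calc exp m * (1 + ((s' - s) * log (V x) - m)) ≤ exp m * exp ((s' - s) * log (V x) - m) :=
            mul_le_mul_of_nonneg_left (by linarith) (exp_pos _).le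
        _ = _ := by rw [← exp_add]; ring_nf
    have h3 := sum_le_sum fun x (_ : x ∈ univ) => h2 x
    refine le_trans (le_of_eq ?_) h3
    have h4 : ∀ x, pw (V x) s * (exp m * (1 + ((s' - s) * log (V x) - m)))
        = exp m * ((1 - m) * pw (V x) s - (s' - s) * (pw (V x) s * (- log (V x)))) := fun x => by ring
    simp only [h4]
    rw [← mul_sum, sum_sub_distrib, ← mul_sum, ← mul_sum]
    have h5 : ∑ x, pw (V x) s * (- log (V x)) = am V s * Sm V s := by
      unfold am; rw [div_mul_cancel₀ _ hS.ne']
    rw [h5]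
    have h6 : ∑ x, pw (V x) s = Sm V s := rfl
    rw [h6, hm]; ring
  have h2 := log_le_log (by positivity) h1
  rw [log_mul hS.ne' (exp_pos _).ne', log_exp] at h2
  unfold psi
  linarith

/-- Second order upper bound. -/
lemma psi_taylor (hV : ∀ x, 0 ≤ V x) (h0 : ∃ x, 0 < V x) {B : ℝ}
    (hB : ∀ x, |log (V x)| ≤ B) (s δ : ℝ) (hδ : |δ| * B ≤ 1) :
    psi V (s + δ) ≤ psi V s - δ * am V s + δ ^ 2 * B ^ 2 := by
  have hS := Sm_pos hV h0 s
  have h1 : Sm V (s + δ) ≤ Sm V s * exp (- δ * am V s + δ ^ 2 * B ^ 2) := by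
    have h2 : ∀ x, pw (V x) (s + δ) ≤ pw (V x) s * (1 + δ * log (V x) + δ ^ 2 * B ^ 2) := by
      intro x
      rw [pw_add (hV x)]
      apply mul_le_mul_of_nonneg_left _ (pw_nonneg (hV x) s)
      have hz : |δ * log (V x)| ≤ 1 := by
        rw [abs_mul]
        exact (mul_le_mul_of_nonneg_left (hB x) (abs_nonneg _)).trans hδ
      have h3 := (abs_le.1 (Real.abs_exp_sub_one_sub_id_le hz)).2
      have h4 : (δ * log (V x)) ^ 2 ≤ δ ^ 2 * B ^ 2 := by
        rw [mul_pow]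
        exact mul_le_mul_of_nonneg_left (sq_le_sq.2 ((hB x).trans (le_abs_self _))) (sq_nonneg _)
      linarith
    have h3 := sum_le_sum fun x (_ : x ∈ univ) => h2 x
    have h4 : ∀ x, pw (V x) s * (1 + δ * log (V x) + δ ^ 2 * B ^ 2)
        = (1 + δ ^ 2 * B ^ 2) * pw (V x) s - δ * (pw (V x) s * (- log (V x))) := fun x => by ring
    simp only [h4] at h3
    rw [sum_sub_distrib, ← mul_sum, ← mul_sum] at h3
    have h5 : ∑ x, pw (V x) s * (- log (V x)) = am V s * Sm V s := by
      unfold am; rw [div_mul_cancel₀ _ hS.ne']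
    have h6 : ∑ x, pw (V x) s = Sm V s := rfl
    have h7 : ∑ x, pw (V x) (s + δ) = Sm V (s + δ) := rfl
    rw [h5, h6, h7] at h3
    have h8 := add_one_le_exp (- δ * am V s + δ ^ 2 * B ^ 2)
    nlinarith [mul_le_mul_of_nonneg_left h8 hS.le]
  have h2 := log_le_log (Sm_pos hV h0 _) h1
  rw [log_mul hS.ne' (exp_pos _).ne', log_exp] at h2
  unfold psi
  linarith

lemma prob_pos (hV1 : ∑ x, V x = 1) (hV : ∀ x, 0 ≤ V x) : ∃ x, 0 < V x := by
  by_contra h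
  push Not at h
  have : ∑ x, V x ≤ 0 := sum_nonpos fun x _ => h x
  linarith

/-- Rényi entropy function (natural logarithm) of real order. -/
def Ht (V : X → ℝ) (s : ℝ) : ℝ := - dslope (psi V) 1 s

lemma psi_one (hV1 : ∑ x, V x = 1) : psi V 1 = 0 := by
  unfold psi; rw [Sm_one, hV1, log_one]

lemma Ht_cont (hV : ∀ x, 0 ≤ V x) (h0 : ∃ x, 0 < V x) : Continuous (Ht V) := by
  have hc : Continuous (dslope (psi V) 1) := by
    rw [continuous_iff_continuousAt]
    intro s
    rcases eq_or_ne s 1 with rfl | hs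
    · exact continuousAt_dslope_same.2 (psi_hasDerivAt hV h0 1).differentiableAt
    · exact (continuousAt_dslope_of_ne hs).2 (psi_cont hV h0).continuousAt
  exact hc.neg

lemma Ht_one (hV : ∀ x, 0 ≤ V x) (h0 : ∃ x, 0 < V x) : Ht V 1 = am V 1 := by
  unfold Ht
  rw [dslope_same, (psi_hasDerivAt hV h0 1).deriv, neg_neg]

lemma Ht_of_ne (hV1 : ∑ x, V x = 1) {s : ℝ} (hs : s ≠ 1) : Ht V s = (1 - s)⁻¹ * psi V s := by
  unfold Ht
  rw [dslope_of_ne _ hs, slope_def_field, psi_one hV1, sub_zero]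
  have h1 : s - 1 ≠ 0 := sub_ne_zero.2 hs
  have h2 : 1 - s ≠ 0 := sub_ne_zero.2 hs.symm
  field_simp
  ring

lemma Ht_mul (hV1 : ∑ x, V x = 1) (s : ℝ) : (1 - s) * Ht V s = psi V s := by
  rcases eq_or_ne s 1 with rfl | hs
  · simp [psi_one hV1]
  · rw [Ht_of_ne hV1 hs, mul_inv_cancel_left₀ (sub_ne_zero.2 hs.symm)]

/-- Maximum entry. -/
def vmax (V : X → ℝ) : ℝ := ⨆ x, V x

lemma le_vmax (V : X → ℝ) (x : X) : V x ≤ vmax V := le_ciSup (Finite.bddAbove_range V) x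

lemma vmax_pos (h0 : ∃ x, 0 < V x) : 0 < vmax V := by
  obtain ⟨x, hx⟩ := h0; exact hx.trans_le (le_vmax V x)

lemma exists_vmax (h0 : ∃ x, 0 < V x) : ∃ x, V x = vmax V := by
  obtain ⟨x, hx⟩ := h0
  haveI : Nonempty X := ⟨x⟩
  exact exists_eq_ciSup_of_finite

lemma psi_ge_vmax (hV : ∀ x, 0 ≤ V x) (h0 : ∃ x, 0 < V x) (u : ℝ) : u * log (vmax V) ≤ psi V u := by
  obtain ⟨x, hx⟩ := exists_vmax h0
  have h1 : exp (u * log (vmax V)) ≤ Sm V u := by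
    rw [← hx, ← pw_of_pos (by rw [hx]; exact vmax_pos h0)]
    exact single_le_sum (f := fun x => pw (V x) u) (fun x _ => pw_nonneg (hV x) u) (mem_univ x)
  have := log_le_log (exp_pos _) h1
  rwa [log_exp] at this

lemma psi_le_vmax (hV : ∀ x, 0 ≤ V x) (h0 : ∃ x, 0 < V x) {u : ℝ} (hu : 0 ≤ u) :
    psi V u ≤ log (Fintype.card X) + u * log (vmax V) := by
  have h1 : Sm V u ≤ Fintype.card X * exp (u * log (vmax V)) := by
    calc Sm V u ≤ ∑ x : X, exp (u * log (vmax V)) := by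
          refine sum_le_sum fun x _ => ?_
          rcases (hV x).eq_or_lt with h | h
          · rw [← h, pw_zero_left]; exact (exp_pos _).le
          · rw [pw_of_pos h]
            exact exp_le_exp.2 (mul_le_mul_of_nonneg_left (log_le_log h (le_vmax V x)) hu)
      _ = _ := by simp
  have hc : (0 : ℝ) < Fintype.card X := by
    obtain ⟨x, _⟩ := h0
    exact_mod_cast Fintype.card_pos_iff.2 ⟨x⟩
  have := log_le_log (Sm_pos hV h0 u) h1
  rwa [log_mul hc.ne' (exp_pos _).ne', log_exp] at this

/-- `β H_{1/(1-β)}`. -/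
def Mf (V : X → ℝ) (β : ℝ) : ℝ :=
  if β < 1 then -((1 - β) * psi V (1 / (1 - β))) else - log (vmax V)

lemma Mf_lt {β : ℝ} (h : β < 1) : Mf V β = -((1 - β) * psi V (1 / (1 - β))) := if_pos h
lemma Mf_one : Mf V 1 = - log (vmax V) := if_neg (lt_irrefl _)
lemma Mf_zero (hV1 : ∑ x, V x = 1) : Mf V 0 = 0 := by
  rw [Mf_lt one_pos]; simp [psi_one hV1]

lemma Mf_le_one (hV : ∀ x, 0 ≤ V x) (h0 : ∃ x, 0 < V x) {β : ℝ} (hβ : β ≤ 1) : Mf V β ≤ Mf V 1 := by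
  rcases hβ.eq_or_lt with rfl | h
  · exact le_rfl
  · rw [Mf_one, Mf_lt h]
    have h1 := psi_ge_vmax hV h0 (1 / (1 - β))
    have h2 : 0 < 1 - β := by linarith
    have h3 := mul_le_mul_of_nonneg_left h1 h2.le
    rw [← mul_assoc, mul_one_div_cancel h2.ne', one_mul] at h3
    linarith

lemma Mf_cont (hV : ∀ x, 0 ≤ V x) (h0 : ∃ x, 0 < V x) :
    ContinuousOn (Mf V) (Set.Iic 1) := by
  intro β hβ
  rcases (show β ≤ 1 from hβ).eq_or_lt with rfl | h
  · -- squeeze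
    have hl : ∀ b ∈ Set.Iic (1 : ℝ), Mf V 1 - (1 - b) * log (Fintype.card X) ≤ Mf V b := by
      intro b hb
      rcases (show b ≤ 1 from hb).eq_or_lt with rfl | h
      · simp
      · rw [Mf_one, Mf_lt h]
        have h2 : 0 < 1 - b := by linarith
        have h1 := psi_le_vmax hV h0 (u := 1 / (1 - b)) (by positivity)
        have h3 := mul_le_mul_of_nonneg_left h1 h2.le
        rw [mul_add, ← mul_assoc, mul_one_div_cancel h2.ne', one_mul] at h3
        linarith
    have hu : ∀ b ∈ Set.Iic (1 : ℝ), Mf V b ≤ Mf V 1 := fun b hb => Mf_le_one hV h0 hb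
    refine tendsto_of_tendsto_of_tendsto_of_le_of_le'
      (g := fun b => Mf V 1 - (1 - b) * log (Fintype.card X)) (h := fun _ => Mf V 1) ?_ ?_ ?_ ?_
    · have : Continuous fun b : ℝ => Mf V 1 - (1 - b) * log (Fintype.card X) := by fun_prop
      have h := this.tendsto 1
      simp only [sub_self, zero_mul, sub_zero] at h
      exact h.mono_left nhdsWithin_le_nhds
    · exact tendsto_const_nhds
    · exact Filter.eventually_of_mem self_mem_nhdsWithin hl
    · exact Filter.eventually_of_mem self_mem_nhdsWithin hu
  · apply ContinuousAt.continuousWithinAt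
    have h1 : ContinuousAt (fun b => -((1 - b) * psi V (1 / (1 - b)))) β := by
      have h2 : ContinuousAt (fun b : ℝ => 1 / (1 - b)) β :=
        ContinuousAt.div continuousAt_const (by fun_prop) (by linarith)
      have h3 : ContinuousAt (fun b : ℝ => psi V (1 / (1 - b))) β :=
        ContinuousAt.comp (f := fun b : ℝ => 1 / (1 - b)) (psi_cont hV h0).continuousAt h2
      exact (ContinuousAt.mul (by fun_prop) h3).neg
    refine h1.congr ?_
    filter_upwards [gt_mem_nhds h] with b hb
    rw [Mf_lt hb]

lemma Mf_support (hV : ∀ x, 0 ≤ V x) (h0 : ∃ x, 0 < V x) {b : ℝ} (hb : b < 1) :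
    ∃ c : ℝ, (∀ β ≤ 1, Mf V β ≤ Mf V b + c * (β - b)) := by
  set u := 1 / (1 - b) with hu
  have hb' : 0 < 1 - b := by linarith
  have hub : (1 - b) * u = 1 := mul_one_div_cancel hb'.ne'
  have hlt : ∀ β < 1, Mf V β ≤ Mf V b + (psi V u + am V u * u) * (β - b) := by
    intro β h
    rw [Mf_lt h, Mf_lt hb, ← hu]
    have h2 : 0 < 1 - β := by linarith
    have h1 := mul_le_mul_of_nonneg_left (psi_support hV h0 u (1 / (1 - β))) h2.le
    have h3 : (1 - β) * (1 / (1 - β)) = 1 := mul_one_div_cancel h2.ne'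
    have h4 : (1 - β) * (psi V u - am V u * (1 / (1 - β) - u))
        = (1 - β) * psi V u - am V u * (1 - (1 - β) * u) := by
      rw [mul_sub, mul_left_comm, mul_sub, h3]
    rw [h4] at h1
    have h5 : 1 - (1 - β) * u = (β - b) * u := by linear_combination -hub
    rw [h5] at h1
    linarith
  refine ⟨psi V u + am V u * u, fun β hβ => ?_⟩
  rcases hβ.eq_or_lt with rfl | h
  · have hc := (Mf_cont hV h0) 1 (by simp)
    have hc' : Filter.Tendsto (Mf V) (𝓝[<] 1) (𝓝 (Mf V 1)) :=
      hc.mono_left (nhdsWithin_mono _ Set.Iio_subset_Iic_self)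
    have hc2 : Filter.Tendsto (fun β => Mf V b + (psi V u + am V u * u) * (β - b)) (𝓝[<] 1)
        (𝓝 (Mf V b + (psi V u + am V u * u) * (1 - b))) := by
      have : Continuous (fun β => Mf V b + (psi V u + am V u * u) * (β - b)) := by fun_prop
      exact (this.tendsto 1).mono_left nhdsWithin_le_nhds
    exact le_of_tendsto_of_tendsto hc' hc2
      (Filter.eventually_of_mem self_mem_nhdsWithin fun β hβ => hlt β hβ)
  · exact hlt β h

lemma logB_exists (V : X → ℝ) : ∃ B : ℝ, 0 < B ∧ ∀ x, |log (V x)| ≤ B := by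
  refine ⟨∑ x, |log (V x)| + 1, by positivity, fun x => ?_⟩
  have := single_le_sum (f := fun x => |log (V x)|) (fun x _ => abs_nonneg _) (mem_univ x)
  linarith

/-- Near zero the slope of `Mf` is the Shannon entropy. -/
lemma Mf_slope (hV : ∀ x, 0 ≤ V x) (hV1 : ∑ x, V x = 1) {B : ℝ} (hB0 : 0 < B)
    (hB : ∀ x, |log (V x)| ≤ B) {β : ℝ} (h0 : 0 < β) (h1 : β ≤ 1 / 2) (h2 : 2 * β * B ≤ 1) :
    β * (am V 1 - 2 * β * B ^ 2) ≤ Mf V β := by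
  have hb : β < 1 := by linarith
  rw [Mf_lt hb]
  have h3 : 0 < 1 - β := by linarith
  set δ := β / (1 - β) with hδ
  have hδ0 : 0 < δ := by positivity
  have e1 : 1 / (1 - β) = 1 + δ := by rw [hδ]; field_simp; ring
  have e2 : (1 - β) * δ = β := by rw [hδ]; field_simp
  have e3 : δ ≤ 2 * β := by
    rw [hδ, div_le_iff₀ h3]; nlinarith
  have h4 := psi_taylor hV (prob_pos hV1 hV) hB 1 δ (by
    rw [abs_of_pos hδ0]; nlinarith)
  rw [psi_one hV1] at h4
  rw [e1]
  have h5 := mul_le_mul_of_nonneg_left h4 h3.le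
  have h6 : (1 - β) * (0 - δ * am V 1 + δ ^ 2 * B ^ 2) = - β * am V 1 + β * δ * B ^ 2 := by
    have : (1 - β) * (0 - δ * am V 1 + δ ^ 2 * B ^ 2)
      = - ((1 - β) * δ) * am V 1 + ((1 - β) * δ) * δ * B ^ 2 := by ring
    rw [this, e2]
  rw [h6] at h5
  have h7 : β * δ * B ^ 2 ≤ β * (2 * β) * B ^ 2 :=
    mul_le_mul_of_nonneg_right (mul_le_mul_of_nonneg_left e3 h0.le) (sq_nonneg _)
  linarith

end Analytic
end CM

set_option linter.unusedSectionVars false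
namespace CM
open Real Finset

/-! ### Conditionally mixing channels and convex functions -/
section Mixing
variable {X Y Y' : Type} [Fintype X] [Fintype Y] [Fintype Y']

lemma mix_decomp {P : Matrix X Y ℝ} {Q : Matrix X Y' ℝ} (h : CondMixed P Q) :
    ∃ (κ : Type) (_ : Fintype κ) (σ : κ → Equiv.Perm X) (C : κ → Y → Y' → ℝ),
      (∀ k y y', 0 ≤ C k y y') ∧ (∀ y, ∑ y', ∑ k, C k y y' = 1) ∧
      ∀ x y', Q x y' = ∑ k, ∑ y, C k y y' * P (σ k x) y := by
  classical
  obtain ⟨k, S, D, hS, hD, hD1, rfl⟩ := h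
  have hb : ∀ i, ∃ w : Equiv.Perm X → ℝ, (∀ σ, 0 ≤ w σ) ∧ ∑ σ, w σ = 1 ∧
      ∑ σ, w σ • σ.permMatrix ℝ = S i := by
    intro i
    apply exists_eq_sum_perm_of_mem_doublyStochastic
    rw [mem_doublyStochastic_iff_sum]
    exact ⟨(hS i).1, (hS i).2.1, (hS i).2.2⟩
  choose w hw0 hw1 hwS using hb
  refine ⟨Fin k × Equiv.Perm X, inferInstance, fun q => q.2,
    fun q y y' => w q.1 q.2 * D q.1 y y', fun q y y' => mul_nonneg (hw0 _ _) (hD _ _ _), ?_, ?_⟩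
  · intro y
    rw [← hD1 y]
    refine sum_congr rfl fun y' _ => ?_
    rw [Fintype.sum_prod_type]
    refine sum_congr rfl fun i _ => ?_
    simp only
    rw [← sum_mul, hw1, one_mul]
  · intro x y'
    rw [Fintype.sum_prod_type, Matrix.sum_apply]
    refine sum_congr rfl fun i _ => ?_
    rw [Matrix.mul_assoc, Matrix.mul_apply]
    simp only [← hwS, Matrix.sum_apply, Matrix.smul_apply, smul_eq_mul]
    simp only [sum_mul]
    rw [sum_comm]
    refine sum_congr rfl fun σ _ => ?_
    have : ∀ j, (Equiv.Perm.permMatrix ℝ σ) x j = if j = σ x then 1 else 0 := by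
      intro j
      simp [Equiv.Perm.permMatrix, PEquiv.toMatrix_apply, eq_comm]
    simp only [this, mul_ite, mul_one, mul_zero, ite_mul, zero_mul, sum_ite_eq', mem_univ, if_true]
    rw [Matrix.mul_apply, mul_sum]
    refine sum_congr rfl fun y _ => ?_
    ring

lemma condX_mem {P : Matrix X Y ℝ} (hP : ∀ x y, 0 ≤ P x y) {y : Y} (hy : 0 < margY P y) :
    condX P y ∈ stdSimplex ℝ X := by
  refine ⟨fun x => div_nonneg (hP _ _) hy.le, ?_⟩
  simp only [condX, ← sum_div]
  exact div_self hy.ne'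

lemma perm_mem {V : X → ℝ} (h : V ∈ stdSimplex ℝ X) (σ : Equiv.Perm X) :
    V ∘ σ ∈ stdSimplex ℝ X := by
  refine ⟨fun x => h.1 _, ?_⟩
  rw [← h.2]
  exact Equiv.sum_comp σ V

lemma margY_nonneg {P : Matrix X Y ℝ} (hP : ∀ x y, 0 ≤ P x y) (y : Y) : 0 ≤ margY P y :=
  sum_nonneg fun x _ => hP x y

lemma margY_mul_condX {P : Matrix X Y ℝ} (hP : ∀ x y, 0 ≤ P x y) (y : Y) (x : X) :
    margY P y * condX P y x = P x y := by
  unfold condX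
  rcases (margY_nonneg hP y).eq_or_lt with h | h
  · have : P x y = 0 := by
      have := (sum_eq_zero_iff_of_nonneg (fun x _ => hP x y)).1 h.symm
      exact this x (mem_univ x)
    rw [this]; simp
  · rw [mul_div_cancel₀ _ h.ne']

/-- The mixing representation of the conditioned distributions. -/
lemma mix_repr {P : Matrix X Y ℝ} {Q : Matrix X Y' ℝ} (hP : ∀ x y, 0 ≤ P x y)
    (h : CondMixed P Q) :
    ∃ (κ : Type) (_ : Fintype κ) (σ : κ → Equiv.Perm X) (C : κ → Y → Y' → ℝ),
      (∀ k y y', 0 ≤ C k y y') ∧ (∀ y, ∑ y', ∑ k, C k y y' = 1) ∧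
      (∀ y', margY Q y' = ∑ k, ∑ y, C k y y' * margY P y) ∧
      ∀ y', 0 < margY Q y' →
        condX Q y' = ∑ q ∈ (univ : Finset (κ × Y)).filter (fun q => 0 < margY P q.2),
          (C q.1 q.2 y' * margY P q.2 / margY Q y') • (condX P q.2 ∘ σ q.1) ∧
        ∑ q ∈ (univ : Finset (κ × Y)).filter (fun q => 0 < margY P q.2),
          (C q.1 q.2 y' * margY P q.2 / margY Q y') = 1 := by
  obtain ⟨κ, iκ, σ, C, hC, hC1, hQ⟩ := mix_decomp h
  have hm : ∀ y', margY Q y' = ∑ k, ∑ y, C k y y' * margY P y := by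
    intro y'
    unfold margY
    simp only [hQ]
    rw [sum_comm]
    refine sum_congr rfl fun k _ => ?_
    rw [sum_comm]
    refine sum_congr rfl fun y _ => ?_
    rw [← mul_sum]
    congr 1
    exact Equiv.sum_comp (σ k) (fun x => P x y)
  refine ⟨κ, iκ, σ, C, hC, hC1, hm, fun y' hy' => ⟨?_, ?_⟩⟩
  · funext x
    rw [Finset.sum_apply]
    simp only [Pi.smul_apply, smul_eq_mul, Function.comp]
    rw [sum_filter_of_ne, Fintype.sum_prod_type]
    · show Q x y' / margY Q y' = _
      rw [hQ, sum_div]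
      refine sum_congr rfl fun k _ => ?_
      rw [sum_div]
      refine sum_congr rfl fun y _ => ?_
      have := margY_mul_condX hP y (σ k x)
      rw [← this]
      ring
    · intro q _ hq
      rcases (margY_nonneg hP q.2).eq_or_lt with h | h
      · rw [← h] at hq; simp at hq
      · exact h
  · rw [← sum_div, sum_filter_of_ne, Fintype.sum_prod_type, ← hm, div_self hy'.ne']
    intro q _ hq
    rcases (margY_nonneg hP q.2).eq_or_lt with h | h
    · rw [← h] at hq; simp at hq
    · exact h

lemma mix_nonneg {P : Matrix X Y ℝ} {Q : Matrix X Y' ℝ} (hP : ∀ x y, 0 ≤ P x y)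
    (h : CondMixed P Q) : ∀ x y, 0 ≤ Q x y := by
  obtain ⟨κ, iκ, σ, C, hC, hC1, hQ⟩ := mix_decomp h
  intro x y
  rw [hQ]
  exact sum_nonneg fun k _ => sum_nonneg fun y _ => mul_nonneg (hC _ _ _) (hP _ _)

lemma mix_jensen {P : Matrix X Y ℝ} {Q : Matrix X Y' ℝ} (hP : ∀ x y, 0 ≤ P x y)
    (h : CondMixed P Q) {g : (X → ℝ) → ℝ} (hg : ConvexOn ℝ (stdSimplex ℝ X) g)
    (hσ : ∀ (σ : Equiv.Perm X) V, g (V ∘ σ) = g V) :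
    ∑ y' ∈ univ.filter (fun y => 0 < margY Q y), margY Q y' * g (condX Q y') ≤
    ∑ y ∈ univ.filter (fun y => 0 < margY P y), margY P y * g (condX P y) := by
  obtain ⟨κ, iκ, σ, C, hC, hC1, hm, hr⟩ := mix_repr hP h
  have h1 : ∀ y' ∈ univ.filter (fun y => 0 < margY Q y), margY Q y' * g (condX Q y') ≤
      ∑ q ∈ (univ : Finset (κ × Y)).filter (fun q => 0 < margY P q.2),
        C q.1 q.2 y' * margY P q.2 * g (condX P q.2) := by
    intro y' hy'
    have hy : 0 < margY Q y' := (mem_filter.1 hy').2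
    obtain ⟨e1, e2⟩ := hr y' hy
    have hj := hg.map_sum_le (t := (univ : Finset (κ × Y)).filter (fun q => 0 < margY P q.2))
      (w := fun q => C q.1 q.2 y' * margY P q.2 / margY Q y')
      (p := fun q => condX P q.2 ∘ σ q.1)
      (fun q _ => div_nonneg (mul_nonneg (hC _ _ _) (margY_nonneg hP _)) hy.le) e2
      (fun q hq => perm_mem (condX_mem hP (mem_filter.1 hq).2) _)
    rw [← e1] at hj
    simp only [hσ, smul_eq_mul] at hj
    have := mul_le_mul_of_nonneg_left hj hy.le
    refine this.trans (le_of_eq ?_)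
    rw [mul_sum]
    refine sum_congr rfl fun q _ => ?_
    field_simp
  refine (sum_le_sum h1).trans ?_
  have hz : ∀ y' ∉ univ.filter (fun y => 0 < margY Q y), ∀ q ∈
      (univ : Finset (κ × Y)).filter (fun q => 0 < margY P q.2), C q.1 q.2 y' * margY P q.2 = 0 := by
    intro y' hy' q hq
    simp only [mem_filter, mem_univ, true_and, not_lt] at hy'
    have h0 : margY Q y' = 0 := le_antisymm hy' (margY_nonneg (mix_nonneg hP h) y')
    rw [hm] at h0
    have h2 := (sum_eq_zero_iff_of_nonneg (fun k _ => sum_nonneg fun y _ =>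
      mul_nonneg (hC k y y') (margY_nonneg hP y))).1 h0 q.1 (mem_univ _)
    exact (sum_eq_zero_iff_of_nonneg (fun y _ =>
      mul_nonneg (hC q.1 y y') (margY_nonneg hP y))).1 h2 q.2 (mem_univ _)
  rw [sum_subset (subset_univ _) (fun y' _ hy' => sum_eq_zero fun q hq => by
    rw [hz y' hy' q hq, zero_mul])]
  rw [sum_comm]
  apply le_of_eq
  rw [sum_filter, Fintype.sum_prod_type, sum_comm, sum_filter]
  refine sum_congr rfl fun y _ => ?_
  by_cases hy : 0 < margY P y
  · simp only [hy, if_true]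
    have : ∀ k y', C k y y' * margY P y * g (condX P y) = C k y y' * (margY P y * g (condX P y)) :=
      fun _ _ => by ring
    simp only [this, ← sum_mul]
    rw [sum_comm, hC1, one_mul]
  · simp [hy]

lemma mix_quasi {P : Matrix X Y ℝ} {Q : Matrix X Y' ℝ} (hP : ∀ x y, 0 ≤ P x y)
    (h : CondMixed P Q) {g : (X → ℝ) → ℝ} (hg : QuasiconcaveOn ℝ (stdSimplex ℝ X) g)
    (hσ : ∀ (σ : Equiv.Perm X) V, g (V ∘ σ) = g V) {m : ℝ}
    (hm : ∀ y, 0 < margY P y → m ≤ g (condX P y)) {y' : Y'} (hy' : 0 < margY Q y') :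
    m ≤ g (condX Q y') := by
  obtain ⟨κ, iκ, σ, C, hC, hC1, hm', hr⟩ := mix_repr hP h
  obtain ⟨e1, e2⟩ := hr y' hy'
  have := (hg m).sum_mem (t := (univ : Finset (κ × Y)).filter (fun q => 0 < margY P q.2))
      (w := fun q => C q.1 q.2 y' * margY P q.2 / margY Q y')
      (z := fun q => condX P q.2 ∘ σ q.1)
      (fun q _ => div_nonneg (mul_nonneg (hC _ _ _) (margY_nonneg hP _)) hy'.le) e2
      (fun q hq => ⟨perm_mem (condX_mem hP (mem_filter.1 hq).2) _, by
        rw [hσ]; exact hm _ (mem_filter.1 hq).2⟩)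
  rw [← e1] at this
  exact this.2

lemma exists_marg_pos {P : Matrix X Y ℝ} (hP : IsJointProb P) : ∃ y, 0 < margY P y := by
  by_contra hc
  push Not at hc
  have h1 : ∑ y, margY P y = 1 := by
    unfold margY; rw [sum_comm]; exact hP.2
  have : ∑ y, margY P y ≤ 0 := sum_nonpos fun y _ => hc y
  linarith

lemma mix_joint {P : Matrix X Y ℝ} {Q : Matrix X Y' ℝ} (hP : IsJointProb P)
    (h : CondMixed P Q) : IsJointProb Q := by
  refine ⟨mix_nonneg hP.1 h, ?_⟩
  obtain ⟨κ, iκ, σ, C, hC, hC1, hm, hr⟩ := mix_repr hP.1 h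
  have : ∑ x, ∑ y, Q x y = ∑ y, margY Q y := by unfold margY; rw [sum_comm]
  rw [this]
  simp only [hm]
  rw [sum_comm]
  have : ∑ k, ∑ y', ∑ y, C k y y' * margY P y = ∑ y, (∑ y', ∑ k, C k y y') * margY P y := by
    simp only [sum_mul]
    simp_rw [sum_comm (s := (univ : Finset Y)) (t := (univ : Finset Y'))]
    rw [sum_comm]
    refine sum_congr rfl fun y _ => ?_
    rw [sum_comm]
  rw [this]
  simp only [hC1, one_mul]
  unfold margY; rw [sum_comm]; exact hP.2
end Mixing

/-! ### Entropies -/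

lemma renyi_perm {X : Type} [Fintype X] (α : ℝ≥0∞) (V : X → ℝ) (σ : Equiv.Perm X) :
    renyi α (V ∘ σ) = renyi α V := by
  unfold renyi
  have h1 : Nat.card {x : X // 0 < (V ∘ σ) x} = Nat.card {x : X // 0 < V x} :=
    Nat.card_congr (σ.subtypeEquiv fun x => Iff.rfl)
  have h2 : (⨆ x, (V ∘ σ) x) = ⨆ x, V x := Equiv.iSup_comp σ
  have h3 : ∑ x, (V ∘ σ) x * log2 ((V ∘ σ) x) = ∑ x, V x * log2 (V x) :=
    Equiv.sum_comp σ fun x => V x * log2 (V x)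
  have h4 : ∑ x, (V ∘ σ) x ^ α.toReal = ∑ x, V x ^ α.toReal :=
    Equiv.sum_comp σ fun x => V x ^ α.toReal
  rw [h1, h2, h3, h4]

/-- Averaged entropy in natural units. -/
def En {X : Type} [Fintype X] (τ : Measure ℝ≥0∞) (V : X → ℝ) : ℝ :=
  log 2 * ∫ α, renyi α V ∂τ

lemma En_perm {X : Type} [Fintype X] (τ : Measure ℝ≥0∞) (V : X → ℝ) (σ : Equiv.Perm X) :
    En τ (V ∘ σ) = En τ V := by
  unfold En; simp only [renyi_perm]

lemma log2_pos : 0 < log 2 := log_pos one_lt_two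

lemma exp2_En {X : Type} [Fintype X] (t : ℝ) (τ : Measure ℝ≥0∞) (V : X → ℝ) :
    exp2 (t * ∫ α, renyi α V ∂τ) = exp (t * En τ V) := by
  unfold exp2 En
  rw [rpow_def_of_pos two_pos]; ring_nf

lemma Hbulk_eq {X Y : Type} [Fintype X] [Fintype Y] (t : ℝ) (τ : Measure ℝ≥0∞)
    (P : Matrix X Y ℝ) : Hbulk t τ P = (t⁻¹ * log (∑ y ∈ univ.filter (fun y => 0 < margY P y),
    margY P y * exp (t * En τ (condX P y)))) / log 2 := by
  unfold Hbulk log2 logb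
  simp only [exp2_En]; ring

lemma HnegInf_eq {X Y : Type} [Fintype X] [Fintype Y] (τ : Measure ℝ≥0∞)
    (P : Matrix X Y ℝ) : HnegInf τ P =
      sInf ((fun y => En τ (condX P y) / log 2) '' {y | 0 < margY P y}) := by
  unfold HnegInf En
  congr 1
  refine Set.image_congr fun y _ => ?_
  field_simp [log2_pos.ne']

lemma bulk_sum_pos {X Y : Type} [Fintype X] [Fintype Y] {P : Matrix X Y ℝ} (hP : IsJointProb P)
    (t : ℝ) (τ : Measure ℝ≥0∞) : 0 < ∑ y ∈ univ.filter (fun y => 0 < margY P y),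
    margY P y * exp (t * En τ (condX P y)) := by
  obtain ⟨y, hy⟩ := exists_marg_pos hP
  exact sum_pos (fun y hy => mul_pos (mem_filter.1 hy).2 (exp_pos _))
    ⟨y, mem_filter.2 ⟨mem_univ _, hy⟩⟩

lemma mem_Dbulk_neg {t : ℝ} (ht : t < 0) {τ : Measure ℝ≥0∞} (hτ : IsProbabilityMeasure τ)
    (h : ∀ d : ℕ, ConvexOn ℝ (stdSimplex ℝ (Fin d)) fun V => exp (t * En τ V)) :
    (t, τ) ∈ Dbulk := by
  refine ⟨ht.ne, hτ, fun d n n' P Q hP hPQ => ?_⟩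
  simp only [Hbulk_eq]
  refine div_le_div_of_nonneg_right ?_ log2_pos.le
  refine mul_le_mul_of_nonpos_left ?_ (inv_nonpos.2 ht.le)
  exact log_le_log (bulk_sum_pos (mix_joint hP hPQ) t τ)
    (mix_jensen hP.1 hPQ (h d) (fun σ V => by rw [En_perm]))

lemma mem_Dbulk_pos {t : ℝ} (ht : 0 < t) {τ : Measure ℝ≥0∞} (hτ : IsProbabilityMeasure τ)
    (h : ∀ d : ℕ, ConcaveOn ℝ (stdSimplex ℝ (Fin d)) fun V => exp (t * En τ V)) :
    (t, τ) ∈ Dbulk := by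
  refine ⟨ht.ne', hτ, fun d n n' P Q hP hPQ => ?_⟩
  simp only [Hbulk_eq]
  refine div_le_div_of_nonneg_right ?_ log2_pos.le
  refine mul_le_mul_of_nonneg_left ?_ (inv_nonneg.2 ht.le)
  refine log_le_log (bulk_sum_pos hP t τ) ?_
  have := mix_jensen hP.1 hPQ (h d).neg (fun σ V => by simp [En_perm])
  simpa using this

lemma mem_DnegInf {τ : Measure ℝ≥0∞} (hτ : IsProbabilityMeasure τ)
    (h : ∀ d : ℕ, QuasiconcaveOn ℝ (stdSimplex ℝ (Fin d)) fun V => En τ V) :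
    τ ∈ DnegInf := by
  refine ⟨hτ, fun d n n' P Q hP hPQ => ?_⟩
  simp only [HnegInf_eq]
  obtain ⟨y0, hy0⟩ := exists_marg_pos (mix_joint hP hPQ)
  refine le_csInf ⟨_, y0, hy0, rfl⟩ ?_
  rintro _ ⟨y', hy', rfl⟩
  simp only
  rw [le_div_iff₀ log2_pos]
  refine mix_quasi hP.1 hPQ (h d) (fun σ V => En_perm τ V σ) ?_ hy'
  intro y hy
  rw [← le_div_iff₀ log2_pos]
  exact csInf_le (Set.toFinite _).bddBelow ⟨y, hy, rfl⟩

end CM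

set_option linter.unusedSectionVars false
namespace CM
open Real Finset

/-! ### Rényi entropies and power sums -/
section Renyi
variable {X : Type} [Fintype X] {V : X → ℝ}

lemma simplex_pos (hV : V ∈ stdSimplex ℝ X) : ∃ x, 0 < V x := prob_pos hV.2 hV.1

lemma renyi_zero (hV : ∀ x, 0 ≤ V x) : log 2 * renyi 0 V = psi V 0 := by
  classical
  unfold renyi log2 logb psi Sm
  rw [if_pos rfl, mul_div_cancel₀ _ log2_pos.ne']
  congr 1
  rw [Nat.card_eq_fintype_card, Fintype.card_subtype]
  have : ∀ x, pw (V x) 0 = if 0 < V x then 1 else 0 := by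
    intro x
    rcases (hV x).eq_or_lt with h | h
    · simp [← h]
    · simp [pw, h.ne', h]
  simp only [this, sum_boole]

lemma renyi_fin (hV : V ∈ stdSimplex ℝ X) {s : ℝ} (hs : 0 ≤ s) :
    log 2 * renyi (ENNReal.ofReal s) V = Ht V s := by
  rcases eq_or_ne s 0 with rfl | h0
  · rw [ENNReal.ofReal_zero, renyi_zero hV.1, Ht_of_ne hV.2 zero_ne_one]; simp
  rcases eq_or_ne s 1 with rfl | h1
  · rw [ENNReal.ofReal_one, Ht_one hV.1 (simplex_pos hV)]
    unfold renyi log2 logb am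
    rw [if_neg one_ne_zero, if_pos rfl, Sm_one, hV.2, div_one, mul_neg, mul_sum, ← sum_neg_distrib]
    refine sum_congr rfl fun x _ => ?_
    rw [pw_one]
    field_simp [log2_pos.ne']
  · have hs' : 0 < s := lt_of_le_of_ne hs (Ne.symm h0)
    rw [Ht_of_ne hV.2 h1]
    unfold renyi
    rw [if_neg (by simpa using hs'), if_neg (by simpa using h1), if_neg ENNReal.ofReal_ne_top,
      ENNReal.toReal_ofReal hs]
    unfold log2 logb psi Sm
    simp only [pw_of_ne h0]
    field_simp [log2_pos.ne']

/-- Order conjugate to `β`. -/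
def ub (β : ℝ) : ℝ≥0∞ := if β < 1 then ENNReal.ofReal (1 / (1 - β)) else ⊤

lemma renyi_ub (hV : V ∈ stdSimplex ℝ X) {β : ℝ} (h1 : β ≤ 1) :
    β * (log 2 * renyi (ub β) V) = Mf V β := by
  unfold ub
  rcases h1.eq_or_lt with rfl | h
  · rw [if_neg (lt_irrefl _), Mf_one]
    unfold renyi log2 logb vmax
    rw [if_neg (by simp), if_neg (by simp), if_pos rfl]
    field_simp [log2_pos.ne']
  · have h2 : 0 < 1 - β := by linarith
    rw [if_pos h, renyi_fin hV (by positivity), Mf_lt h, ← Ht_mul hV.2]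
    field_simp
    ring

lemma renyi_measurable (hV : V ∈ stdSimplex ℝ X) : Measurable fun α => renyi α V := by
  classical
  have : (fun α => renyi α V) = fun α : ℝ≥0∞ =>
      if α = ⊤ then renyi ⊤ V else Ht V α.toReal / log 2 := by
    funext α
    split_ifs with h
    · rw [h]
    · rw [eq_div_iff log2_pos.ne', mul_comm, ← renyi_fin hV ENNReal.toReal_nonneg,
        ENNReal.ofReal_toReal h]
  rw [this]
  refine Measurable.ite (measurableSet_singleton _) measurable_const ?_
  exact ((Ht_cont hV.1 (simplex_pos hV)).measurable.comp ENNReal.measurable_toReal).div_const _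

lemma psi_hom (hV : ∀ x, 0 ≤ V x) (h0 : ∃ x, 0 < V x) {w : ℝ} (hw : 0 < w) (s : ℝ) :
    psi (w • V) s = s * log w + psi V s := by
  unfold psi
  have : Sm (w • V) s = exp (s * log w) * Sm V s := by
    unfold Sm
    rw [mul_sum]
    refine sum_congr rfl fun x _ => ?_
    rw [Pi.smul_apply, smul_eq_mul, pw_mul hw.le (hV x), pw_of_pos hw]
  rw [this, log_mul (exp_pos _).ne' (Sm_pos hV h0 s).ne', log_exp]

lemma Mf_hom (hV : ∀ x, 0 ≤ V x) (h0 : ∃ x, 0 < V x) {w : ℝ} (hw : 0 < w) {β : ℝ} (h1 : β ≤ 1) :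
    Mf (w • V) β = Mf V β - log w := by
  rcases h1.eq_or_lt with rfl | h
  · rw [Mf_one, Mf_one]
    have : vmax (w • V) = w * vmax V := by
      unfold vmax
      simp only [Pi.smul_apply, smul_eq_mul]
      rw [Real.mul_iSup_of_nonneg hw.le]
    rw [this, log_mul hw.ne' (vmax_pos h0).ne']; ring
  · rw [Mf_lt h, Mf_lt h, psi_hom hV h0 hw]
    have : 1 - β ≠ 0 := by linarith
    field_simp
    ring

lemma Mf_add {a b : X → ℝ} (ha : ∀ x, 0 ≤ a x) (hb : ∀ x, 0 ≤ b x) (ha0 : ∃ x, 0 < a x)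
    (hb0 : ∃ x, 0 < b x) {β : ℝ} (h0 : 0 ≤ β) (h1 : β ≤ 1) :
    exp (- Mf (a + b) β) ≤ exp (- Mf a β) + exp (- Mf b β) := by
  have hab0 : ∃ x, 0 < (a + b) x := by
    obtain ⟨x, hx⟩ := ha0
    exact ⟨x, by simpa using add_pos_of_pos_of_nonneg hx (hb x)⟩
  have hab : ∀ x, 0 ≤ (a + b) x := fun x => add_nonneg (ha x) (hb x)
  rcases h1.eq_or_lt with rfl | h
  · rw [Mf_one, Mf_one, Mf_one, neg_neg, neg_neg, neg_neg, exp_log (vmax_pos hab0),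
      exp_log (vmax_pos ha0), exp_log (vmax_pos hb0)]
    obtain ⟨x, hx⟩ := exists_vmax hab0
    rw [← hx]
    exact add_le_add (le_vmax a x) (le_vmax b x)
  · have h2 : 0 < 1 - β := by linarith
    have e : ∀ V : X → ℝ, (∀ x, 0 ≤ V x) → (∃ x, 0 < V x) → exp (- Mf V β) =
        (∑ x, V x ^ (1 / (1 - β))) ^ (1 / (1 / (1 - β))) := by
      intro V hV hV0
      have e1 : ∑ x, V x ^ (1 / (1 - β)) = Sm V (1 / (1 - β)) := by
        unfold Sm
        refine sum_congr rfl fun x _ => ?_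
        rw [pw_of_ne (by positivity)]
      rw [e1, Mf_lt h, neg_neg, rpow_def_of_pos (Sm_pos hV hV0 _), one_div_one_div, mul_comm]
      rfl
    rw [e _ hab hab0, e _ ha ha0, e _ hb hb0]
    refine Real.Lp_add_le_of_nonneg univ ?_ (fun x _ => ha x) (fun x _ => hb x)
    rw [le_div_iff₀ h2]; linarith

lemma star_elem {u a : ℝ} (hu : 0 ≤ u) (hua : u ≤ a) {s : ℝ} (h0 : 0 ≤ s) (h1 : s ≤ 1) (c : ℝ) :
    exp (c * (1 - s)) * pw u s ≤ (1 - s) * exp c * pw a s + s * (pw a s * (u / a)) := by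
  have ha := hu.trans hua
  rcases hu.eq_or_lt with h | h
  · rw [← h, pw_zero_left, mul_zero, zero_div, mul_zero, mul_zero, add_zero]
    exact mul_nonneg (mul_nonneg (by linarith) (exp_pos _).le) (pw_nonneg ha s)
  · have ha' : 0 < a := h.trans_le hua
    have e : pw u s = pw a s * exp (s * log (u / a)) := by
      rw [pw_of_pos h, pw_of_pos ha', ← exp_add, log_div h.ne' ha'.ne']; ring_nf
    have hc := convexOn_exp.2 (Set.mem_univ c) (Set.mem_univ (log (u / a)))
      (show 0 ≤ 1 - s by linarith) h0 (by ring)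
    simp only [smul_eq_mul] at hc
    rw [exp_log (div_pos h ha'), exp_add] at hc
    have := mul_le_mul_of_nonneg_left hc (pw_nonneg ha s)
    rw [e, mul_comm c]
    linarith

lemma star {a b : X → ℝ} (ha : ∀ x, 0 ≤ a x) (hb : ∀ x, 0 ≤ b x) (ha0 : ∃ x, 0 < a x)
    (hb0 : ∃ x, 0 < b x) {s : ℝ} (h0 : 0 ≤ s) (h1 : s ≤ 1) (c d : ℝ) :
    exp c * (s * (1 - c) + (psi a s - psi (a + b) s)) +
      exp d * (s * (1 - d) + (psi b s - psi (a + b) s)) ≤ s := by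
  have hab0 : ∃ x, 0 < (a + b) x := by
    obtain ⟨x, hx⟩ := ha0
    exact ⟨x, by simpa using add_pos_of_pos_of_nonneg hx (hb x)⟩
  have hab : ∀ x, 0 ≤ (a + b) x := fun x => add_nonneg (ha x) (hb x)
  have hS := Sm_pos hab hab0 s
  have key : ∀ (u : X → ℝ) (c : ℝ), (∀ x, 0 ≤ u x) → (∃ x, 0 < u x) → (∀ x, u x ≤ (a + b) x) →
      exp c * (s * (1 - c) + (psi u s - psi (a + b) s)) ≤
        s * ((∑ x, pw ((a + b) x) s * (u x / (a + b) x)) / Sm (a + b) s) := by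
    intro u c hu hu0 hua
    have hSu := Sm_pos hu hu0 s
    have k1 : exp (c * (1 - s)) * Sm u s ≤ (1 - s) * exp c * Sm (a + b) s +
        s * ∑ x, pw ((a + b) x) s * (u x / (a + b) x) := by
      unfold Sm
      rw [mul_sum, mul_sum, mul_sum, ← sum_add_distrib]
      exact sum_le_sum fun x _ => star_elem (hu x) (hua x) h0 h1 c
    have k2 : psi u s - psi (a + b) s - s * c + 1 ≤ Sm u s / Sm (a + b) s * exp (-(s * c)) := by
      have := add_one_le_exp (psi u s - psi (a + b) s - s * c)
      refine this.trans (le_of_eq ?_)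
      rw [sub_eq_add_neg, exp_add, exp_sub, exp_psi hu hu0, exp_psi hab hab0]
    have k3 : exp c * (Sm u s / Sm (a + b) s * exp (-(s * c))) =
        exp (c * (1 - s)) * Sm u s / Sm (a + b) s := by
      have : exp (c * (1 - s)) = exp c * exp (-(s * c)) := by rw [← exp_add]; ring_nf
      rw [this]; ring
    have k4 := mul_le_mul_of_nonneg_left k2 (exp_pos c).le
    rw [k3] at k4
    have k5 := div_le_div_of_nonneg_right k1 hS.le
    rw [add_div, mul_div_cancel_right₀ _ hS.ne', mul_div_assoc s] at k5
    nlinarith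
  have A := key a c ha ha0 (fun x => by simpa using hb x)
  have B := key b d hb hb0 (fun x => by simpa using ha x)
  have e : (∑ x, pw ((a + b) x) s * (a x / (a + b) x)) / Sm (a + b) s +
      (∑ x, pw ((a + b) x) s * (b x / (a + b) x)) / Sm (a + b) s = 1 := by
    rw [← add_div, ← sum_add_distrib, div_eq_one_iff_eq hS.ne']
    unfold Sm
    refine sum_congr rfl fun x _ => ?_
    rcases (hab x).eq_or_lt with h | h
    · rw [← h]; simp
    · rw [← mul_add, ← add_div]
      have : a x + b x = (a + b) x := rfl
      rw [this, div_self h.ne', mul_one]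
  nlinarith

end Renyi

/-! ### Types of admissible measures -/
section Types
variable {K : Type} [TopologicalSpace K] [CompactSpace K] [T2Space K] [MeasurableSpace K]
  [BorelSpace K] (ρ : Measure K) [IsFiniteMeasure ρ] {W s : K → ℝ}

lemma tau_exists (hW : Continuous W) (hs : Continuous s) (hW0 : ∀ k, 0 ≤ W k) (hs0 : ∀ k, 0 ≤ s k)
    {c : ℝ} (hc : 0 ≤ c) (u : ℝ≥0∞) (hA : 0 < c + ∫ k, W k ∂ρ) :
    ∃ τ : Measure ℝ≥0∞, IsProbabilityMeasure τ ∧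
      ∀ (X : Type) (_ : Fintype X) (V : X → ℝ), V ∈ stdSimplex ℝ X →
      (c + ∫ k, W k ∂ρ) * En τ V = c * (log 2 * renyi u V) + ∫ k, W k * Ht V (s k) ∂ρ := by
  set A := c + ∫ k, W k ∂ρ with hAdef
  set μ1 : Measure K := ρ.withDensity fun k => ENNReal.ofReal (W k) with hμ1
  have hWm : Measurable fun k => ENNReal.ofReal (W k) := hW.measurable.ennreal_ofReal
  have hsm : Measurable fun k => ENNReal.ofReal (s k) := hs.measurable.ennreal_ofReal
  have hWi : Integrable W ρ := cont_integrable ρ hW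
  have hmass : μ1 Set.univ = ENNReal.ofReal (∫ k, W k ∂ρ) := by
    rw [hμ1, withDensity_apply _ MeasurableSet.univ, Measure.restrict_univ,
      ofReal_integral_eq_lintegral_ofReal hWi (Filter.Eventually.of_forall hW0)]
  haveI : IsFiniteMeasure μ1 := ⟨by rw [hmass]; exact ENNReal.ofReal_lt_top⟩
  set μ2 : Measure ℝ≥0∞ := μ1.map fun k => ENNReal.ofReal (s k) with hμ2
  set μ : Measure ℝ≥0∞ := ENNReal.ofReal c • Measure.dirac u + μ2 with hμ
  refine ⟨ENNReal.ofReal A⁻¹ • μ, ⟨?_⟩, ?_⟩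
  · have h2 : μ2 Set.univ = ENNReal.ofReal (∫ k, W k ∂ρ) := by
      rw [hμ2, Measure.map_apply hsm MeasurableSet.univ, Set.preimage_univ, hmass]
    rw [Measure.smul_apply, hμ, Measure.add_apply, Measure.smul_apply, h2, measure_univ,
      smul_eq_mul, smul_eq_mul, mul_one, ← ENNReal.ofReal_add hc (integral_nonneg hW0), ← hAdef,
      ← ENNReal.ofReal_mul (inv_nonneg.2 hA.le), inv_mul_cancel₀ hA.ne', ENNReal.ofReal_one]
  · intro X _ V hV
    have hm := renyi_measurable hV
    have hHc := Ht_cont hV.1 (simplex_pos hV)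
    have hr : (fun k => renyi (ENNReal.ofReal (s k)) V) = fun k => Ht V (s k) / log 2 := by
      funext k
      rw [eq_div_iff log2_pos.ne', mul_comm, renyi_fin hV (hs0 k)]
    have hi1 : Integrable (fun k => renyi (ENNReal.ofReal (s k)) V) μ1 := by
      rw [hr]; exact cont_integrable μ1 (by fun_prop)
    have hi2 : Integrable (fun α => renyi α V) μ2 := by
      rw [hμ2, integrable_map_measure hm.aestronglyMeasurable hsm.aemeasurable]
      exact hi1
    have hi3 : Integrable (fun α => renyi α V) (ENNReal.ofReal c • Measure.dirac u) :=
      (integrable_dirac (by simp)).smul_measure ENNReal.ofReal_ne_top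
    have e2 : ∫ α, renyi α V ∂μ2 = ∫ k, W k * (Ht V (s k) / log 2) ∂ρ := by
      rw [hμ2, integral_map hsm.aemeasurable hm.aestronglyMeasurable, hr, hμ1,
        integral_withDensity_eq_integral_toReal_smul hWm
          (Filter.Eventually.of_forall fun k => ENNReal.ofReal_lt_top)]
      refine integral_congr_ae (Filter.Eventually.of_forall fun k => ?_)
      simp only [smul_eq_mul, ENNReal.toReal_ofReal (hW0 k)]
    unfold En
    rw [integral_smul_measure, hμ, integral_add_measure hi3 hi2, integral_smul_measure,
      integral_dirac, e2, ENNReal.toReal_ofReal hc, ENNReal.toReal_ofReal (inv_nonneg.2 hA.le)]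
    simp only [smul_eq_mul]
    have e3 : ∫ k, W k * (Ht V (s k) / log 2) ∂ρ = (∫ k, W k * Ht V (s k) ∂ρ) / log 2 := by
      rw [← integral_div]
      refine integral_congr_ae (Filter.Eventually.of_forall fun k => ?_)
      simp only; ring
    rw [e3]
    field_simp [log2_pos.ne']

lemma star_int {X : Type} [Fintype X] (hW : Continuous W) (hs : Continuous s) (hW0 : ∀ k, 0 ≤ W k)
    (hs0 : ∀ k, 0 ≤ s k) (hs1 : ∀ k, s k ≤ 1)
    {a b : X → ℝ} (ha : ∀ x, 0 ≤ a x) (hb : ∀ x, 0 ≤ b x) (ha0 : ∃ x, 0 < a x)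
    (hb0 : ∃ x, 0 < b x) (c d : ℝ) :
    exp c * ((∫ k, W k * s k ∂ρ) * (1 - c) +
        ((∫ k, W k * psi a (s k) ∂ρ) - ∫ k, W k * psi (a + b) (s k) ∂ρ)) +
      exp d * ((∫ k, W k * s k ∂ρ) * (1 - d) +
        ((∫ k, W k * psi b (s k) ∂ρ) - ∫ k, W k * psi (a + b) (s k) ∂ρ)) ≤ ∫ k, W k * s k ∂ρ := by
  have hab0 : ∃ x, 0 < (a + b) x := by
    obtain ⟨x, hx⟩ := ha0
    exact ⟨x, by simpa using add_pos_of_pos_of_nonneg hx (hb x)⟩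
  have hab : ∀ x, 0 ≤ (a + b) x := fun x => add_nonneg (ha x) (hb x)
  have c1 : Continuous fun k => W k * s k := hW.mul hs
  have c2 : Continuous fun k => W k * psi a (s k) := hW.mul ((psi_cont ha ha0).comp hs)
  have c3 : Continuous fun k => W k * psi b (s k) := hW.mul ((psi_cont hb hb0).comp hs)
  have c4 : Continuous fun k => W k * psi (a + b) (s k) := hW.mul ((psi_cont hab hab0).comp hs)
  have i1 := cont_integrable ρ c1
  have i2 := cont_integrable ρ c2
  have i3 := cont_integrable ρ c3
  have i4 := cont_integrable ρ c4
  have key := integral_mono (μ := ρ) (f := fun k =>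
    exp c * ((W k * s k) * (1 - c) + (W k * psi a (s k) - W k * psi (a + b) (s k))) +
    exp d * ((W k * s k) * (1 - d) + (W k * psi b (s k) - W k * psi (a + b) (s k))))
    (g := fun k => W k * s k) (cont_integrable ρ (by fun_prop)) i1 (fun k => by
      have := mul_le_mul_of_nonneg_left (star ha hb ha0 hb0 (hs0 k) (hs1 k) c d) (hW0 k)
      simp only
      linarith)
  refine le_trans (le_of_eq ?_) key
  rw [integral_add, integral_const_mul, integral_const_mul, integral_add, integral_add,
    integral_mul_const, integral_mul_const, integral_sub i2 i4, integral_sub i3 i4]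
  · exact cont_integrable ρ (by fun_prop)
  · exact cont_integrable ρ (by fun_prop)
  · exact cont_integrable ρ (by fun_prop)
  · exact cont_integrable ρ (by fun_prop)
  · exact cont_integrable ρ (by fun_prop)
  · exact cont_integrable ρ (by fun_prop)

lemma smul_nn {X : Type} [Fintype X] {V : X → ℝ} (hV : V ∈ stdSimplex ℝ X) {w : ℝ} (hw : 0 < w) :
    (∀ x, 0 ≤ (w • V) x) ∧ ∃ x, 0 < (w • V) x := by
  refine ⟨fun x => mul_nonneg hw.le (hV.1 x), ?_⟩
  obtain ⟨x, hx⟩ := simplex_pos hV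
  exact ⟨x, mul_pos hw hx⟩

lemma int_psi_hom {X : Type} [Fintype X] (hW : Continuous W) (hs : Continuous s) {V : X → ℝ}
    (hV : V ∈ stdSimplex ℝ X) {w : ℝ} (hw : 0 < w) :
    ∫ k, W k * psi (w • V) (s k) ∂ρ = (∫ k, W k * s k ∂ρ) * log w + ∫ k, W k * psi V (s k) ∂ρ := by
  have c2 : Continuous fun k => W k * psi V (s k) :=
    hW.mul ((psi_cont hV.1 (simplex_pos hV)).comp hs)
  rw [← integral_mul_const, ← integral_add (cont_integrable ρ (by fun_prop))
    (cont_integrable ρ c2)]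
  refine integral_congr_ae (Filter.Eventually.of_forall fun k => ?_)
  simp only [psi_hom hV.1 (simplex_pos hV) hw]
  ring

/-- Positive `t` type. -/
lemma mem_F3 (hs : Continuous s) (hs0 : ∀ k, 0 ≤ s k) (hs1 : ∀ k, s k ≤ 1) {lam t : ℝ}
    (hl : lam = ∫ k, s k ∂ρ) (hl0 : 0 < lam) (ht : 0 < t) {τ : Measure ℝ≥0∞}
    (hτ : IsProbabilityMeasure τ) (hE : ∀ (X : Type) (_ : Fintype X) (V : X → ℝ),
      V ∈ stdSimplex ℝ X → t * En τ V = lam⁻¹ * ∫ k, psi V (s k) ∂ρ) : (t, τ) ∈ Dbulk := by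
  refine mem_Dbulk_pos ht hτ fun d => ?_
  rw [concaveOn_iff_forall_pos]
  refine ⟨convex_stdSimplex ℝ _, fun p hp q hq w1 w2 h1 h2 h12 => ?_⟩
  have hr : w1 • p + w2 • q ∈ stdSimplex ℝ (Fin d) :=
    convex_stdSimplex ℝ _ hp hq h1.le h2.le h12
  simp only [smul_eq_mul]
  rw [hE _ _ _ hp, hE _ _ _ hq, hE _ _ _ hr]
  have hW : Continuous fun _ : K => (1 : ℝ) := continuous_const
  have k1 := int_psi_hom ρ hW hs hp h1
  have k2 := int_psi_hom ρ hW hs hq h2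
  have st := star_int ρ hW hs (fun _ => zero_le_one) hs0 hs1 (smul_nn hp h1).1 (smul_nn hq h2).1
    (smul_nn hp h1).2 (smul_nn hq h2).2
  rw [k1, k2] at st
  simp only [one_mul, ← hl] at st
  set Ip := ∫ k, psi p (s k) ∂ρ
  set Iq := ∫ k, psi q (s k) ∂ρ
  set Ir := ∫ k, psi (w1 • p + w2 • q) (s k) ∂ρ
  have st' := st (lam⁻¹ * (lam * log w1 + Ip - Ir)) (lam⁻¹ * (lam * log w2 + Iq - Ir))
  have e1 : lam * (1 - lam⁻¹ * (lam * log w1 + Ip - Ir)) + (lam * log w1 + Ip - Ir) = lam := by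
    field_simp; ring
  have e2 : lam * (1 - lam⁻¹ * (lam * log w2 + Iq - Ir)) + (lam * log w2 + Iq - Ir) = lam := by
    field_simp; ring
  rw [e1, e2, ← add_mul] at st'
  have st2 : exp (lam⁻¹ * (lam * log w1 + Ip - Ir)) + exp (lam⁻¹ * (lam * log w2 + Iq - Ir)) ≤ 1 := by
    by_contra hc
    push Not at hc
    nlinarith
  have f : ∀ w I : ℝ, 0 < w → w * exp (lam⁻¹ * I) =
      exp (lam⁻¹ * Ir) * exp (lam⁻¹ * (lam * log w + I - Ir)) := by
    intro w I hw
    rw [← exp_add]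
    conv_lhs => rw [← exp_log hw]
    rw [← exp_add]
    congr 1
    field_simp; ring
  rw [f _ _ h1, f _ _ h2, ← mul_add]
  exact mul_le_of_le_one_right (exp_pos _).le st2

/-- Core inequality for the negative `t` type. -/
lemma F4_core {X : Type} [Fintype X] (hW : Continuous W) (hs : Continuous s) (hW0 : ∀ k, 0 ≤ W k)
    (hs0 : ∀ k, 0 ≤ s k) (hs1 : ∀ k, s k ≤ 1) {lam Lam β : ℝ}
    (hL : Lam = lam + ∫ k, W k * s k ∂ρ) (hβ0 : 0 ≤ β) (hβ1 : β ≤ 1)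
    {p q : X → ℝ} (hp : p ∈ stdSimplex ℝ X) (hq : q ∈ stdSimplex ℝ X) {w1 w2 : ℝ} (h1 : 0 < w1)
    (h2 : 0 < w2) (G : (X → ℝ) → ℝ) (hG : ∀ V, G V = Lam * Mf V β + ∫ k, W k * psi V (s k) ∂ρ) :
    ∃ L1 L2 : ℝ, 1 ≤ exp L1 + exp L2 ∧
      exp L1 * (lam * (L1 - log w1) + (G p - G (w1 • p + w2 • q))) +
      exp L2 * (lam * (L2 - log w2) + (G q - G (w1 • p + w2 • q))) ≤ 0 := by
  have k1 := int_psi_hom ρ hW hs hp h1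
  have k2 := int_psi_hom ρ hW hs hq h2
  have st := star_int ρ hW hs hW0 hs0 hs1 (smul_nn hp h1).1 (smul_nn hq h2).1
    (smul_nn hp h1).2 (smul_nn hq h2).2
  rw [k1, k2] at st
  have m1 := Mf_hom hp.1 (simplex_pos hp) h1 hβ1
  have m2 := Mf_hom hq.1 (simplex_pos hq) h2 hβ1
  have mk := Mf_add (smul_nn hp h1).1 (smul_nn hq h2).1 (smul_nn hp h1).2 (smul_nn hq h2).2 hβ0 hβ1
  rw [m1, m2] at mk
  have σ0 : 0 ≤ ∫ k, W k * s k ∂ρ := integral_nonneg fun k => mul_nonneg (hW0 k) (hs0 k)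
  rw [hG p, hG q, hG (w1 • p + w2 • q)]
  set σ := ∫ k, W k * s k ∂ρ
  set Ip := ∫ k, W k * psi p (s k) ∂ρ
  set Iq := ∫ k, W k * psi q (s k) ∂ρ
  set Ir := ∫ k, W k * psi (w1 • p + w2 • q) (s k) ∂ρ
  set Mr := Mf (w1 • p + w2 • q) β
  set Mp := Mf p β
  set Mq := Mf q β
  have hsum : 1 ≤ exp (Mr - Mp + log w1) + exp (Mr - Mq + log w2) := by
    have := mul_le_mul_of_nonneg_left mk (exp_pos Mr).le
    rw [mul_add, ← exp_add, ← exp_add, ← exp_add, add_neg_cancel, exp_zero] at this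
    refine this.trans (le_of_eq ?_)
    congr 2 <;> ring
  refine ⟨Mr - Mp + log w1, Mr - Mq + log w2, hsum, ?_⟩
  have st' := st (Mr - Mp + log w1) (Mr - Mq + log w2)
  have hh := mul_le_mul_of_nonneg_left hsum σ0
  subst hL
  nlinarith

/-- Negative `t` type. -/
lemma mem_F4 (hW : Continuous W) (hs : Continuous s) (hW0 : ∀ k, 0 ≤ W k)
    (hs0 : ∀ k, 0 ≤ s k) (hs1 : ∀ k, s k ≤ 1) {lam Lam β A : ℝ}
    (hL : Lam = lam + ∫ k, W k * s k ∂ρ) (hβ0 : 0 ≤ β) (hβ1 : β ≤ 1) (hA : 0 < A)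
    {τ : Measure ℝ≥0∞} (hτ : IsProbabilityMeasure τ)
    (hE : ∀ (X : Type) (_ : Fintype X) (V : X → ℝ),
      V ∈ stdSimplex ℝ X → A * En τ V = Lam * Mf V β + ∫ k, W k * psi V (s k) ∂ρ) :
    (0 < lam → (-(A / lam), τ) ∈ Dbulk) ∧ (lam = 0 → τ ∈ DnegInf) := by
  constructor
  · intro hl
    refine mem_Dbulk_neg (by rw [neg_lt_zero]; positivity) hτ fun d => ?_
    rw [convexOn_iff_forall_pos]
    refine ⟨convex_stdSimplex ℝ _, fun p hp q hq w1 w2 h1 h2 h12 => ?_⟩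
    have hr : w1 • p + w2 • q ∈ stdSimplex ℝ (Fin d) :=
      convex_stdSimplex ℝ _ hp hq h1.le h2.le h12
    obtain ⟨L1, L2, hL1, hL2⟩ := F4_core ρ hW hs hW0 hs0 hs1 hL hβ0 hβ1 hp hq h1 h2 _
      (fun V => rfl)
    rw [← hE _ _ _ hp, ← hE _ _ _ hq, ← hE _ _ _ hr] at hL2
    simp only [smul_eq_mul]
    set Ep := En τ p
    set Eq := En τ q
    set Er := En τ (w1 • p + w2 • q)
    have e : ∀ E, -(A / lam) * E = -(A * E / lam) := fun E => by ring
    simp only [e]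
    have f : ∀ w E : ℝ, 0 < w → w * exp (-(A * E / lam)) =
        exp (-(A * Er / lam)) * exp (log w - (A * E - A * Er) / lam) := by
      intro w I hw
      rw [← exp_add]
      conv_lhs => rw [← exp_log hw]
      rw [← exp_add]
      congr 1
      field_simp; ring
    rw [f _ _ h1, f _ _ h2, ← mul_add]
    refine le_mul_of_one_le_right (exp_pos _).le ?_
    have g : ∀ c L : ℝ, exp L * (1 + (c - L)) ≤ exp c := by
      intro c L
      have := mul_le_mul_of_nonneg_left (add_one_le_exp (c - L)) (exp_pos L).le
      rw [← exp_add] at this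
      calc _ = exp L * (c - L + 1) := by ring
        _ ≤ _ := this
        _ = exp c := by ring_nf
    have g1 := g (log w1 - (A * Ep - A * Er) / lam) L1
    have g2 := g (log w2 - (A * Eq - A * Er) / lam) L2
    have hh : exp L1 * (log w1 - (A * Ep - A * Er) / lam - L1) +
        exp L2 * (log w2 - (A * Eq - A * Er) / lam - L2) =
        -((exp L1 * (lam * (L1 - log w1) + (A * Ep - A * Er)) +
      exp L2 * (lam * (L2 - log w2) + (A * Eq - A * Er))) / lam) := by
      field_simp; ring
    have hh2 := div_nonpos_of_nonpos_of_nonneg hL2 hl.le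
    linarith
  · intro hl
    refine mem_DnegInf hτ fun d m => ?_
    rw [convex_iff_forall_pos]
    rintro p ⟨hp, hpm⟩ q ⟨hq, hqm⟩ w1 w2 h1 h2 h12
    have hr : w1 • p + w2 • q ∈ stdSimplex ℝ (Fin d) :=
      convex_stdSimplex ℝ _ hp hq h1.le h2.le h12
    refine ⟨hr, ?_⟩
    obtain ⟨L1, L2, hL1, hL2⟩ := F4_core ρ hW hs hW0 hs0 hs1 hL hβ0 hβ1 hp hq h1 h2 _
      (fun V => rfl)
    rw [← hE _ _ _ hp, ← hE _ _ _ hq, ← hE _ _ _ hr, hl] at hL2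
    by_contra hc
    push Not at hc
    have a1 : 0 < A * En τ p - A * En τ (w1 • p + w2 • q) := by
      rw [← mul_sub]; exact mul_pos hA (by linarith)
    have a2 : 0 < A * En τ q - A * En τ (w1 • p + w2 • q) := by
      rw [← mul_sub]; exact mul_pos hA (by linarith)
    have b1 := mul_pos (exp_pos L1) a1
    have b2 := mul_pos (exp_pos L2) a2
    linarith

lemma Ht_concave {X : Type} [Fintype X] {s : ℝ} (h0 : 0 ≤ s) (h1 : s ≤ 1)
    {p q : X → ℝ} (hp : p ∈ stdSimplex ℝ X) (hq : q ∈ stdSimplex ℝ X) {w1 w2 : ℝ} (hw1 : 0 < w1)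
    (hw2 : 0 < w2) (h12 : w1 + w2 = 1) :
    w1 * Ht p s + w2 * Ht q s ≤ Ht (w1 • p + w2 • q) s := by
  have hr : w1 • p + w2 • q ∈ stdSimplex ℝ X :=
    convex_stdSimplex ℝ _ hp hq hw1.le hw2.le h12
  have hlt : ∀ s : ℝ, 0 ≤ s → s < 1 → w1 * Ht p s + w2 * Ht q s ≤ Ht (w1 • p + w2 • q) s := by
    intro s h0 h1
    have st := star (smul_nn hp hw1).1 (smul_nn hq hw2).1
      (smul_nn hp hw1).2 (smul_nn hq hw2).2 h0 h1.le (log w1) (log w2)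
    rw [psi_hom hp.1 (simplex_pos hp) hw1, psi_hom hq.1 (simplex_pos hq) hw2, exp_log hw1,
      exp_log hw2, ← Ht_mul hp.2, ← Ht_mul hq.2, ← Ht_mul hr.2] at st
    have h2 : 0 < 1 - s := by linarith
    have e : (1 - s) * (w1 * Ht p s + w2 * Ht q s) ≤ (1 - s) * Ht (w1 • p + w2 • q) s := by
      have hw : w2 = 1 - w1 := by linarith
      subst hw
      nlinarith
    exact le_of_mul_le_mul_left e h2
  rcases h1.eq_or_lt with rfl | h
  · have cp := Ht_cont hp.1 (simplex_pos hp)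
    have cq := Ht_cont hq.1 (simplex_pos hq)
    have cr := Ht_cont hr.1 (simplex_pos hr)
    have c1 : Continuous fun s => w1 * Ht p s + w2 * Ht q s := by fun_prop
    refine le_of_tendsto_of_tendsto (b := nhdsWithin (1 : ℝ) (Set.Iio 1))
      ((c1.tendsto 1).mono_left nhdsWithin_le_nhds) ((cr.tendsto 1).mono_left nhdsWithin_le_nhds) ?_
    have h01 : Set.Ioo (0 : ℝ) 1 ∈ nhdsWithin (1 : ℝ) (Set.Iio 1) :=
      Ioo_mem_nhdsLT zero_lt_one
    filter_upwards [h01] with s hs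
    exact hlt s hs.1.le hs.2
  · exact hlt s h0 h

/-- Type supported on `[0,1]`. -/
lemma mem_F2 (hW : Continuous W) (hs : Continuous s) (hW0 : ∀ k, 0 ≤ W k)
    (hs0 : ∀ k, 0 ≤ s k) (hs1 : ∀ k, s k ≤ 1) {A : ℝ} (hA : 0 < A)
    {τ : Measure ℝ≥0∞} (hτ : IsProbabilityMeasure τ)
    (hE : ∀ (X : Type) (_ : Fintype X) (V : X → ℝ),
      V ∈ stdSimplex ℝ X → A * En τ V = ∫ k, W k * Ht V (s k) ∂ρ) :
    (∀ t : ℝ, t < 0 → (t, τ) ∈ Dbulk) ∧ τ ∈ DnegInf := by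
  have hc : ∀ d : ℕ, ConcaveOn ℝ (stdSimplex ℝ (Fin d)) fun V => En τ V := by
    intro d
    rw [concaveOn_iff_forall_pos]
    refine ⟨convex_stdSimplex ℝ _, fun p hp q hq w1 w2 h1 h2 h12 => ?_⟩
    have hr : w1 • p + w2 • q ∈ stdSimplex ℝ (Fin d) :=
      convex_stdSimplex ℝ _ hp hq h1.le h2.le h12
    simp only [smul_eq_mul]
    refine le_of_mul_le_mul_left ?_ hA
    have cp : Continuous fun k => W k * Ht p (s k) :=
      hW.mul ((Ht_cont hp.1 (simplex_pos hp)).comp hs)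
    have cq : Continuous fun k => W k * Ht q (s k) :=
      hW.mul ((Ht_cont hq.1 (simplex_pos hq)).comp hs)
    have cr : Continuous fun k => W k * Ht (w1 • p + w2 • q) (s k) :=
      hW.mul ((Ht_cont hr.1 (simplex_pos hr)).comp hs)
    have e : A * (w1 * En τ p + w2 * En τ q) = w1 * (A * En τ p) + w2 * (A * En τ q) := by ring
    rw [e, hE _ _ _ hp, hE _ _ _ hq, hE _ _ _ hr, ← integral_const_mul, ← integral_const_mul,
      ← integral_add ((cont_integrable ρ cp).const_mul w1) ((cont_integrable ρ cq).const_mul w2)]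
    refine integral_mono (((cont_integrable ρ cp).const_mul w1).add
      ((cont_integrable ρ cq).const_mul w2)) (cont_integrable ρ cr) fun k => ?_
    have := mul_le_mul_of_nonneg_left (Ht_concave (hs0 k) (hs1 k) hp hq h1 h2 h12) (hW0 k)
    simp only
    linarith
  refine ⟨fun t ht => mem_Dbulk_neg ht hτ fun d => ?_, mem_DnegInf hτ fun d => (hc d).quasiconcaveOn⟩
  refine ⟨convex_stdSimplex ℝ _, fun p hp q hq w1 w2 h1 h2 h12 => ?_⟩
  have h3 := (hc d).2 hp hq h1 h2 h12
  have h4 := convexOn_exp.2 (Set.mem_univ (t * En τ p)) (Set.mem_univ (t * En τ q)) h1 h2 h12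
  simp only [smul_eq_mul] at h3 h4 ⊢
  refine le_trans (exp_le_exp.2 ?_) h4
  have := mul_le_mul_of_nonpos_left h3 ht.le
  linarith

end Types
end CM

set_option linter.unusedSectionVars false
namespace CM
open Real Finset

/-! ### Relative entropy and the Gibbs variational principle -/
section Gibbs
variable {Y : Type} [Fintype Y]

/-- Average. -/
def av (θ f : Y → ℝ) : ℝ := ∑ y, θ y * f y

lemma Dv_cont (pr : Y → ℝ) : Continuous (Dv pr) := by
  unfold Dv
  refine continuous_finsetSum _ fun y _ => ?_
  have : Continuous fun θ : Y → ℝ => θ y * log (θ y) :=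
    continuous_mul_log.comp (continuous_apply y)
  fun_prop

lemma Dv_convex (pr : Y → ℝ) : ConvexOn ℝ (stdSimplex ℝ Y) (Dv pr) := by
  refine ⟨convex_stdSimplex ℝ _, fun a ha b hb w1 w2 h1 h2 h12 => ?_⟩
  unfold Dv
  simp only [smul_eq_mul, mul_sum, ← sum_add_distrib]
  refine sum_le_sum fun y _ => ?_
  have := convexOn_mul_log.2 (ha.1 y) (hb.1 y) h1 h2 h12
  simp only [smul_eq_mul, Pi.add_apply, Pi.smul_apply] at this ⊢
  nlinarith

lemma Dv_self (pr : Y → ℝ) : Dv pr pr = 0 := by simp [Dv]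

lemma Dv_elem {t r : ℝ} (ht : 0 ≤ t) (hr : 0 < r) (h : t ≠ r) :
    t - r < t * log t - t * log r := by
  rcases ht.eq_or_lt with h0 | h0
  · rw [← h0]; simpa using hr
  · have := log_lt_sub_one_of_pos (div_pos hr h0) (fun e => h ((div_eq_one_iff_eq h0.ne').1 e).symm)
    rw [log_div hr.ne' h0.ne'] at this
    have h2 := mul_lt_mul_of_pos_left this h0
    have e : t * (r / t - 1) = r - t := by field_simp
    rw [e] at h2
    linarith

lemma Dv_pos {pr θ : Y → ℝ} (h0 : ∀ y, 0 < pr y) (h1 : ∑ y, pr y = 1) (hθ : θ ∈ stdSimplex ℝ Y)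
    (hne : θ ≠ pr) : 0 < Dv pr θ := by
  have e : ∑ y, (θ y - pr y) = 0 := by rw [sum_sub_distrib, hθ.2, h1, sub_self]
  rw [← e]
  unfold Dv
  obtain ⟨y, hy⟩ := Function.ne_iff.1 hne
  refine sum_lt_sum (fun y _ => ?_) ⟨y, mem_univ _, Dv_elem (hθ.1 y) (h0 y) hy⟩
  by_cases h : θ y = pr y
  · rw [h]; simp
  · exact (Dv_elem (hθ.1 y) (h0 y) h).le

lemma Dv_nonneg {pr θ : Y → ℝ} (h0 : ∀ y, 0 < pr y) (h1 : ∑ y, pr y = 1)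
    (hθ : θ ∈ stdSimplex ℝ Y) : 0 ≤ Dv pr θ := by
  by_cases h : θ = pr
  · rw [h, Dv_self]
  · exact (Dv_pos h0 h1 hθ h).le

lemma gibbs {pr : Y → ℝ} (h0 : ∀ y, 0 < pr y) (h1 : ∑ y, pr y = 1) (K : Y → ℝ) {lam : ℝ}
    (hl : 0 < lam) :
    (∀ θ ∈ stdSimplex ℝ Y, -(lam * log (∑ y, pr y * exp (-(K y / lam)))) ≤ lam * Dv pr θ + av θ K) ∧
    ∃ θ ∈ stdSimplex ℝ Y,
      lam * Dv pr θ + av θ K = -(lam * log (∑ y, pr y * exp (-(K y / lam)))) := by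
  have hne : Nonempty Y := by
    by_contra h
    rw [not_nonempty_iff] at h
    simp at h1
  set Zs := ∑ y, pr y * exp (-(K y / lam)) with hZ
  have hZ0 : 0 < Zs := sum_pos (fun y _ => mul_pos (h0 y) (exp_pos _)) univ_nonempty
  set ts : Y → ℝ := fun y => pr y * exp (-(K y / lam)) / Zs with hts
  have ts0 : ∀ y, 0 < ts y := fun y => div_pos (mul_pos (h0 y) (exp_pos _)) hZ0
  have ts1 : ∑ y, ts y = 1 := by rw [hts, ← sum_div, ← hZ, div_self hZ0.ne']
  have key : ∀ θ ∈ stdSimplex ℝ Y, lam * Dv pr θ + av θ K = lam * Dv ts θ - lam * log Zs := by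
    intro θ hθ
    have e : lam * log Zs = ∑ y, θ y * (lam * log Zs) := by rw [← sum_mul, hθ.2, one_mul]
    rw [e]
    unfold Dv av
    rw [mul_sum, mul_sum, ← sum_add_distrib, ← sum_sub_distrib]
    refine sum_congr rfl fun y _ => ?_
    have : log (ts y) = log (pr y) - K y / lam - log Zs := by
      rw [hts]
      simp only
      rw [log_div (mul_pos (h0 y) (exp_pos _)).ne' hZ0.ne', log_mul (h0 y).ne' (exp_pos _).ne',
        log_exp]
      ring
    rw [this]
    field_simp
    ring
  refine ⟨fun θ hθ => ?_, ts, ⟨fun y => (ts0 y).le, ts1⟩, ?_⟩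
  · rw [key θ hθ]
    have := mul_nonneg hl.le (Dv_nonneg ts0 ts1 hθ)
    linarith
  · rw [key ts ⟨fun y => (ts0 y).le, ts1⟩, Dv_self]; ring

lemma av_single [DecidableEq Y] (y : Y) (f : Y → ℝ) : av (Pi.single y 1) f = f y := by
  unfold av
  rw [sum_eq_single y]
  · simp
  · intro b _ hb; simp [hb]
  · simp

lemma av_lt {θ f : Y → ℝ} (hθ : θ ∈ stdSimplex ℝ Y) {c : ℝ} (h : ∀ y, c < f y) : c < av θ f := by
  have e : c = ∑ y, θ y * c := by rw [← sum_mul, hθ.2, one_mul]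
  rw [e]
  obtain ⟨y, hy⟩ := simplex_pos hθ
  exact sum_lt_sum (fun y _ => mul_le_mul_of_nonneg_left (h y).le (hθ.1 y))
    ⟨y, mem_univ _, mul_lt_mul_of_pos_left (h y) hy⟩

lemma av_neg (θ f : Y → ℝ) : av θ (fun y => - f y) = - av θ f := by simp [av]

lemma av_le {θ f g : Y → ℝ} (hθ : θ ∈ stdSimplex ℝ Y) (h : ∀ y, f y ≤ g y) : av θ f ≤ av θ g :=
  sum_le_sum fun y _ => mul_le_mul_of_nonneg_left (h y) (hθ.1 y)

lemma av_add (θ f g : Y → ℝ) : av θ (fun y => f y + g y) = av θ f + av θ g := by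
  simp [av, mul_add, sum_add_distrib]

lemma av_mul (θ f : Y → ℝ) (c : ℝ) : av θ (fun y => c * f y) = c * av θ f := by
  unfold av; rw [mul_sum]; exact sum_congr rfl fun y _ => by ring

lemma av_const {θ : Y → ℝ} (hθ : θ ∈ stdSimplex ℝ Y) (c : ℝ) : av θ (fun _ => c) = c := by
  unfold av; rw [← sum_mul, hθ.2, one_mul]

lemma av_cont {Z : Type*} [TopologicalSpace Z] {θ : Z → Y → ℝ} {f : Y → Z → ℝ}
    (hθ : Continuous θ) (hf : ∀ y, Continuous (f y)) :
    Continuous fun z => av (θ z) (fun y => f y z) := by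
  unfold av
  exact continuous_finsetSum _ fun y _ => ((continuous_apply y).comp hθ).mul (hf y)

lemma int_av {K : Type} [TopologicalSpace K] [CompactSpace K] [MeasurableSpace K]
    [BorelSpace K] (ν : Measure K) [IsFiniteMeasure ν] {W : K → ℝ} {f : Y → K → ℝ}
    (hW : Continuous W) (hf : ∀ y, Continuous (f y)) (θ : Y → ℝ) :
    ∫ k, W k * av θ (fun y => f y k) ∂ν = av θ (fun y => ∫ k, W k * f y k ∂ν) := by
  unfold av
  simp only [mul_sum]
  rw [integral_finsetSum]
  · refine sum_congr rfl fun y _ => ?_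
    rw [← integral_const_mul]
    refine integral_congr_ae (Filter.Eventually.of_forall fun k => ?_)
    simp only; ring
  · intro y _
    have := hf y
    exact cont_integrable ν (by fun_prop)

lemma av_linear (f : Y → ℝ) : (fun θ => av θ f) = fun θ => ∑ y, θ y * f y := rfl

lemma av_convexOn (S : Set (Y → ℝ)) (hS : Convex ℝ S) (f : Y → ℝ) (c : ℝ) :
    ConvexOn ℝ S fun θ => c * av θ f := by
  refine ⟨hS, fun a _ b _ w1 w2 _ _ _ => le_of_eq ?_⟩
  unfold av
  simp only [smul_eq_mul, mul_sum, Pi.add_apply, Pi.smul_apply, ← sum_add_distrib]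
  exact sum_congr rfl fun y _ => by ring

end Gibbs

/-! ### The setup -/

/-- Standing assumptions. -/
structure Setup {X Y X' Y' : Type} [Fintype X] [Fintype Y] [Fintype X'] [Fintype Y']
    (pr : Y → ℝ) (p : Y → X → ℝ) (qr : Y' → ℝ) (q : Y' → X' → ℝ) : Prop where
  pr0 : ∀ y, 0 < pr y
  pr1 : ∑ y, pr y = 1
  pm : ∀ y, p y ∈ stdSimplex ℝ X
  qr0 : ∀ y, 0 < qr y
  qr1 : ∑ y, qr y = 1
  qm : ∀ y, q y ∈ stdSimplex ℝ X'
  bulk : ∀ t τ, (t, τ) ∈ Dbulk → t⁻¹ * log (∑ y, pr y * exp (t * En τ (p y))) <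
    t⁻¹ * log (∑ y, qr y * exp (t * En τ (q y)))
  neg : ∀ τ ∈ DnegInf, ∃ y, ∀ y', En τ (p y) < En τ (q y')
  zero : ∀ s, 0 ≤ s → s ≤ 1 → av pr (fun y => Ht (p y) s) < av qr (fun y => Ht (q y) s)
  pos : ∃ y', ∀ y, psi (p y) 0 < psi (q y') 0

section Exponents
variable {X Y X' Y' : Type} [Fintype X] [Fintype Y] [Fintype X'] [Fintype Y']
    {pr : Y → ℝ} {p : Y → X → ℝ} {qr : Y' → ℝ} {q : Y' → X' → ℝ}

lemma Setup.prm (S : Setup pr p qr q) : pr ∈ stdSimplex ℝ Y := ⟨fun y => (S.pr0 y).le, S.pr1⟩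
lemma Setup.qrm (S : Setup pr p qr q) : qr ∈ stdSimplex ℝ Y' := ⟨fun y => (S.qr0 y).le, S.qr1⟩

/-- Finishing lemma for negative `t`. -/
lemma Setup.fin_neg (S : Setup pr p qr q) {A lam : ℝ} (hA : 0 < A) (hl : 0 ≤ lam)
    {τ : Measure ℝ≥0∞} (h1 : 0 < lam → (-(A / lam), τ) ∈ Dbulk) (h2 : lam = 0 → τ ∈ DnegInf)
    {θ' : Y' → ℝ} (hθ' : θ' ∈ stdSimplex ℝ Y')
    (h : ∀ θ ∈ stdSimplex ℝ Y, lam * Dv qr θ' + av θ' (fun y => A * En τ (q y)) ≤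
      lam * Dv pr θ + av θ (fun y => A * En τ (p y))) : False := by
  classical
  rcases hl.eq_or_lt with h0 | h0
  · obtain ⟨y, hy⟩ := S.neg τ (h2 h0.symm)
    have := h (Pi.single y 1) (single_mem_stdSimplex ℝ y)
    rw [← h0, zero_mul, zero_mul, zero_add, zero_add, av_single] at this
    have h3 := av_lt hθ' (f := fun y => A * En τ (q y)) (c := A * En τ (p y))
      (fun y' => mul_lt_mul_of_pos_left (hy y') hA)
    linarith
  · have hb := S.bulk _ _ (h1 h0)
    obtain ⟨θ, hθ, e⟩ := (gibbs S.pr0 S.pr1 (fun y => A * En τ (p y)) h0).2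
    have g := (gibbs S.qr0 S.qr1 (fun y => A * En τ (q y)) h0).1 θ' hθ'
    have h3 := h θ hθ
    rw [e] at h3
    have e1 : ∀ E, -(A / lam) * E = -(A * E / lam) := fun E => by ring
    simp only [e1] at hb
    have hi : (-(A / lam))⁻¹ = -(lam / A) := by rw [inv_neg, inv_div]
    rw [hi] at hb
    have h4 := mul_lt_mul_of_pos_left hb hA
    have e2 : ∀ L, A * (-(lam / A) * L) = -(lam * L) := fun L => by field_simp
    rw [e2, e2] at h4
    linarith

/-- The unit interval. -/
abbrev I01 := Set.Icc (0 : ℝ) 1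

instance : Nonempty I01 := ⟨⟨0, by simp⟩⟩

lemma F1 (S : Setup pr p qr q) : ∃ ε > 0, ∀ θ : Y → ℝ, ∀ θ' : Y' → ℝ, dist θ pr < ε →
    dist θ' qr < ε → ∀ s, 0 ≤ s → s ≤ 1 →
    av θ (fun y => Ht (p y) s) + ε ≤ av θ' (fun y => Ht (q y) s) := by
  have cp : ∀ y, Continuous (Ht (p y)) := fun y => Ht_cont (S.pm y).1 (simplex_pos (S.pm y))
  have cq : ∀ y, Continuous (Ht (q y)) := fun y => Ht_cont (S.qm y).1 (simplex_pos (S.qm y))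
  have hF : Continuous (fun w : (Unit × ((Y → ℝ) × (Y' → ℝ))) × I01 =>
      av w.1.2.1 (fun y => Ht (p y) w.2.1) - av w.1.2.2 (fun y => Ht (q y) w.2.1)) := by
    refine Continuous.sub (av_cont (by fun_prop) fun y => ?_) (av_cont (by fun_prop) fun y => ?_)
    · exact (cp y).comp (by fun_prop)
    · exact (cq y).comp (by fun_prop)
  obtain ⟨ε, hε, h⟩ := minimax (Z := Unit) (E := (Y → ℝ) × (Y' → ℝ)) (K := I01) {(pr, qr)}
    (convex_singleton _) (Set.singleton_nonempty _)
    (fun _ θ s => av θ.1 (fun y => Ht (p y) s.1) - av θ.2 (fun y => Ht (q y) s.1)) hF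
    (fun z k => ⟨convex_singleton _, by
      rintro a rfl b rfl w1 w2 h1 h2 h12
      rw [← add_smul, ← add_smul, h12, one_smul, one_smul]⟩)
    (by
      intro z ν hν
      refine ⟨_, rfl, ?_⟩
      have hc : Continuous fun s : I01 => av pr (fun y => Ht (p y) s.1) - av qr (fun y => Ht (q y) s.1) :=
        hF.comp (by fun_prop : Continuous fun s : I01 => ((z, (pr, qr)), s))
      obtain ⟨s0, -, hs0⟩ := isCompact_univ.exists_isMaxOn Set.univ_nonempty hc.continuousOn
      have := integral_mono (μ := ν) (cont_integrable ν hc) (integrable_const _)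
        (fun s => hs0 (Set.mem_univ s))
      refine this.trans_lt ?_
      have h := S.zero s0.1 s0.2.1 s0.2.2
      simpa using h)
  refine ⟨ε, hε, fun θ θ' h1 h2 s hs0 hs1 => ?_⟩
  obtain ⟨θ0, rfl, h0⟩ := h ()
  have := h0 (θ, θ') (by rw [Prod.dist_eq]; exact max_lt h1 h2) ⟨s, hs0, hs1⟩
  simp only at this
  linarith

lemma ae_zero_of_int {K : Type} [TopologicalSpace K] [CompactSpace K] [MeasurableSpace K]
    [BorelSpace K] (ν : Measure K) [IsFiniteMeasure ν] {W : K → ℝ} (hW : Continuous W)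
    (h0 : ∀ k, 0 ≤ W k) (h : ∫ k, W k ∂ν = 0) : ∀ᵐ k ∂ν, W k = 0 :=
  (integral_eq_zero_iff_of_nonneg h0 (cont_integrable ν hW)).1 h

/-- Points of the simplex away from `qr`. -/
abbrev Far (qr : Y' → ℝ) (δ : ℝ) := {θ' : Y' → ℝ // θ' ∈ stdSimplex ℝ Y' ∧ δ ≤ dist θ' qr}

lemma far_compact (qr : Y' → ℝ) (δ : ℝ) : CompactSpace (Far qr δ) := by
  have h : IsCompact {θ' : Y' → ℝ | θ' ∈ stdSimplex ℝ Y' ∧ δ ≤ dist θ' qr} :=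
    (isCompact_stdSimplex ℝ Y').inter_right
      (isClosed_le continuous_const (continuous_id.dist continuous_const))
  exact isCompact_iff_compactSpace.1 h

lemma F2 (S : Setup pr p qr q) {δ : ℝ} (hδ : 0 < δ) : ∃ ε > 0, ∀ θ' ∈ stdSimplex ℝ Y',
    δ ≤ dist θ' qr → ∃ θ ∈ stdSimplex ℝ Y, ∀ θ1, dist θ1 θ < ε →
    Dv pr θ1 + ε ≤ Dv qr θ' ∧ ∀ s, 0 ≤ s → s ≤ 1 →
    av θ1 (fun y => Ht (p y) s) + ε ≤ av θ' (fun y => Ht (q y) s) := by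
  have cp : ∀ y, Continuous (Ht (p y)) := fun y => Ht_cont (S.pm y).1 (simplex_pos (S.pm y))
  have cq : ∀ y, Continuous (Ht (q y)) := fun y => Ht_cont (S.qm y).1 (simplex_pos (S.qm y))
  have := far_compact qr δ
  have hD := Dv_cont pr
  have hD' := Dv_cont qr
  have hF : Continuous (fun w : (Far qr δ × (Y → ℝ)) × (I01 × I01) =>
      w.2.1.1 * (Dv pr w.1.2 - Dv qr w.1.1.1) + (1 - w.2.1.1) *
      (av w.1.2 (fun y => Ht (p y) w.2.2.1) - av w.1.1.1 (fun y => Ht (q y) w.2.2.1))) := by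
    refine Continuous.add ?_ (Continuous.mul (by fun_prop)
      (Continuous.sub (av_cont (by fun_prop) fun y => ?_) (av_cont (by fun_prop) fun y => ?_)))
    · have h1 := hD.comp (by fun_prop : Continuous fun w : (Far qr δ × (Y → ℝ)) × (I01 × I01) => w.1.2)
      have h2 := hD'.comp (by fun_prop : Continuous fun w : (Far qr δ × (Y → ℝ)) × (I01 × I01) => w.1.1.1)
      exact Continuous.mul (by fun_prop) (h1.sub h2)
    · exact (cp y).comp (by fun_prop)
    · exact (cq y).comp (by fun_prop)
  obtain ⟨ε, hε, h⟩ := minimax (Z := Far qr δ) (E := Y → ℝ) (K := I01 × I01) (stdSimplex ℝ Y)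
    (convex_stdSimplex ℝ Y) ⟨pr, S.prm⟩
    (fun θ' θ k => k.1.1 * (Dv pr θ - Dv qr θ'.1) + (1 - k.1.1) *
      (av θ (fun y => Ht (p y) k.2.1) - av θ'.1 (fun y => Ht (q y) k.2.1))) hF
    (by
      intro z k
      have h1 := ((Dv_convex pr).smul k.1.2.1).add (av_convexOn (stdSimplex ℝ Y)
        (convex_stdSimplex ℝ Y) (fun y => Ht (p y) k.2.1) (1 - k.1.1))
      have h2 := h1.add_const (- (k.1.1 * Dv qr z.1) - (1 - k.1.1) * av z.1 (fun y => Ht (q y) k.2.1))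
      refine h2.congr fun θ _ => ?_
      simp only [Pi.add_apply, smul_eq_mul]; ring)
    (by
      rintro ⟨θ', hθ', hfar⟩ ρ hρ
      by_contra hcon
      push Not at hcon
      have cx : Continuous fun k : I01 × I01 => (k.1.1 : ℝ) := by fun_prop
      have cW : Continuous fun k : I01 × I01 => 1 - (k.1.1 : ℝ) := by fun_prop
      have cs : Continuous fun k : I01 × I01 => (k.2.1 : ℝ) := by fun_prop
      have hW0 : ∀ k : I01 × I01, 0 ≤ 1 - (k.1.1 : ℝ) := fun k => sub_nonneg.2 k.1.2.2
      set lam := ∫ k : I01 × I01, (k.1.1 : ℝ) ∂ρ with hlam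
      have hl0 : 0 ≤ lam := integral_nonneg fun k => k.1.2.1
      have hA : ∫ k : I01 × I01, (1 - (k.1.1 : ℝ)) ∂ρ = 1 - lam := by
        rw [integral_sub (integrable_const _) (cont_integrable ρ cx)]; simp [hlam]
      have hcon2 : ∀ θ ∈ stdSimplex ℝ Y,
          lam * Dv qr θ' + av θ' (fun y => ∫ k : I01 × I01, (1 - (k.1.1 : ℝ)) * Ht (q y) k.2.1 ∂ρ) ≤
          lam * Dv pr θ + av θ (fun y => ∫ k : I01 × I01, (1 - (k.1.1 : ℝ)) * Ht (p y) k.2.1 ∂ρ) := by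
        intro θ hθ
        have h := hcon θ hθ
        have c1 : Continuous fun k : I01 × I01 => (1 - (k.1.1 : ℝ)) * av θ (fun y => Ht (p y) k.2.1) :=
          cW.mul (av_cont continuous_const fun y => (cp y).comp cs)
        have c2 : Continuous fun k : I01 × I01 => (1 - (k.1.1 : ℝ)) * av θ' (fun y => Ht (q y) k.2.1) :=
          cW.mul (av_cont continuous_const fun y => (cq y).comp cs)
        have ee : ∀ k : I01 × I01, (1 - (k.1.1 : ℝ)) * (av θ (fun y => Ht (p y) k.2.1) -
            av θ' (fun y => Ht (q y) k.2.1)) = (1 - (k.1.1 : ℝ)) * av θ (fun y => Ht (p y) k.2.1) -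
            (1 - (k.1.1 : ℝ)) * av θ' (fun y => Ht (q y) k.2.1) := fun k => mul_sub _ _ _
        simp only [ee] at h
        have i1 := int_av ρ cW (fun y => (cp y).comp cs) θ
        have i2 := int_av ρ cW (fun y => (cq y).comp cs) θ'
        simp only [Function.comp] at i1 i2
        rw [integral_add (cont_integrable ρ (by fun_prop)) (cont_integrable ρ (by exact c1.sub c2)),
          integral_mul_const, integral_sub (cont_integrable ρ c1) (cont_integrable ρ c2), i1, i2] at h
        linarith
      have hl1 : 0 ≤ 1 - lam := by rw [← hA]; exact integral_nonneg hW0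
      rcases hl1.eq_or_lt with h1 | h1
      · have hae := ae_zero_of_int ρ cW hW0 (by rw [hA]; exact h1.symm)
        have hz : ∀ f : I01 × I01 → ℝ, ∫ k : I01 × I01, (1 - (k.1.1 : ℝ)) * f k ∂ρ = 0 := by
          intro f
          refine integral_eq_zero_of_ae ?_
          filter_upwards [hae] with k hk
          rw [hk]; simp
        have h := hcon2 pr S.prm
        simp only [hz] at h
        have hlam1 : lam = 1 := by linarith
        rw [hlam1, Dv_self, one_mul, av_const hθ', av_const S.prm] at h
        have := Dv_pos S.qr0 S.qr1 hθ' (by rintro rfl; simp at hfar; linarith)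
        linarith
      · obtain ⟨τ, hτ, hE⟩ := tau_exists ρ cW cs hW0 (fun k => k.2.2.1) le_rfl 0 (by
          rw [hA, zero_add]; exact h1)
        rw [hA, zero_add] at hE
        simp only [zero_mul, zero_add] at hE
        have hm := mem_F2 ρ cW cs hW0 (fun k => k.2.2.1) (fun k => k.2.2.2) h1 hτ hE
        refine S.fin_neg h1 hl0 (fun h => hm.1 _ (by rw [neg_lt_zero]; positivity)) (fun _ => hm.2)
          hθ' (fun θ hθ => ?_)
        have := hcon2 θ hθ
        simpa only [hE _ _ _ (S.pm _), hE _ _ _ (S.qm _)] using this)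
  refine ⟨ε, hε, fun θ' hθ' hfar => ?_⟩
  obtain ⟨θ, hθ, h1⟩ := h ⟨θ', hθ', hfar⟩
  refine ⟨θ, hθ, fun θ1 hd => ⟨?_, fun s hs0 hs1 => ?_⟩⟩
  · have := h1 θ1 hd (⟨1, by simp⟩, ⟨0, by simp⟩)
    simp only [sub_self, zero_mul, one_mul] at this
    linarith
  · have := h1 θ1 hd (⟨0, by simp⟩, ⟨s, hs0, hs1⟩)
    simp only [sub_zero, zero_mul, one_mul] at this
    linarith

lemma F3 (S : Setup pr p qr q) {δ : ℝ} (hδ : 0 < δ) : ∃ ε > 0, ∀ θ ∈ stdSimplex ℝ Y,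
    δ ≤ dist θ pr → ∃ θ' ∈ stdSimplex ℝ Y', ∀ θ1, dist θ1 θ' < ε → ∀ s, 0 ≤ s → s ≤ 1 →
    av θ (fun y => psi (p y) s) + ε ≤
      av θ1 (fun y => psi (q y) s) + s * (Dv pr θ - Dv qr θ1) := by
  have cp : ∀ y, Continuous (psi (p y)) := fun y => psi_cont (S.pm y).1 (simplex_pos (S.pm y))
  have cq : ∀ y, Continuous (psi (q y)) := fun y => psi_cont (S.qm y).1 (simplex_pos (S.qm y))
  have := far_compact pr δ
  have hD := Dv_cont pr
  have hD' := Dv_cont qr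
  have hF : Continuous (fun w : (Far pr δ × (Y' → ℝ)) × I01 =>
      w.2.1 * (Dv qr w.1.2 - Dv pr w.1.1.1) +
      (av w.1.1.1 (fun y => psi (p y) w.2.1) - av w.1.2 (fun y => psi (q y) w.2.1))) := by
    refine Continuous.add ?_
      (Continuous.sub (av_cont (by fun_prop) fun y => ?_) (av_cont (by fun_prop) fun y => ?_))
    · have h1 := hD'.comp (by fun_prop : Continuous fun w : (Far pr δ × (Y' → ℝ)) × I01 => w.1.2)
      have h2 := hD.comp (by fun_prop : Continuous fun w : (Far pr δ × (Y' → ℝ)) × I01 => w.1.1.1)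
      exact Continuous.mul (by fun_prop) (h1.sub h2)
    · exact (cp y).comp (by fun_prop)
    · exact (cq y).comp (by fun_prop)
  obtain ⟨ε, hε, h⟩ := minimax (Z := Far pr δ) (E := Y' → ℝ) (K := I01) (stdSimplex ℝ Y')
    (convex_stdSimplex ℝ Y') ⟨qr, S.qrm⟩
    (fun θ θ' k => k.1 * (Dv qr θ' - Dv pr θ.1) +
      (av θ.1 (fun y => psi (p y) k.1) - av θ' (fun y => psi (q y) k.1))) hF
    (by
      intro z k
      have h1 := ((Dv_convex qr).smul k.2.1).add (av_convexOn (stdSimplex ℝ Y')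
        (convex_stdSimplex ℝ Y') (fun y => psi (q y) k.1) (-1))
      have h2 := h1.add_const (- (k.1 * Dv pr z.1) + av z.1 (fun y => psi (p y) k.1))
      refine h2.congr fun θ _ => ?_
      simp only [Pi.add_apply, smul_eq_mul]; ring)
    (by
      classical
      rintro ⟨θ, hθ, hfar⟩ ρ hρ
      by_contra hcon
      push Not at hcon
      have cW : Continuous fun _ : I01 => (1 : ℝ) := by fun_prop
      have cW2 : Continuous fun k : I01 => 1 - (k.1 : ℝ) := by fun_prop
      have cs : Continuous fun k : I01 => (k.1 : ℝ) := by fun_prop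
      have hW0 : ∀ k : I01, 0 ≤ 1 - (k.1 : ℝ) := fun k => sub_nonneg.2 k.2.2
      set lam := ∫ k : I01, (k.1 : ℝ) ∂ρ with hlam
      have hl0 : 0 ≤ lam := integral_nonneg fun k => k.2.1
      have hA : ∫ k : I01, (1 - (k.1 : ℝ)) ∂ρ = 1 - lam := by
        rw [integral_sub (integrable_const _) (cont_integrable ρ cs)]; simp [hlam]
      have hcon2 : ∀ θ' ∈ stdSimplex ℝ Y',
          lam * Dv pr θ - av θ (fun y => ∫ k : I01, psi (p y) k.1 ∂ρ) ≤
          lam * Dv qr θ' - av θ' (fun y => ∫ k : I01, psi (q y) k.1 ∂ρ) := by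
        intro θ' hθ'
        have h := hcon θ' hθ'
        have c1 : Continuous fun k : I01 => av θ (fun y => psi (p y) k.1) :=
          av_cont continuous_const fun y => (cp y).comp cs
        have c2 : Continuous fun k : I01 => av θ' (fun y => psi (q y) k.1) :=
          av_cont continuous_const fun y => (cq y).comp cs
        have i1 := int_av ρ cW (fun y => (cp y).comp cs) θ
        have i2 := int_av ρ cW (fun y => (cq y).comp cs) θ'
        simp only [one_mul, Function.comp] at i1 i2
        rw [integral_add (cont_integrable ρ (by fun_prop)) (cont_integrable ρ (by fun_prop)),
          integral_mul_const, integral_sub (cont_integrable ρ c1) (cont_integrable ρ c2), i1, i2] at h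
        linarith
      have hl1 : 0 ≤ 1 - lam := by rw [← hA]; exact integral_nonneg hW0
      rcases hl1.eq_or_lt with h1 | h1
      · have hae := ae_zero_of_int ρ cW2 hW0 (by rw [hA]; exact h1.symm)
        have hz : ∀ (X : Type) (_ : Fintype X) (V : X → ℝ), V ∈ stdSimplex ℝ X →
            ∫ k : I01, psi V k.1 ∂ρ = 0 := by
          intro X _ V hV
          refine integral_eq_zero_of_ae ?_
          filter_upwards [hae] with k hk
          have : (k.1 : ℝ) = 1 := by linarith
          rw [this, psi_one hV.2]; rfl
        have h := hcon2 qr S.qrm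
        simp only [hz _ _ _ (S.pm _), hz _ _ _ (S.qm _)] at h
        have hlam1 : lam = 1 := by linarith
        rw [hlam1, Dv_self, one_mul, av_const hθ, av_const S.qrm] at h
        have := Dv_pos S.pr0 S.pr1 hθ (by rintro rfl; simp at hfar; linarith)
        linarith
      rcases hl0.eq_or_lt with h0 | h0
      · have hae := ae_zero_of_int ρ cs (fun k => k.2.1) h0.symm
        have hz : ∀ (X : Type) (_ : Fintype X) (V : X → ℝ), V ∈ stdSimplex ℝ X →
            ∫ k : I01, psi V k.1 ∂ρ = psi V 0 := by
          intro X _ V hV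
          have : ∫ k : I01, psi V k.1 ∂ρ = ∫ k : I01, psi V 0 ∂ρ := by
            refine integral_congr_ae ?_
            filter_upwards [hae] with k hk
            rw [hk]
          rw [this]; simp
        obtain ⟨y', hy'⟩ := S.pos
        have h := hcon2 (Pi.single y' 1) (single_mem_stdSimplex ℝ y')
        simp only [hz _ _ _ (S.pm _), hz _ _ _ (S.qm _)] at h
        rw [← h0, av_single, zero_mul, zero_mul] at h
        have h3 := av_lt hθ (f := fun y => - psi (p y) 0) (c := - psi (q y') 0)
          (fun y => neg_lt_neg (hy' y))
        rw [av_neg] at h3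
        linarith
      · obtain ⟨τ, hτ, hE⟩ := tau_exists ρ cW2 cs hW0 (fun k => k.2.1) le_rfl 0 (by
          rw [hA, zero_add]; exact h1)
        rw [hA, zero_add] at hE
        simp only [zero_mul, zero_add] at hE
        have ht : 0 < (1 - lam) / lam := div_pos h1 h0
        have hE2 : ∀ (X : Type) (_ : Fintype X) (V : X → ℝ),
            V ∈ stdSimplex ℝ X → (1 - lam) / lam * En τ V = lam⁻¹ * ∫ k : I01, psi V k.1 ∂ρ := by
          intro X _ V hV
          have := hE X _ V hV
          simp only [Ht_mul hV.2] at this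
          rw [← this]; field_simp
        have hb := S.bulk _ _ (mem_F3 ρ cs (fun k => k.2.1) (fun k => k.2.2) hlam h0 ht hτ hE2)
        have g := (gibbs S.pr0 S.pr1 (fun y => - ∫ k : I01, psi (p y) k.1 ∂ρ) h0).1 θ hθ
        obtain ⟨θ', hθ', e⟩ := (gibbs S.qr0 S.qr1 (fun y => - ∫ k : I01, psi (q y) k.1 ∂ρ) h0).2
        have h := hcon2 θ' hθ'
        rw [av_neg] at g e
        have e1 : ∀ I : ℝ, -(-I / lam) = lam⁻¹ * I := fun I => by field_simp
        simp only [e1, ← hE2 _ _ _ (S.pm _)] at g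
        simp only [e1, ← hE2 _ _ _ (S.qm _)] at e
        have hb2 := lt_of_mul_lt_mul_left hb (inv_nonneg.2 ht.le)
        have := mul_lt_mul_of_pos_left hb2 h0
        linarith)
  refine ⟨ε, hε, fun θ hθ hfar => ?_⟩
  obtain ⟨θ', hθ', h1⟩ := h ⟨θ, hθ, hfar⟩
  refine ⟨θ', hθ', fun θ1 hd s hs0 hs1 => ?_⟩
  have := h1 θ1 hd ⟨s, hs0, hs1⟩
  simp only at this
  linarith

end Exponents
end CM

set_option linter.unusedSectionVars false
namespace CM
open Real Finset

section Jensen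
variable {K : Type} [TopologicalSpace K] [CompactSpace K] [MeasurableSpace K] [BorelSpace K]

lemma Mf_comp_cont {X : Type} [Fintype X] {V : X → ℝ} (hV : V ∈ stdSimplex ℝ X) {Z : Type*}
    [TopologicalSpace Z] {b : Z → ℝ} (hb : Continuous b) (hb1 : ∀ k, b k ≤ 1) :
    Continuous fun k => Mf V (b k) :=
  (Mf_cont hV.1 (simplex_pos hV)).comp_continuous hb hb1

lemma mf_jensen (ρ : Measure K) [IsFiniteMeasure ρ] {w b : K → ℝ} (hw : Continuous w)
    (hb : Continuous b) (hw0 : ∀ k, 0 ≤ w k) (hb0 : ∀ k, 0 ≤ b k) (hb1 : ∀ k, b k ≤ 1) :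
    ∃ B, 0 ≤ B ∧ B ≤ 1 ∧ ∫ k, w k * b k ∂ρ = (∫ k, w k ∂ρ) * B ∧
      ∀ (X : Type) (_ : Fintype X) (V : X → ℝ), V ∈ stdSimplex ℝ X →
        ∫ k, w k * Mf V (b k) ∂ρ ≤ (∫ k, w k ∂ρ) * Mf V B := by
  have iw := cont_integrable ρ hw
  have iwb : Integrable (fun k => w k * b k) ρ := cont_integrable ρ (hw.mul hb)
  rcases (integral_nonneg hw0 : 0 ≤ ∫ k, w k ∂ρ).eq_or_lt with h0 | h0
  · have hae := ae_zero_of_int ρ hw hw0 h0.symm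
    refine ⟨0, le_rfl, zero_le_one, ?_, fun X _ V hV => ?_⟩
    · rw [mul_zero]
      refine integral_eq_zero_of_ae ?_
      filter_upwards [hae] with k hk
      rw [hk]; simp
    · rw [← h0, zero_mul]
      refine le_of_eq (integral_eq_zero_of_ae ?_)
      filter_upwards [hae] with k hk
      rw [hk]; simp
  · set L := ∫ k, w k ∂ρ with hL
    have hB0 : 0 ≤ ∫ k, w k * b k ∂ρ := integral_nonneg fun k => mul_nonneg (hw0 k) (hb0 k)
    have hB1 : ∫ k, w k * b k ∂ρ ≤ L := integral_mono iwb iw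
      fun k => mul_le_of_le_one_right (hw0 k) (hb1 k)
    have e : ∫ k, w k * b k ∂ρ = L * ((∫ k, w k * b k ∂ρ) / L) := by field_simp
    refine ⟨(∫ k, w k * b k ∂ρ) / L, div_nonneg hB0 h0.le, (div_le_one h0).2 hB1, e,
      fun X _ V hV => ?_⟩
    have iM : Integrable (fun k => w k * Mf V (b k)) ρ := cont_integrable ρ (hw.mul (Mf_comp_cont hV hb hb1))
    rcases lt_or_eq_of_le ((div_le_one h0).2 hB1) with h1 | h1
    · set Bb := (∫ k, w k * b k ∂ρ) / L
      obtain ⟨c, hc⟩ := Mf_support hV.1 (simplex_pos hV) h1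
      have h2 : ∫ k, w k * Mf V (b k) ∂ρ ≤ ∫ k, ((Mf V Bb - c * Bb) * w k + c * (w k * b k)) ∂ρ := by
        refine integral_mono iM ((iw.const_mul _).add (iwb.const_mul _)) fun k => ?_
        have := mul_le_mul_of_nonneg_left (hc (b k) (hb1 k)) (hw0 k)
        simp only
        linarith
      rw [integral_add (iw.const_mul _) (iwb.const_mul _), integral_const_mul, integral_const_mul,
        e] at h2
      rw [← hL] at h2
      linarith
    · rw [h1]
      have h2 : ∫ k, w k * Mf V (b k) ∂ρ ≤ ∫ k, w k * Mf V 1 ∂ρ :=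
        integral_mono iM (iw.mul_const _) fun k =>
          mul_le_mul_of_nonneg_left (Mf_le_one hV.1 (simplex_pos hV) (hb1 k)) (hw0 k)
      rwa [integral_mul_const] at h2

lemma int6 (ρ : Measure K) [IsFiniteMeasure ρ] {f1 f2 f3 f4 f5 f6 : K → ℝ} (h1 : Continuous f1)
    (h2 : Continuous f2) (h3 : Continuous f3) (h4 : Continuous f4) (h5 : Continuous f5)
    (h6 : Continuous f6) :
    ∫ k, (f1 k + f2 k - f3 k - f4 k + f5 k - f6 k) ∂ρ = ∫ k, f1 k ∂ρ + ∫ k, f2 k ∂ρ - ∫ k, f3 k ∂ρ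
      - ∫ k, f4 k ∂ρ + ∫ k, f5 k ∂ρ - ∫ k, f6 k ∂ρ := by
  rw [integral_sub (cont_integrable ρ (by fun_prop)) (cont_integrable ρ h6),
    integral_add (cont_integrable ρ (by fun_prop)) (cont_integrable ρ h5),
    integral_sub (cont_integrable ρ (by fun_prop)) (cont_integrable ρ h4),
    integral_sub (cont_integrable ρ (by fun_prop)) (cont_integrable ρ h3),
    integral_add (cont_integrable ρ h1) (cont_integrable ρ h2)]
end Jensen

section Exp4
variable {X Y X' Y' : Type} [Fintype X] [Fintype Y] [Fintype X'] [Fintype Y']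
    {pr : Y → ℝ} {p : Y → X → ℝ} {qr : Y' → ℝ} {q : Y' → X' → ℝ}

/-- Parameter space for the head estimates. -/
abbrev Zh (q : Y' → X' → ℝ) (e0 : ℝ) := {z : (Y' → ℝ) × (ℝ × I01) // z.1 ∈ stdSimplex ℝ Y' ∧
  0 ≤ z.2.1 ∧ z.2.1 + e0 ≤ av z.1 (fun y => am (q y) 1) ∧
  ∀ β : I01, av z.1 (fun y => Mf (q y) β.1) - β.1 * z.2.1 ≤
    av z.1 (fun y => Mf (q y) z.2.2.1) - z.2.2.1 * z.2.1}

lemma Zh_compact (qm : ∀ y, q y ∈ stdSimplex ℝ X') {e0 : ℝ} (he : 0 < e0) :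
    CompactSpace (Zh q e0) := by
  have h : IsCompact {z : (Y' → ℝ) × (ℝ × I01) | z.1 ∈ stdSimplex ℝ Y' ∧
      0 ≤ z.2.1 ∧ z.2.1 + e0 ≤ av z.1 (fun y => am (q y) 1) ∧
      ∀ β : I01, av z.1 (fun y => Mf (q y) β.1) - β.1 * z.2.1 ≤
      av z.1 (fun y => Mf (q y) z.2.2.1) - z.2.2.1 * z.2.1} := by
    have hK : IsCompact ((stdSimplex ℝ Y') ×ˢ ((Set.Icc (0 : ℝ) (∑ y, |am (q y) 1|)) ×ˢ
        (Set.univ : Set I01))) :=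
      (isCompact_stdSimplex ℝ Y').prod (isCompact_Icc.prod isCompact_univ)
    refine hK.of_isClosed_subset ?_ ?_
    · simp only [Set.ofPred_and, Set.ofPred_forall]
      refine IsClosed.inter ?_ (IsClosed.inter ?_ (IsClosed.inter ?_ ?_))
      · exact (isClosed_stdSimplex ℝ Y').preimage continuous_fst
      · exact isClosed_le continuous_const (by fun_prop)
      · exact isClosed_le (by fun_prop) (av_cont (by fun_prop) fun y => continuous_const)
      · refine isClosed_iInter fun β => isClosed_le ?_ ?_
        · exact (av_cont (by fun_prop) fun y => continuous_const).sub (by fun_prop)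
        · refine (av_cont (by fun_prop) fun y => ?_).sub (by fun_prop)
          exact Mf_comp_cont (qm y) (b := fun z : (Y' → ℝ) × (ℝ × I01) => z.2.2.1) (by fun_prop)
            (fun z => z.2.2.2.2)
    · rintro ⟨θ, R, b⟩ ⟨h1, h2, h3, -⟩
      refine ⟨h1, ⟨h2, ?_⟩, trivial⟩
      have h4 : av θ (fun y => am (q y) 1) ≤ ∑ y, |am (q y) 1| := by
        refine sum_le_sum fun y _ => ?_
        have h5 : θ y ≤ 1 := by
          rw [← h1.2]; exact single_le_sum (f := θ) (fun i _ => h1.1 i) (mem_univ y)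
        calc θ y * am (q y) 1 ≤ θ y * |am (q y) 1| :=
              mul_le_mul_of_nonneg_left (le_abs_self _) (h1.1 y)
          _ ≤ 1 * |am (q y) 1| := mul_le_mul_of_nonneg_right h5 (abs_nonneg _)
          _ = _ := one_mul _
      simp only at h3 ⊢
      linarith
  exact isCompact_iff_compactSpace.1 h

lemma Zh_pos (qm : ∀ y, q y ∈ stdSimplex ℝ X') {e0 : ℝ} (he : 0 < e0) {θ : Y' → ℝ}
    (hθ : θ ∈ stdSimplex ℝ Y') {R : ℝ} (hR : R + e0 ≤ av θ (fun y => am (q y) 1)) :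
    ∃ β : I01, 0 < av θ (fun y => Mf (q y) β.1) - β.1 * R := by
  choose B hB0 hB using fun y => logB_exists (q y)
  set C := 1 + ∑ y, B y with hC
  have hC0 : ∀ y, B y ≤ C := fun y => by
    have := single_le_sum (f := B) (fun i _ => (hB0 i).le) (mem_univ y)
    linarith
  have hCp : 0 < C := by
    have : 0 ≤ ∑ y, B y := sum_nonneg fun i _ => (hB0 i).le
    linarith
  set β := min (1 / 2) (min (1 / (2 * C)) (e0 / (4 * C ^ 2))) with hβ
  have b0 : 0 < β := lt_min (by norm_num) (lt_min (by positivity) (by positivity))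
  have b1 : β ≤ 1 / 2 := min_le_left _ _
  have b2 : β ≤ 1 / (2 * C) := (min_le_right _ _).trans (min_le_left _ _)
  have b3 : β ≤ e0 / (4 * C ^ 2) := (min_le_right _ _).trans (min_le_right _ _)
  rw [le_div_iff₀ (by positivity)] at b2 b3
  refine ⟨⟨β, b0.le, by linarith⟩, ?_⟩
  have h1 : av θ (fun y => β * am (q y) 1 + -(2 * β ^ 2 * C ^ 2)) ≤ av θ (fun y => Mf (q y) β) :=
    av_le hθ fun y => by
      have := Mf_slope (qm y).1 (qm y).2 hCp (fun x => (hB y x).trans (hC0 y)) b0 b1 (by linarith)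
      refine le_trans (le_of_eq ?_) this
      ring
  rw [av_add, av_mul, av_const hθ] at h1
  simp only
  have h2 := mul_le_mul_of_nonneg_left hR b0.le
  have h3 := mul_le_mul_of_nonneg_left b3 b0.le
  have h4 := mul_pos b0 he
  nlinarith

set_option maxHeartbeats 1000000 in
lemma F4 (S : Setup pr p qr q) {e0 : ℝ} (he : 0 < e0) : ∃ ε > 0, ∀ θ' ∈ stdSimplex ℝ Y',
    ∀ R, 0 ≤ R → R + e0 ≤ av θ' (fun y => am (q y) 1) →
    ∃ β', 0 ≤ β' ∧ β' ≤ 1 ∧ ∃ θ ∈ stdSimplex ℝ Y, ∀ θ1, dist θ1 θ < ε → ∃ κ, 0 ≤ κ ∧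
      Dv pr θ1 + ε ≤ Dv qr θ' + κ ∧
      (∀ β, 0 ≤ β → β ≤ 1 → κ + av θ1 (fun y => Mf (p y) β) - β * R + ε ≤
        av θ' (fun y => Mf (q y) β') - β' * R) ∧
      ∀ s, 0 ≤ s → s ≤ 1 → av θ1 (fun y => psi (p y) s) + ε ≤
        av θ' (fun y => psi (q y) s) + s * κ := by
  have cp : ∀ y, Continuous (psi (p y)) := fun y => psi_cont (S.pm y).1 (simplex_pos (S.pm y))
  have cq : ∀ y, Continuous (psi (q y)) := fun y => psi_cont (S.qm y).1 (simplex_pos (S.qm y))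
  have hcomp := Zh_compact S.qm he
  have hD := Dv_cont pr
  have hD' := Dv_cont qr
  have hF : Continuous (fun w : (Zh q e0 × (Y → ℝ)) × (I01 × (I01 × I01)) =>
      w.2.1.1 * (Dv pr w.1.2 - Dv qr w.1.1.1.1) + (1 - w.2.1.1) *
      (av w.1.2 (fun y => psi (p y) w.2.2.1.1) - av w.1.1.1.1 (fun y => psi (q y) w.2.2.1.1)) -
      (w.2.1.1 + (1 - w.2.1.1) * w.2.2.1.1) *
      (av w.1.1.1.1 (fun y => Mf (q y) w.1.1.1.2.2.1) - w.1.1.1.2.2.1 * w.1.1.1.2.1 -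
       av w.1.2 (fun y => Mf (p y) w.2.2.2.1) + w.2.2.2.1 * w.1.1.1.2.1)) := by
    have h1 := hD.comp (by fun_prop :
      Continuous fun w : (Zh q e0 × (Y → ℝ)) × (I01 × (I01 × I01)) => w.1.2)
    have h2 := hD'.comp (by fun_prop :
      Continuous fun w : (Zh q e0 × (Y → ℝ)) × (I01 × (I01 × I01)) => w.1.1.1.1)
    refine Continuous.sub (Continuous.add (Continuous.mul (by fun_prop) (h1.sub h2))
      (Continuous.mul (by fun_prop)
      (Continuous.sub (av_cont (by fun_prop) fun y => ?_) (av_cont (by fun_prop) fun y => ?_))))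
      (Continuous.mul (by fun_prop) (Continuous.add (Continuous.sub (Continuous.sub
        (av_cont (by fun_prop) fun y => ?_) (by fun_prop)) (av_cont (by fun_prop) fun y => ?_))
        (by fun_prop)))
    · exact (cp y).comp (by fun_prop)
    · exact (cq y).comp (by fun_prop)
    · exact Mf_comp_cont (S.qm y) (b := fun w : (Zh q e0 × (Y → ℝ)) × (I01 × (I01 × I01)) =>
        (w.1.1.1.2.2.1 : ℝ)) (by fun_prop) (fun w => w.1.1.1.2.2.2.2)
    · exact Mf_comp_cont (S.pm y) (b := fun w : (Zh q e0 × (Y → ℝ)) × (I01 × (I01 × I01)) =>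
        (w.2.2.2.1 : ℝ)) (by fun_prop) (fun w => w.2.2.2.2.2)
  obtain ⟨ε, hε, h⟩ := minimax (Z := Zh q e0) (E := Y → ℝ) (K := I01 × (I01 × I01))
    (stdSimplex ℝ Y) (convex_stdSimplex ℝ Y) ⟨pr, S.prm⟩
    (fun z θ k => k.1.1 * (Dv pr θ - Dv qr z.1.1) + (1 - k.1.1) *
      (av θ (fun y => psi (p y) k.2.1.1) - av z.1.1 (fun y => psi (q y) k.2.1.1)) -
      (k.1.1 + (1 - k.1.1) * k.2.1.1) *
      (av z.1.1 (fun y => Mf (q y) z.1.2.2.1) - z.1.2.2.1 * z.1.2.1 -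
       av θ (fun y => Mf (p y) k.2.2.1) + k.2.2.1 * z.1.2.1)) hF
    (by
      intro z k
      have h1 := (((Dv_convex pr).smul k.1.2.1).add (av_convexOn (stdSimplex ℝ Y)
        (convex_stdSimplex ℝ Y) (fun y => psi (p y) k.2.1.1) (1 - k.1.1))).add
        (av_convexOn (stdSimplex ℝ Y) (convex_stdSimplex ℝ Y) (fun y => Mf (p y) k.2.2.1)
          (k.1.1 + (1 - k.1.1) * k.2.1.1))
      have h2 := h1.add_const (- (k.1.1 * Dv qr z.1.1) -
        (1 - k.1.1) * av z.1.1 (fun y => psi (q y) k.2.1.1) - (k.1.1 + (1 - k.1.1) * k.2.1.1) *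
      (av z.1.1 (fun y => Mf (q y) z.1.2.2.1) - z.1.2.2.1 * z.1.2.1 + k.2.2.1 * z.1.2.1))
      refine h2.congr fun θ _ => ?_
      simp only [Pi.add_apply, smul_eq_mul]; ring)
    (by
      rintro ⟨⟨θ', R, β'⟩, hθ', hR0, hR, hmax⟩ ρ hρ
      by_contra hcon
      push Not at hcon
      simp only at hθ' hR0 hR hmax hcon
      set m := av θ' (fun y => Mf (q y) β'.1) - β'.1 * R with hm
      have hmpos : 0 < m := by
        obtain ⟨β, hβ⟩ := Zh_pos S.qm he hθ' hR
        exact hβ.trans_le (hmax β)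
      have cx : Continuous fun k : I01 × (I01 × I01) => (k.1.1 : ℝ) := by fun_prop
      have cW : Continuous fun k : I01 × (I01 × I01) => 1 - (k.1.1 : ℝ) := by fun_prop
      have cs : Continuous fun k : I01 × (I01 × I01) => (k.2.1.1 : ℝ) := by fun_prop
      have cb : Continuous fun k : I01 × (I01 × I01) => (k.2.2.1 : ℝ) := by fun_prop
      have cw : Continuous fun k : I01 × (I01 × I01) => k.1.1 + (1 - (k.1.1 : ℝ)) * k.2.1.1 := by
        fun_prop
      have cW2 : Continuous fun k : I01 × (I01 × I01) => (1 - (k.1.1 : ℝ)) * (1 - k.2.1.1) := by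
        fun_prop
      have hW0 : ∀ k : I01 × (I01 × I01), 0 ≤ 1 - (k.1.1 : ℝ) := fun k => sub_nonneg.2 k.1.2.2
      have hW20 : ∀ k : I01 × (I01 × I01), 0 ≤ (1 - (k.1.1 : ℝ)) * (1 - k.2.1.1) :=
        fun k => mul_nonneg (hW0 k) (sub_nonneg.2 k.2.1.2.2)
      have hw0 : ∀ k : I01 × (I01 × I01), 0 ≤ k.1.1 + (1 - (k.1.1 : ℝ)) * k.2.1.1 :=
        fun k => add_nonneg k.1.2.1 (mul_nonneg (hW0 k) k.2.1.2.1)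
      obtain ⟨Bb, hB0, hB1, hBe, hBj⟩ := mf_jensen ρ cw cb hw0 (fun k => k.2.2.2.1)
        (fun k => k.2.2.2.2)
      set Lam := ∫ k : I01 × (I01 × I01), (k.1.1 + (1 - (k.1.1 : ℝ)) * k.2.1.1) ∂ρ with hLam
      set lam := ∫ k : I01 × (I01 × I01), (k.1.1 : ℝ) ∂ρ with hlam
      have hl0 : 0 ≤ lam := integral_nonneg fun k => k.1.2.1
      have hL0 : 0 ≤ Lam := integral_nonneg hw0
      have hLl : Lam = lam + ∫ k : I01 × (I01 × I01), (1 - (k.1.1 : ℝ)) * k.2.1.1 ∂ρ := by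
        rw [hLam, integral_add (cont_integrable ρ cx) (cont_integrable ρ (by fun_prop))]
      have hLA : Lam = 1 - ∫ k : I01 × (I01 × I01), (1 - (k.1.1 : ℝ)) * (1 - k.2.1.1) ∂ρ := by
        have e := integral_sub (integrable_const (1 : ℝ)) (cont_integrable ρ cW2)
        rw [integral_const, probReal_univ, one_smul] at e
        rw [← e, hLam]
        refine integral_congr_ae (Filter.Eventually.of_forall fun k => ?_)
        simp only; ring
      have hcon2 : ∀ θ ∈ stdSimplex ℝ Y,
          lam * Dv qr θ' + av θ' (fun y => ∫ k : I01 × (I01 × I01),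
            (1 - (k.1.1 : ℝ)) * psi (q y) k.2.1.1 ∂ρ) + Lam * m + R * (Lam * Bb) ≤
          lam * Dv pr θ + av θ (fun y => ∫ k : I01 × (I01 × I01),
            (1 - (k.1.1 : ℝ)) * psi (p y) k.2.1.1 ∂ρ) + av θ (fun y => Lam * Mf (p y) Bb) := by
        intro θ hθ
        have h := hcon θ hθ
        have c2 : Continuous fun k : I01 × (I01 × I01) =>
            (1 - (k.1.1 : ℝ)) * av θ (fun y => psi (p y) k.2.1.1) :=
          cW.mul (av_cont continuous_const fun y => (cp y).comp cs)
        have c3 : Continuous fun k : I01 × (I01 × I01) =>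
            (1 - (k.1.1 : ℝ)) * av θ' (fun y => psi (q y) k.2.1.1) :=
          cW.mul (av_cont continuous_const fun y => (cq y).comp cs)
        have cM : ∀ y, Continuous fun k : I01 × (I01 × I01) => Mf (p y) k.2.2.1 :=
          fun y => Mf_comp_cont (S.pm y) cb (fun k => k.2.2.2.2)
        have c5 : Continuous fun k : I01 × (I01 × I01) =>
            (k.1.1 + (1 - (k.1.1 : ℝ)) * k.2.1.1) * av θ (fun y => Mf (p y) k.2.2.1) :=
          cw.mul (av_cont continuous_const cM)
        have i1 := int_av ρ cW (fun y => (cp y).comp cs) θ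
        have i2 := int_av ρ cW (fun y => (cq y).comp cs) θ'
        have i3 := int_av ρ cw cM θ
        simp only [Function.comp] at i1 i2
        have c6 : Continuous fun k : I01 × (I01 × I01) =>
            (k.1.1 + (1 - (k.1.1 : ℝ)) * k.2.1.1) * k.2.2.1 * R := by fun_prop
        have e := int6 ρ (cx.mul_const (Dv pr θ - Dv qr θ')) c2 c3 (cw.mul_const m) c5 c6
        have h' := h.trans_eq (Eq.trans (integral_congr_ae
          (Filter.Eventually.of_forall (fun k => by simp only; ring))) e)
        rw [integral_mul_const, integral_mul_const, integral_mul_const, i1, i2, i3, hBe,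
          ← hlam, ← hLam] at h'
        have h5 := av_le hθ (fun y => hBj X _ (p y) (S.pm y))
        linarith
      have hA0 : 0 ≤ Lam * Bb + ∫ k : I01 × (I01 × I01), (1 - (k.1.1 : ℝ)) * (1 - k.2.1.1) ∂ρ :=
        add_nonneg (mul_nonneg hL0 hB0) (integral_nonneg hW20)
      rcases hA0.eq_or_lt with h1 | h1
      · have hi : ∫ k : I01 × (I01 × I01), (1 - (k.1.1 : ℝ)) * (1 - k.2.1.1) ∂ρ = 0 :=
          le_antisymm (by linarith [mul_nonneg hL0 hB0]) (integral_nonneg hW20)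
        rw [hi, sub_zero] at hLA
        have hBz : Bb = 0 := by rw [hi, hLA] at h1; linarith
        have hae := ae_zero_of_int ρ cW2 hW20 hi
        have hz : ∀ (X : Type) (_ : Fintype X) (V : X → ℝ), V ∈ stdSimplex ℝ X →
            ∫ k : I01 × (I01 × I01), (1 - (k.1.1 : ℝ)) * psi V k.2.1.1 ∂ρ = 0 := by
          intro X _ V hV
          refine integral_eq_zero_of_ae ?_
          filter_upwards [hae] with k hk
          rw [← Ht_mul hV.2, ← mul_assoc, hk]; simp
        have h := hcon2 pr S.prm
        simp only [hz _ _ _ (S.pm _), hz _ _ _ (S.qm _)] at h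
        rw [hLA, hBz, Dv_self, av_const hθ', av_const S.prm] at h
        simp only [Mf_zero (S.pm _).2, mul_zero, av_const S.prm] at h
        have := mul_nonneg hl0 (Dv_nonneg S.qr0 S.qr1 hθ')
        linarith
      · obtain ⟨τ, hτ, hE⟩ := tau_exists ρ cW2 cs hW20 (fun k => k.2.1.2.1) (mul_nonneg hL0 hB0)
          (ub Bb) h1
        set A := Lam * Bb + ∫ k : I01 × (I01 × I01), (1 - (k.1.1 : ℝ)) * (1 - k.2.1.1) ∂ρ with hA
        have hE2 : ∀ (X : Type) (_ : Fintype X) (V : X → ℝ), V ∈ stdSimplex ℝ X →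
            A * En τ V = Lam * Mf V Bb +
              ∫ k : I01 × (I01 × I01), (1 - (k.1.1 : ℝ)) * psi V k.2.1.1 ∂ρ := by
          intro X _ V hV
          rw [hE X _ V hV, mul_assoc, renyi_ub hV hB1]
          congr 1
          refine integral_congr_ae (Filter.Eventually.of_forall fun k => ?_)
          simp only
          rw [← Ht_mul hV.2, mul_assoc]
        have hmem := mem_F4 ρ cW cs hW0 (fun k => k.2.1.2.1) (fun k => k.2.1.2.2) hLl hB0 hB1 h1
          hτ hE2
        refine S.fin_neg h1 hl0 hmem.1 hmem.2 hθ' (fun θ hθ => ?_)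
        have h3 := hcon2 θ hθ
        have h4 := mul_le_mul_of_nonneg_left (hmax ⟨Bb, hB0, hB1⟩) hL0
        simp only [hE2 _ _ _ (S.pm _), hE2 _ _ _ (S.qm _)]
        rw [av_add, av_add, av_mul (f := fun y => Mf (q y) Bb)]
        simp only at h4
        linarith)
  refine ⟨ε / 2, by positivity, fun θ' hθ' R hR0 hR => ?_⟩
  have cMq : Continuous fun β : I01 => av θ' (fun y => Mf (q y) β.1) - β.1 * R :=
    (av_cont continuous_const fun y => Mf_comp_cont (S.qm y) (by fun_prop) (fun k => k.2.2)).sub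
      (by fun_prop)
  obtain ⟨β', -, hβ'⟩ := isCompact_univ.exists_isMaxOn Set.univ_nonempty cMq.continuousOn
  obtain ⟨θ, hθ, h1⟩ := h ⟨⟨θ', R, β'⟩, hθ', hR0, hR, fun β => hβ' (Set.mem_univ β)⟩
  refine ⟨β'.1, β'.2.1, β'.2.2, θ, hθ, fun θ1 hd => ?_⟩
  have h2 := h1 θ1 (by linarith)
  simp only at h2
  set m := av θ' (fun y => Mf (q y) β'.1) - β'.1 * R with hm
  have cN : Continuous fun β : I01 => m - av θ1 (fun y => Mf (p y) β.1) + β.1 * R :=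
    (continuous_const.sub
      (av_cont continuous_const fun y => Mf_comp_cont (S.pm y) (by fun_prop) (fun k => k.2.2))).add
      (by fun_prop)
  obtain ⟨b, -, hb⟩ := isCompact_univ.exists_isMinOn Set.univ_nonempty cN.continuousOn
  have hb' : ∀ β : I01, m - av θ1 (fun y => Mf (p y) b.1) + b.1 * R ≤
      m - av θ1 (fun y => Mf (p y) β.1) + β.1 * R := fun β => hb (Set.mem_univ β)
  refine ⟨m - av θ1 (fun y => Mf (p y) b.1) + b.1 * R - ε / 2, ?_, ?_, ?_, ?_⟩
  · have := h2 (⟨0, by simp⟩, ⟨1, by simp⟩, b)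
    simp only [psi_one (S.pm _).2, psi_one (S.qm _).2, av_const hθ'] at this
    have e : av θ1 (fun _ : Y => (0 : ℝ)) = 0 := by simp [av]
    rw [e] at this
    linarith
  · have := h2 (⟨1, by simp⟩, ⟨0, by simp⟩, b)
    simp only at this
    linarith
  · intro β h0 h1
    have := hb' ⟨β, h0, h1⟩
    simp only at this
    linarith
  · intro s h0 h1
    have := h2 (⟨0, by simp⟩, ⟨s, h0, h1⟩, b)
    simp only at this
    nlinarith

end Exp4
end CM

set_option linter.unusedSectionVars false
namespace CM
open Real Finset

section Col
variable {X Y : Type} [Fintype X] [Fintype Y] [DecidableEq Y] {n : ℕ}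

/-- Averaged log power sums. -/
abbrev Ps (p : Y → X → ℝ) (θ : Y → ℝ) (s : ℝ) : ℝ := av θ (fun y => psi (p y) s)
/-- Averaged tilted means. -/
abbrev Am (p : Y → X → ℝ) (θ : Y → ℝ) (s : ℝ) : ℝ := av θ (fun y => am (p y) s)
/-- Averaged head exponents. -/
abbrev MM (p : Y → X → ℝ) (θ : Y → ℝ) (s : ℝ) : ℝ := av θ (fun y => Mf (p y) s)
/-- The rate of the tilted window. -/
def RR (p : Y → X → ℝ) (θ : Y → ℝ) (s : ℝ) : ℝ := Ps p θ s + s * Am p θ s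

lemma RR_cont {p : Y → X → ℝ} (pm : ∀ y, p y ∈ stdSimplex ℝ X) (θ : Y → ℝ) :
    Continuous (RR p θ) := by
  unfold RR
  exact (av_cont continuous_const fun y => psi_cont (pm y).1 (simplex_pos (pm y))).add
    (continuous_id.mul (av_cont continuous_const fun y => am_cont (pm y).1 (simplex_pos (pm y))))

lemma Ps_one {p : Y → X → ℝ} (pm : ∀ y, p y ∈ stdSimplex ℝ X) (θ : Y → ℝ) : Ps p θ 1 = 0 := by
  simp [Ps, psi_one (pm _).2, av]

lemma RR_one {p : Y → X → ℝ} (pm : ∀ y, p y ∈ stdSimplex ℝ X) (θ : Y → ℝ) :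
    RR p θ 1 = Am p θ 1 := by
  unfold RR; rw [Ps_one pm]; ring

lemma RR_zero {p : Y → X → ℝ} (θ : Y → ℝ) : RR p θ 0 = Ps p θ 0 := by
  unfold RR; ring

lemma col_mem {p : Y → X → ℝ} (pm : ∀ y, p y ∈ stdSimplex ℝ X) (y : Fin n → Y) :
    col p y ∈ stdSimplex ℝ (Fin n → X) :=
  ⟨col_nonneg p (fun y => (pm y).1) y, sum_col p (fun y => (pm y).2) y⟩

lemma col_psi (hn : 0 < n) {p : Y → X → ℝ} (pm : ∀ y, p y ∈ stdSimplex ℝ X) (y : Fin n → Y)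
    (s : ℝ) : psi (col p y) s = n * Ps p (fr (ty y)) s := by
  have h : Sm (col p y) s = ∏ i, Sm (p (y i)) s := by
    unfold Sm col
    rw [Fintype.prod_sum]
    exact sum_congr rfl fun x _ => pw_prod _ _ (fun i => (pm _).1 _) _
  unfold psi
  rw [h, log_prod (fun i _ => (Sm_pos (pm _).1 (simplex_pos (pm _)) s).ne')]
  exact sum_letters hn (fun b => psi (p b) s) y

lemma col_window (hn : 0 < n) {p : Y → X → ℝ} (pm : ∀ y, p y ∈ stdSimplex ℝ X) {B η : ℝ}
    (hB1 : 1 ≤ B) (hB : ∀ y x, |log (p y x)| ≤ B) (h0 : 0 < η) (h1 : η ≤ 1)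
    (h4 : log 4 ≤ n * (η ^ 2 / (4 * B ^ 2))) (y : Fin n → Y) {s : ℝ} (hs : 0 ≤ s) :
    ∃ W : Finset (Fin n → X), (∀ x ∈ W, exp (n * (-Am p (fr (ty y)) s - η)) ≤ col p y x) ∧
      exp (n * (RR p (fr (ty y)) s - s * η) - log 2) ≤ W.card := by
  have hm := col_mem pm y
  have hθ := fr_mem hn (ty y)
  set θ := fr (ty y) with hθd
  have hn' : (0 : ℝ) < n := by exact_mod_cast hn
  set δ := η / (2 * B ^ 2) with hδ
  have hBp : 0 < B := by linarith
  have hδ0 : 0 < δ := by positivity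
  have hδB : δ * B ≤ 1 := by
    have e : δ * B = η / (2 * B) := by rw [hδ]; field_simp
    rw [e, div_le_one (by positivity)]; linarith
  have tay : ∀ d : ℝ, |d| = δ → Ps p θ (s + d) ≤ Ps p θ s - d * Am p θ s + δ ^ 2 * B ^ 2 := by
    intro d hd
    have := av_le hθ (fun y => psi_taylor (pm y).1 (simplex_pos (pm y)) (hB y) s d
      (by rw [hd]; exact hδB))
    have e : av θ (fun y => psi (p y) s - d * am (p y) s + d ^ 2 * B ^ 2) =
        Ps p θ s - d * Am p θ s + d ^ 2 * B ^ 2 := by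
      have e2 : ∀ y, psi (p y) s - d * am (p y) s + d ^ 2 * B ^ 2 =
        (psi (p y) s + (-d) * am (p y) s) + d ^ 2 * B ^ 2 := fun y => by ring
      simp only [e2]
      rw [av_add, av_add, av_mul, av_const hθ]; ring
    rw [e] at this
    rw [← hd, sq_abs]; exact this
  have key : δ ^ 2 * B ^ 2 - δ * η = -(η ^ 2 / (4 * B ^ 2)) := by
    rw [hδ]; field_simp; ring
  obtain ⟨W, hW1, hW2⟩ := window hm.1 (simplex_pos hm) (s := s) (δ := δ) (c := n * Am p θ s)
    (e := n * (δ ^ 2 * B ^ 2)) (h := n * η) hδ0 hs (by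
      rw [col_psi hn pm, col_psi hn pm, ← hθd]
      have := mul_le_mul_of_nonneg_left (tay δ (abs_of_pos hδ0)) hn'.le
      linarith) (by
      rw [col_psi hn pm, col_psi hn pm, ← hθd]
      have := mul_le_mul_of_nonneg_left (tay (-δ) (by rw [abs_neg, abs_of_pos hδ0])) hn'.le
      rw [← sub_eq_add_neg] at this
      linarith) (by
      have e : n * (δ ^ 2 * B ^ 2) - δ * (n * η) = n * (δ ^ 2 * B ^ 2 - δ * η) := by ring
      rw [e, key]; linarith)
  refine ⟨W, fun x hx => ?_, ?_⟩
  · refine le_trans (le_of_eq ?_) (hW1 x hx)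
    congr 1; ring
  · refine le_trans (le_of_eq ?_) hW2
    rw [col_psi hn pm, ← hθd]
    congr 1; unfold RR; ring

/-- Upper tail bound. -/
lemma col_tail_le (hn : 0 < n) {p : Y → X → ℝ} (pm : ∀ y, p y ∈ stdSimplex ℝ X) (y : Fin n → Y)
    {k : ℕ} {R : ℝ} (hk : exp (n * R) ≤ k) {s : ℝ} (hs0 : 0 < s) (hs1 : s ≤ 1) :
    tailk (col p y) k ≤ exp (n * ((Ps p (fr (ty y)) s - (1 - s) * R) / s)) := by
  have hm := col_mem pm y
  have hk0 : (0 : ℝ) < k := (exp_pos _).trans_le hk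
  have hk1 : 1 ≤ k := by
    have : 0 < k := by exact_mod_cast hk0
    omega
  refine (tailk_le hm.1 (simplex_pos hm) hk1 hs0 hs1).trans (exp_le_exp.2 ?_)
  rw [col_psi hn pm]
  have hl : n * R ≤ log k := (le_log_iff_exp_le hk0).2 hk
  have := mul_le_mul_of_nonneg_left hl (sub_nonneg.2 hs1)
  rw [← mul_div_assoc]
  apply div_le_div_of_nonneg_right _ hs0.le
  linarith

lemma col_tail_zero (hn : 0 < n) {p : Y → X → ℝ} (pm : ∀ y, p y ∈ stdSimplex ℝ X) (y : Fin n → Y)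
    {k : ℕ} {R : ℝ} (hk : exp (n * R) ≤ k) (h : Ps p (fr (ty y)) 0 ≤ R) :
    tailk (col p y) k = 0 := by
  have hm := col_mem pm y
  refine tailk_eq_zero hm.1 (le_trans ?_ hk)
  rw [← exp_psi hm.1 (simplex_pos hm), col_psi hn pm]
  exact exp_le_exp.2 (mul_le_mul_of_nonneg_left h (Nat.cast_nonneg n))

/-- Lower tail bound. -/
lemma col_le_tail (hn : 0 < n) {p : Y → X → ℝ} (pm : ∀ y, p y ∈ stdSimplex ℝ X) {B η : ℝ}
    (hB1 : 1 ≤ B) (hB : ∀ y x, |log (p y x)| ≤ B) (h0 : 0 < η) (h1 : η ≤ 1)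
    (h4 : log 4 ≤ n * (η ^ 2 / (4 * B ^ 2))) (h5 : log 4 ≤ n * η) (y : Fin n → Y) {s : ℝ}
    (hs : 0 ≤ s) (hs1 : s ≤ 1) {k : ℕ} {R : ℝ} (hk : (k : ℝ) ≤ 2 * exp (n * R))
    (hR : R + 3 * η ≤ RR p (fr (ty y)) s) :
    exp (n * (Ps p (fr (ty y)) s - (1 - s) * Am p (fr (ty y)) s - 3 * η)) ≤ tailk (col p y) k := by
  have hm := col_mem pm y
  have hn' : (0 : ℝ) < n := by exact_mod_cast hn
  obtain ⟨W, hW1, hW2⟩ := col_window hn pm hB1 hB h0 h1 h4 y hs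
  set θ := fr (ty y) with hθd
  refine le_trans ?_ (le_tailk hm.1 W (exp_pos _).le hW1 k)
  have l2 : (0 : ℝ) < log 2 := log_pos (by norm_num)
  have l4 : log 4 = 2 * log 2 := by
    rw [show (4 : ℝ) = 2 ^ 2 by norm_num, log_pow]; norm_num
  set C := exp (n * (RR p θ s - s * η) - log 2) with hC
  have hsη : s * η ≤ η := mul_le_of_le_one_left h0.le hs1
  have hk2 : (k : ℝ) ≤ C / 2 := by
    have : exp (n * R) ≤ C / 4 := by
      rw [hC, show (4 : ℝ) = exp (log 4) by rw [exp_log]; norm_num, ← exp_sub]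
      apply exp_le_exp.2
      have := mul_le_mul_of_nonneg_left (show R + 3 * η - s * η ≤ RR p θ s - s * η by linarith) hn'.le
      have h6 := mul_le_mul_of_nonneg_left hsη hn'.le
      nlinarith
    linarith
  have h7 : C / 2 ≤ W.card - k := by linarith
  refine le_trans ?_ (mul_le_mul_of_nonneg_right h7 (exp_pos _).le)
  rw [hC, show C / 2 = exp (n * (RR p θ s - s * η) - log 2 - log 2) by
    rw [exp_sub _ (log 2), exp_log (by norm_num)], ← exp_add]
  apply exp_le_exp.2
  have h6 := mul_le_mul_of_nonneg_left hsη hn'.le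
  unfold RR
  nlinarith

/-- Lower head bound. -/
lemma col_le_head (hn : 0 < n) {p : Y → X → ℝ} (pm : ∀ y, p y ∈ stdSimplex ℝ X) {B η : ℝ}
    (hB1 : 1 ≤ B) (hB : ∀ y x, |log (p y x)| ≤ B) (h0 : 0 < η) (h1 : η ≤ 1)
    (h4 : log 4 ≤ n * (η ^ 2 / (4 * B ^ 2))) (h5 : log 4 ≤ n * η) (y : Fin n → Y)
    {k : ℕ} {R U ζ : ℝ} (hU : 1 ≤ U) (hd : log (Fintype.card X) / U + (U + 2) * η ≤ ζ)
    (hk : exp (n * R) ≤ k) :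
    ∃ β, 0 ≤ β ∧ β ≤ 1 ∧ exp (-(n * (MM p (fr (ty y)) β - β * R + ζ))) ≤ headk (col p y) k := by
  have hθ := fr_mem hn (ty y)
  have hn' : (0 : ℝ) < n := by exact_mod_cast hn
  have l2 : (0 : ℝ) < log 2 := log_pos (by norm_num)
  have l4 : log 4 = 2 * log 2 := by
    rw [show (4 : ℝ) = 2 ^ 2 by norm_num, log_pow]; norm_num
  have hU0 : 0 < U := by linarith
  have hd0 : 0 ≤ log (Fintype.card X) / U := div_nonneg (log_natCast_nonneg _) hU0.le
  -- the generic estimate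
  have gen : ∀ u, 1 ≤ u → u ≤ U → ∀ R', R' ≤ R → R' ≤ RR p (fr (ty y)) u →
      exp (n * (R' - Am p (fr (ty y)) u - (U + 2) * η)) ≤ headk (col p y) k := by
    intro u hu1 hu2 R' hR1 hR2
    obtain ⟨W, hW1, hW2⟩ := col_window hn pm hB1 hB h0 h1 h4 y (by linarith : 0 ≤ u)
    set θ := fr (ty y) with hθd
    have huη : 0 ≤ u * η := by positivity
    have hle := le_headk' W (exp_pos _).le hW1 k (r := exp (n * (R' - u * η) - log 2))
      (le_trans (exp_le_exp.2 (by
        have := mul_le_mul_of_nonneg_left (sub_le_sub_right hR2 (u * η)) hn'.le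
        linarith)) hW2)
      (le_trans (exp_le_exp.2 (by
        have := mul_le_mul_of_nonneg_left (show R' - u * η ≤ R by linarith) hn'.le
        linarith)) hk)
    refine le_trans ?_ hle
    rw [← exp_add]
    apply exp_le_exp.2
    have h6 := mul_le_mul_of_nonneg_left (mul_le_mul_of_nonneg_right hu2 h0.le) hn'.le
    nlinarith
  set θ := fr (ty y) with hθd
  by_cases c1 : RR p θ 1 ≤ R
  · refine ⟨0, le_rfl, zero_le_one, le_trans (exp_le_exp.2 ?_) (gen 1 le_rfl hU _ c1 le_rfl)⟩
    have e : MM p θ 0 = 0 := by simp [MM, Mf_zero (pm _).2, av]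
    rw [e, RR_one pm]
    have := mul_le_mul_of_nonneg_left (show (U + 2) * η ≤ ζ by linarith) hn'.le
    linarith
  push Not at c1
  by_cases c2 : R < RR p θ U
  · refine ⟨1, zero_le_one, le_rfl, le_trans (exp_le_exp.2 ?_) (gen U hU le_rfl R le_rfl c2.le)⟩
    have h6 : Am p θ U ≤ av θ (fun y => log (Fintype.card X) / U + Mf (p y) 1) := by
      refine av_le hθ fun y => ?_
      have a1 := psi_support (pm y).1 (simplex_pos (pm y)) U 0
      have a2 := psi_ge_vmax (pm y).1 (simplex_pos (pm y)) U
      have a3 := psi_le_vmax (pm y).1 (simplex_pos (pm y)) (le_refl 0)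
      rw [Mf_one]
      have : am (p y) U * U ≤ log (Fintype.card X) - U * log (vmax (p y)) := by linarith
      rw [← le_div_iff₀ hU0] at this
      refine this.trans (le_of_eq ?_)
      field_simp
      ring
    rw [av_add, av_const hθ] at h6
    have := mul_le_mul_of_nonneg_left h6 hn'.le
    have := mul_le_mul_of_nonneg_left hd hn'.le
    simp only [MM]
    linarith
  push Not at c2
  obtain ⟨u, hu, huR⟩ : R ∈ RR p θ '' Set.Icc 1 U :=
    intermediate_value_Icc' hU (RR_cont pm θ).continuousOn ⟨c2, c1.le⟩
  have hu0 : 0 < u := by linarith [hu.1]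
  refine ⟨1 - 1 / u, ?_, ?_, le_trans (exp_le_exp.2 ?_) (gen u hu.1 hu.2 R le_rfl huR.ge)⟩
  · rw [sub_nonneg, div_le_one hu0]; exact hu.1
  · have : 0 ≤ 1 / u := by positivity
    linarith
  have hM : MM p θ (1 - 1 / u) = -(1 / u) * Ps p θ u := by
    unfold MM Ps
    rw [← av_mul]
    congr 1
    funext y
    have : 1 - 1 / u < 1 := by
      have : 0 < 1 / u := by positivity
      linarith
    rw [Mf_lt this]
    rw [show 1 - (1 - 1 / u) = 1 / u by ring, one_div_one_div]; ring
  rw [hM, ← huR]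
  have e : -(1 / u) * Ps p θ u - (1 - 1 / u) * RR p θ u = -(RR p θ u - Am p θ u) := by
    unfold RR; field_simp; ring
  rw [e]
  have := mul_le_mul_of_nonneg_left (show (U + 2) * η ≤ ζ by linarith) hn'.le
  linarith

/-- Upper head bound. -/
lemma col_head_le (hn : 0 < n) {p : Y → X → ℝ} (pm : ∀ y, p y ∈ stdSimplex ℝ X) (y : Fin n → Y)
    {k : ℕ} {R β : ℝ} (hk1 : 1 ≤ k) (hk : (k : ℝ) ≤ 2 * exp (n * R)) (hb0 : 0 ≤ β) (hb1 : β ≤ 1) :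
    headk (col p y) k ≤ 2 * exp (-(n * (MM p (fr (ty y)) β - β * R))) := by
  have hm := col_mem pm y
  have hk0 : (0 : ℝ) < k := by exact_mod_cast hk1
  have l2 : (0 : ℝ) < log 2 := log_pos (by norm_num)
  have hlk : log k ≤ log 2 + n * R := by
    have := log_le_log hk0 hk
    rwa [log_mul (by norm_num) (exp_pos _).ne', log_exp] at this
  set θ := fr (ty y) with hθd
  rcases lt_or_eq_of_le hb1 with h1 | h1
  · refine (headk_le_rpow hm.1 (simplex_pos hm) hk1 hb0 h1).trans ?_
    rw [show (2 : ℝ) * exp (-(n * (MM p θ β - β * R))) =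
      exp (log 2 + -(n * (MM p θ β - β * R))) by rw [exp_add, exp_log (by norm_num)]]
    apply exp_le_exp.2
    have hM : MM p θ β = -(1 - β) * Ps p θ (1 / (1 - β)) := by
      unfold MM Ps
      rw [← av_mul]
      congr 1
      funext y
      rw [Mf_lt h1]; ring
    rw [hM, col_psi hn pm, ← hθd]
    have := mul_le_mul_of_nonneg_left hlk hb0
    have := mul_le_mul_of_nonneg_right hb1 l2.le
    nlinarith
  · subst h1
    have hM : exp (-(n * MM p θ 1)) = ∏ i, vmax (p (y i)) := by
      have := sum_letters hn (fun b => Mf (p b) 1) y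
      have e : n * MM p θ 1 = ∑ i, Mf (p (y i)) 1 := this.symm
      rw [e, ← sum_neg_distrib, exp_sum]
      refine prod_congr rfl fun i _ => ?_
      rw [Mf_one, neg_neg, exp_log (vmax_pos (simplex_pos (pm _)))]
    have := headk_le_max (V := col p y) (C := exp (-(n * MM p θ 1))) (exp_pos _).le (fun x => by
      rw [hM]
      exact prod_le_prod (fun i _ => (pm _).1 _) (fun i _ => le_vmax _ _)) k
    refine this.trans ((mul_le_mul_of_nonneg_right hk (exp_pos _).le).trans (le_of_eq ?_))
    rw [mul_assoc, ← exp_add]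
    congr 2; ring

end Col
end CM

set_option linter.unusedSectionVars false
namespace CM
open Real Finset

section TL
variable {X Y X' Y' : Type} [Fintype X] [Fintype Y] [DecidableEq Y] [Fintype X'] [Fintype Y']
  [DecidableEq Y'] {n : ℕ} {p : Y → X → ℝ} {q : Y' → X' → ℝ}

lemma T_local (hn : 0 < n) (pm : ∀ y, p y ∈ stdSimplex ℝ X) (qm : ∀ y, q y ∈ stdSimplex ℝ X')
    {B η : ℝ} (hB1 : 1 ≤ B) (hB : ∀ y x, |log (q y x)| ≤ B) (h0 : 0 < η) (h1 : η ≤ 1)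
    (h4 : log 4 ≤ n * (η ^ 2 / (4 * B ^ 2))) (h5 : log 4 ≤ n * η)
    (y : Fin n → Y) (y' : Fin n → Y') {R g s μ : ℝ} {k k' : ℕ} (hk : exp (n * R) ≤ k)
    (hk' : (k' : ℝ) ≤ 2 * exp (n * (R + g))) (hs : 0 < s) (hs1 : s ≤ 1)
    (hR : R + g + 3 * η ≤ RR q (fr (ty y')) s)
    (h : Ps p (fr (ty y)) s - (1 - s) * R ≤
      Ps q (fr (ty y')) s - (1 - s) * RR q (fr (ty y')) s + s * μ) :
    tailk (col p y) k ≤ exp (n * (μ + 3 * η)) * tailk (col q y') k' := by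
  have hn' : (0 : ℝ) < n := by exact_mod_cast hn
  refine (col_tail_le hn pm y hk hs hs1).trans ?_
  have h2 := col_le_tail hn qm hB1 hB h0 h1 h4 h5 y' hs.le hs1 hk' hR
  refine le_trans ?_ (mul_le_mul_of_nonneg_left h2 (exp_pos _).le)
  rw [← exp_add, exp_le_exp, ← mul_add]
  apply mul_le_mul_of_nonneg_left _ hn'.le
  rw [div_le_iff₀ hs]
  unfold RR at h
  nlinarith

lemma T_weak (hn : 0 < n) (pm : ∀ y, p y ∈ stdSimplex ℝ X) (qm : ∀ y, q y ∈ stdSimplex ℝ X')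
    {B η : ℝ} (hB1 : 1 ≤ B) (hB : ∀ y x, |log (q y x)| ≤ B) (h0 : 0 < η) (h1 : η ≤ 1)
    (h4 : log 4 ≤ n * (η ^ 2 / (4 * B ^ 2))) (h5 : log 4 ≤ n * η)
    (y : Fin n → Y) (y' : Fin n → Y') {R g ε κ : ℝ} {k k' : ℕ} (hk : exp (n * R) ≤ k)
    (hk' : (k' : ℝ) ≤ 2 * exp (n * (R + g))) (hG : g + 3 * η ≤ ε)
    (h : ∀ s, 0 ≤ s → s ≤ 1 →
      Ps p (fr (ty y)) s + (1 - s) * ε ≤ Ps q (fr (ty y')) s + s * κ) :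
    tailk (col p y) k ≤ exp (n * (κ + 3 * η)) * tailk (col q y') k' := by
  have hκ : 0 ≤ κ := by
    have := h 1 zero_le_one le_rfl
    rw [Ps_one pm, Ps_one qm] at this; linarith
  rcases le_or_gt (R + g + 3 * η) (RR q (fr (ty y')) 1) with c1 | c1
  · refine T_local hn pm qm hB1 hB h0 h1 h4 h5 y y' hk hk' one_pos le_rfl c1 ?_
    rw [Ps_one pm, Ps_one qm]; linarith
  rcases le_or_gt (RR q (fr (ty y')) 0) (R + g + 3 * η) with c2 | c2
  · have h3 := h 0 le_rfl zero_le_one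
    rw [RR_zero] at c2
    rw [col_tail_zero hn pm y hk (by linarith)]
    exact mul_nonneg (exp_pos _).le (tailk_nonneg (col_mem qm y').1 _)
  · obtain ⟨s, hs, hse⟩ := intermediate_value_Icc' zero_le_one
      (RR_cont qm (fr (ty y'))).continuousOn ⟨c1.le, c2.le⟩
    have hs0 : 0 < s := by
      rcases hs.1.eq_or_lt with e | e
      · subst e; linarith
      · exact e
    refine T_local hn pm qm hB1 hB h0 h1 h4 h5 y y' hk hk' hs0 hs.2 hse.ge ?_
    rw [hse]
    nlinarith [h s hs.1 hs.2, mul_le_mul_of_nonneg_left hG (sub_nonneg.2 hs.2)]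

lemma T_strong (hn : 0 < n) (pm : ∀ y, p y ∈ stdSimplex ℝ X) (qm : ∀ y, q y ∈ stdSimplex ℝ X')
    {B η : ℝ} (hB1 : 1 ≤ B) (hB : ∀ y x, |log (q y x)| ≤ B) (h0 : 0 < η) (h1 : η ≤ 1)
    (h4 : log 4 ≤ n * (η ^ 2 / (4 * B ^ 2))) (h5 : log 4 ≤ n * η)
    (y : Fin n → Y) (y' : Fin n → Y') {R g ε c s2 : ℝ} {k k' : ℕ} (hk : exp (n * R) ≤ k)
    (hk' : (k' : ℝ) ≤ 2 * exp (n * (R + g))) (hG : g + 3 * η ≤ ε / 4) (hε : 0 < ε)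
    (h : ∀ s, 0 ≤ s → s ≤ 1 →
      Ps p (fr (ty y)) s + (1 - s) * ε ≤ Ps q (fr (ty y')) s)
    (hR : Am q (fr (ty y')) 1 - ε / 2 ≤ R) (hs2 : 0 < s2) (hs21 : s2 < 1) (hc : 0 ≤ c)
    (hcs : c * s2 ≤ (1 - s2) * (ε / 4))
    (hRR : RR q (fr (ty y')) s2 ≤ RR q (fr (ty y')) 1 + ε / 4) :
    tailk (col p y) k ≤ exp (n * (-c + 3 * η)) * tailk (col q y') k' := by
  rw [RR_one qm] at hRR
  rcases le_or_gt (R + g + 3 * η) (RR q (fr (ty y')) s2) with c1 | c1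
  · refine T_local hn pm qm hB1 hB h0 h1 h4 h5 y y' hk hk' hs2 hs21.le c1 ?_
    have := mul_le_mul_of_nonneg_left (show RR q (fr (ty y')) s2 ≤ R + ε / 2 + ε / 4 by linarith)
      (sub_nonneg.2 hs21.le)
    nlinarith [h s2 hs2.le hs21.le]
  rcases le_or_gt (RR q (fr (ty y')) 0) (R + g + 3 * η) with c2 | c2
  · have h3 := h 0 le_rfl zero_le_one
    rw [RR_zero] at c2
    rw [col_tail_zero hn pm y hk (by linarith)]
    exact mul_nonneg (exp_pos _).le (tailk_nonneg (col_mem qm y').1 _)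
  · obtain ⟨s, hs, hse⟩ := intermediate_value_Icc' hs2.le
      (RR_cont qm (fr (ty y'))).continuousOn ⟨c1.le, c2.le⟩
    have hs0 : 0 < s := by
      rcases hs.1.eq_or_lt with e | e
      · subst e; linarith
      · exact e
    have hs1 : s ≤ 1 := hs.2.trans hs21.le
    refine T_local hn pm qm hB1 hB h0 h1 h4 h5 y y' hk hk' hs0 hs1 hse.ge ?_
    rw [hse]
    have e1 := mul_le_mul_of_nonneg_left hG (sub_nonneg.2 hs1)
    have e2 : c * s ≤ (1 - s) * (ε / 4) := by nlinarith [mul_le_mul_of_nonneg_left hs.2 hc, hs.2]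
    nlinarith [h s hs.1 hs1, mul_nonneg (sub_nonneg.2 hs1) hε.le]

end TL
end CM

set_option linter.unusedSectionVars false
namespace CM
open Real Finset

section Cls
variable {X Y : Type} [Fintype X] [Fintype Y] [DecidableEq Y] {n : ℕ}

/-- Largest tail in a type class. -/
def aT (p : Y → X → ℝ) (m : ℕ) (k : Tp Y n) : ℝ :=
  ⨆ y : {y : Fin n → Y // ty y = k}, tailk (col p y.1) m

/-- Smallest tail in a type class. -/
def bT (p : Y → X → ℝ) (m : ℕ) (k : Tp Y n) : ℝ :=
  ⨅ y : {y : Fin n → Y // ty y = k}, tailk (col p y.1) m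

lemma cls_nonempty (k : Tp Y n) : Nonempty {y : Fin n → Y // ty y = k} :=
  let ⟨y, hy⟩ := exists_ty k
  ⟨⟨y, hy⟩⟩

lemma le_aT (p : Y → X → ℝ) (m : ℕ) (y : Fin n → Y) : tailk (col p y) m ≤ aT p m (ty y) :=
  le_ciSup (f := fun z : {z : Fin n → Y // ty z = ty y} => tailk (col p z.1) m)
    (Set.finite_range _).bddAbove ⟨y, rfl⟩

lemma bT_le (p : Y → X → ℝ) (m : ℕ) (y : Fin n → Y) : bT p m (ty y) ≤ tailk (col p y) m :=
  ciInf_le (f := fun z : {z : Fin n → Y // ty z = ty y} => tailk (col p z.1) m)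
    (Set.finite_range _).bddBelow ⟨y, rfl⟩

lemma aT_ex (p : Y → X → ℝ) (m : ℕ) (k : Tp Y n) : ∃ y, ty y = k ∧ tailk (col p y) m = aT p m k := by
  have := cls_nonempty k
  obtain ⟨y, hy⟩ := exists_eq_ciSup_of_finite
    (f := fun z : {z : Fin n → Y // ty z = k} => tailk (col p z.1) m)
  exact ⟨y.1, y.2, hy⟩

lemma bT_ex (p : Y → X → ℝ) (m : ℕ) (k : Tp Y n) : ∃ y, ty y = k ∧ tailk (col p y) m = bT p m k := by
  have := cls_nonempty k
  obtain ⟨y, hy⟩ := exists_eq_ciInf_of_finite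
    (f := fun z : {z : Fin n → Y // ty z = k} => tailk (col p z.1) m)
  exact ⟨y.1, y.2, hy⟩

lemma one_sub_tail {p : Y → X → ℝ} (pm : ∀ y, p y ∈ stdSimplex ℝ X) (y : Fin n → Y) (m : ℕ) :
    1 - tailk (col p y) m = headk (col p y) m := by
  unfold tailk; rw [(col_mem pm y).2]; ring

lemma aT_mem {p : Y → X → ℝ} (pm : ∀ y, p y ∈ stdSimplex ℝ X) (m : ℕ) (k : Tp Y n) :
    0 ≤ aT p m k ∧ aT p m k ≤ 1 := by
  obtain ⟨y, -, h⟩ := aT_ex p m k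
  rw [← h]
  exact ⟨tailk_nonneg (col_mem pm y).1 m, (tailk_le_sum _ m).trans (col_mem pm y).2.le⟩

lemma bT_mem {p : Y → X → ℝ} (pm : ∀ y, p y ∈ stdSimplex ℝ X) (m : ℕ) (k : Tp Y n) :
    0 ≤ bT p m k ∧ bT p m k ≤ 1 := by
  obtain ⟨y, -, h⟩ := bT_ex p m k
  rw [← h]
  exact ⟨tailk_nonneg (col_mem pm y).1 m, (tailk_le_sum _ m).trans (col_mem pm y).2.le⟩

end Cls

section Asm
variable {X Y X' Y' : Type} [Fintype X] [Fintype Y] [DecidableEq Y] [Fintype X'] [Fintype Y']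
  [DecidableEq Y']

/-- The regime in which the finite-size construction works. -/
structure Reg (pr : Y → ℝ) (p : Y → X → ℝ) (qr : Y' → ℝ) (q : Y' → X' → ℝ) (n J : ℕ)
    (B η ε ε4 g δ c s2 U ζ : ℝ) : Prop where
  pr0 : ∀ y, 0 < pr y
  pr1 : ∑ y, pr y = 1
  pm : ∀ y, p y ∈ stdSimplex ℝ X
  qr0 : ∀ y, 0 < qr y
  qr1 : ∑ y, qr y = 1
  qm : ∀ y, q y ∈ stdSimplex ℝ X'
  hn : 0 < n
  B1 : 1 ≤ B
  Bp : ∀ y x, |log (p y x)| ≤ B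
  Bq : ∀ y x, |log (q y x)| ≤ B
  η0 : 0 < η
  η1 : η ≤ 1
  h4 : log 4 ≤ n * (η ^ 2 / (4 * B ^ 2))
  h5 : log 4 ≤ n * η
  g0 : 0 < g
  G1 : g + 3 * η ≤ ε / 4
  G4 : g + 3 * η ≤ ε4
  Z4 : ζ + g + 8 * η ≤ ε4
  e10 : 10 * η ≤ ε
  s20 : 0 < s2
  s21 : s2 < 1
  cη : 4 * η ≤ c
  cs : c * s2 ≤ (1 - s2) * (ε / 4)
  RRu : ∀ θ ∈ stdSimplex ℝ Y', RR q θ s2 ≤ RR q θ 1 + ε / 4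
  U1 : 1 ≤ U
  hd : log (Fintype.card X) / U + (U + 2) * η ≤ ζ
  pol : 8 * ((J : ℝ) + 1) ^ 2 * ((n : ℝ) + 1) ^ (Fintype.card Y + Fintype.card Y') ≤ exp (n * η)
  JJ : log (Fintype.card X) ≤ J * g
  F1f : ∀ (k : Tp Y n) (l : Tp Y' n), dist (fr k) pr < δ → dist (fr l) qr < δ →
    ∀ s, 0 ≤ s → s ≤ 1 → Ps p (fr k) s + (1 - s) * ε ≤ Ps q (fr l) s
  F2f : ∀ l : Tp Y' n, δ ≤ dist (fr l) qr → ∃ k : Tp Y n, Dv pr (fr k) + ε ≤ Dv qr (fr l) ∧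
    ∀ s, 0 ≤ s → s ≤ 1 → Ps p (fr k) s + (1 - s) * ε ≤ Ps q (fr l) s
  F3f : ∀ k : Tp Y n, δ ≤ dist (fr k) pr → ∃ l : Tp Y' n, ∀ s, 0 ≤ s → s ≤ 1 →
    Ps p (fr k) s + ε ≤ Ps q (fr l) s + s * (Dv pr (fr k) - Dv qr (fr l))
  F4f : ∀ (l : Tp Y' n) (R : ℝ), 0 ≤ R → R + ε / 4 ≤ Am q (fr l) 1 →
    ∃ β', 0 ≤ β' ∧ β' ≤ 1 ∧ ∃ k : Tp Y n, ∃ κ, 0 ≤ κ ∧ Dv pr (fr k) + ε4 ≤ Dv qr (fr l) + κ ∧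
      (∀ β, 0 ≤ β → β ≤ 1 → κ + MM p (fr k) β - β * R + ε4 ≤ MM q (fr l) β' - β' * R) ∧
      ∀ s, 0 ≤ s → s ≤ 1 → Ps p (fr k) s + ε4 ≤ Ps q (fr l) s + s * κ
  Nf : ∃ l : Tp Y' n, dist (fr l) qr < δ ∧ Dv qr (fr l) ≤ η

variable {pr : Y → ℝ} {p : Y → X → ℝ} {qr : Y' → ℝ} {q : Y' → X' → ℝ} {n J : ℕ}
    {B η ε ε4 g δ c s2 U ζ : ℝ}

/-- The grid of head sizes. -/
def kgrid (n : ℕ) (g : ℝ) (i : ℕ) : ℕ := ⌈exp (n * (i * g))⌉₊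

lemma le_kgrid (n : ℕ) (g : ℝ) (i : ℕ) : exp (n * (i * g)) ≤ kgrid n g i := Nat.le_ceil _

lemma kgrid_le (n : ℕ) {g : ℝ} (hg : 0 ≤ g) (i : ℕ) : (kgrid n g i : ℝ) ≤ 2 * exp (n * (i * g)) := by
  have h1 : 1 ≤ exp (n * (i * g)) := one_le_exp (by positivity)
  have h2 := (Nat.ceil_lt_add_one (exp_pos (n * (i * g))).le).le
  unfold kgrid; linarith

lemma one_le_kgrid (n : ℕ) (g : ℝ) (i : ℕ) : 1 ≤ kgrid n g i := Nat.ceil_pos.2 (exp_pos _)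

variable (H : Reg pr p qr q n J B η ε ε4 g δ c s2 U ζ)
include H

lemma Reg.Ppol : ((n : ℝ) + 1) ^ Fintype.card Y ≤ exp (n * η) := by
  refine le_trans ?_ H.pol
  have a1 : (1 : ℝ) ≤ (n : ℝ) + 1 := by linarith [Nat.cast_nonneg (α := ℝ) n]
  have a2 : ((n : ℝ) + 1) ^ Fintype.card Y ≤ ((n : ℝ) + 1) ^ (Fintype.card Y + Fintype.card Y') :=
    pow_le_pow_right₀ a1 (by omega)
  have a3 : (1 : ℝ) ≤ ((J : ℝ) + 1) ^ 2 := one_le_pow₀ (by linarith [Nat.cast_nonneg (α := ℝ) J])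
  nlinarith [pow_pos (zero_lt_one.trans_le a1) (Fintype.card Y + Fintype.card Y')]

lemma Reg.Qpol : ((n : ℝ) + 1) ^ Fintype.card Y' ≤ exp (n * η) := by
  refine le_trans ?_ H.pol
  have a1 : (1 : ℝ) ≤ (n : ℝ) + 1 := by linarith [Nat.cast_nonneg (α := ℝ) n]
  have a2 : ((n : ℝ) + 1) ^ Fintype.card Y' ≤ ((n : ℝ) + 1) ^ (Fintype.card Y + Fintype.card Y') :=
    pow_le_pow_right₀ a1 (by omega)
  have a3 : (1 : ℝ) ≤ ((J : ℝ) + 1) ^ 2 := one_le_pow₀ (by linarith [Nat.cast_nonneg (α := ℝ) J])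
  nlinarith [pow_pos (zero_lt_one.trans_le a1) (Fintype.card Y + Fintype.card Y')]

lemma Reg.hE : 4 * ((Fintype.card (Tp Y n) : ℝ) + 1) * ((J : ℝ) + 1) *
    ((Fintype.card (Tp Y' n) : ℝ) * ((J : ℝ) + 1)) ≤ exp (n * η) := by
  refine le_trans ?_ H.pol
  have a1 : (1 : ℝ) ≤ (n : ℝ) + 1 := by linarith [Nat.cast_nonneg (α := ℝ) n]
  have c1 := card_Tp (Y := Y) (n := n)
  have c2 := card_Tp (Y := Y') (n := n)
  have c3 : (Fintype.card (Tp Y n) : ℝ) + 1 ≤ 2 * ((n : ℝ) + 1) ^ Fintype.card Y := by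
    linarith [one_le_pow₀ a1 (n := Fintype.card Y)]
  have c4 := mul_le_mul c3 c2 (by positivity) (by positivity)
  rw [pow_add]
  have := mul_le_mul_of_nonneg_left c4 (show 0 ≤ 4 * ((J : ℝ) + 1) ^ 2 by positivity)
  nlinarith

lemma Reg.Ple (k : Tp Y n) : cp pr k ≤ exp (-(n * Dv pr (fr k))) := cp_le H.hn pr H.pr0 k
lemma Reg.Qle (k : Tp Y' n) : cp qr k ≤ exp (-(n * Dv qr (fr k))) := cp_le H.hn qr H.qr0 k

lemma Reg.leP (k : Tp Y n) : exp (-(n * (Dv pr (fr k) + η))) ≤ cp pr k := by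
  have h := (le_cp H.hn pr H.pr0 k).trans
    (mul_le_mul_of_nonneg_right H.Ppol (cp_nonneg pr (fun b => (H.pr0 b).le) k))
  have := mul_le_mul_of_nonneg_left h (exp_pos (-(n * η))).le
  rw [← mul_assoc, ← exp_add, ← exp_add, neg_add_cancel, exp_zero, one_mul] at this
  rw [show -(n * (Dv pr (fr k) + η)) = -(n * η) + -(n * Dv pr (fr k)) by ring]
  exact this

lemma Reg.leQ (k : Tp Y' n) : exp (-(n * (Dv qr (fr k) + η))) ≤ cp qr k := by
  have h := (le_cp H.hn qr H.qr0 k).trans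
    (mul_le_mul_of_nonneg_right H.Qpol (cp_nonneg qr (fun b => (H.qr0 b).le) k))
  have := mul_le_mul_of_nonneg_left h (exp_pos (-(n * η))).le
  rw [← mul_assoc, ← exp_add, ← exp_add, neg_add_cancel, exp_zero, one_mul] at this
  rw [show -(n * (Dv qr (fr k) + η)) = -(n * η) + -(n * Dv qr (fr k)) by ring]
  exact this

lemma Reg.weak (k : Tp Y n) (l : Tp Y' n) (i : ℕ) {e κ : ℝ} (hG : g + 3 * η ≤ e)
    (h : ∀ s, 0 ≤ s → s ≤ 1 → Ps p (fr k) s + (1 - s) * e ≤ Ps q (fr l) s + s * κ) :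
    aT p (kgrid n g i) k ≤ exp (n * (κ + 3 * η)) * bT q (kgrid n g (i + 1)) l := by
  obtain ⟨y, rfl, hy⟩ := aT_ex p (kgrid n g i) k
  obtain ⟨y', rfl, hy'⟩ := bT_ex q (kgrid n g (i + 1)) l
  rw [← hy, ← hy']
  refine T_weak H.hn H.pm H.qm H.B1 H.Bq H.η0 H.η1 H.h4 H.h5 y y' (le_kgrid n g i) (g := g) ?_ hG h
  have := kgrid_le n H.g0.le (i + 1)
  convert this using 4; push_cast; ring

lemma Reg.ε0 : 0 < ε := by linarith [H.e10, H.η0]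

lemma Reg.strong (k : Tp Y n) (l : Tp Y' n) (i : ℕ)
    (h : ∀ s, 0 ≤ s → s ≤ 1 → Ps p (fr k) s + (1 - s) * ε ≤ Ps q (fr l) s)
    (hi : Am q (fr l) 1 - ε / 2 ≤ i * g) :
    exp (n * η) * aT p (kgrid n g i) k ≤ bT q (kgrid n g (i + 1)) l := by
  obtain ⟨y, rfl, hy⟩ := aT_ex p (kgrid n g i) k
  obtain ⟨y', rfl, hy'⟩ := bT_ex q (kgrid n g (i + 1)) l
  have hn' : (0 : ℝ) < n := by exact_mod_cast H.hn
  have h0 := tailk_nonneg (col_mem H.qm y').1 (kgrid n g (i + 1))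
  rw [← hy, ← hy']
  have := T_strong H.hn H.pm H.qm H.B1 H.Bq H.η0 H.η1 H.h4 H.h5 y y' (le_kgrid n g i) (g := g)
    (k' := kgrid n g (i + 1)) (by
    have := kgrid_le n H.g0.le (i + 1)
    convert this using 4; push_cast; ring) H.G1 H.ε0 h hi H.s20 H.s21
    (c := c) (by linarith [H.cη, H.η0]) H.cs (H.RRu _ (fr_mem H.hn _))
  have := mul_le_mul_of_nonneg_left this (exp_pos (n * η)).le
  refine this.trans ?_
  rw [← mul_assoc, ← exp_add]
  refine mul_le_of_le_one_left h0 (exp_le_one_iff.2 ?_)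
  rw [← mul_add]
  exact mul_nonpos_of_nonneg_of_nonpos hn'.le (by linarith [H.cη])

/-- Far input types. -/
lemma Reg.far (k : Tp Y n) (hk : δ ≤ dist (fr k) pr) : ε ≤ Dv pr (fr k) ∧ ∃ l : Tp Y' n,
    exp (n * η) * cp pr k ≤ cp qr l ∧ ∀ i : ℕ,
    exp (n * η) * (cp pr k * aT p (kgrid n g i) k) ≤ cp qr l * bT q (kgrid n g (i + 1)) l := by
  have hn' : (0 : ℝ) < n := by exact_mod_cast H.hn
  obtain ⟨l, hl⟩ := H.F3f k hk
  have h1 := hl 1 zero_le_one le_rfl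
  rw [Ps_one H.pm, Ps_one H.qm] at h1
  have hD := Dv_nonneg H.qr0 H.qr1 (fr_mem H.hn l)
  have := H.e10
  have := H.η0
  refine ⟨by linarith, l, ?_, fun i => ?_⟩
  · refine (mul_le_mul_of_nonneg_left (H.Ple k) (exp_pos _).le).trans (le_trans ?_ (H.leQ l))
    rw [← exp_add, exp_le_exp]
    nlinarith
  · have hw := H.weak k l i (e := ε) (κ := Dv pr (fr k) - Dv qr (fr l) - ε)
      (by linarith [H.G1]) (fun s h0 h1 => by nlinarith [hl s h0 h1])
    have hb := (bT_mem H.qm (kgrid n g (i + 1)) l).1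
    calc exp (n * η) * (cp pr k * aT p (kgrid n g i) k)
        ≤ exp (n * η) * (exp (-(n * Dv pr (fr k))) *
          (exp (n * (Dv pr (fr k) - Dv qr (fr l) - ε + 3 * η)) * bT q (kgrid n g (i + 1)) l)) := by
          refine mul_le_mul_of_nonneg_left ?_ (exp_pos _).le
          exact mul_le_mul (H.Ple k) hw (aT_mem H.pm _ _).1 (exp_pos _).le
      _ = exp (n * η + (-(n * Dv pr (fr k)) + n * (Dv pr (fr k) - Dv qr (fr l) - ε + 3 * η))) *
          bT q (kgrid n g (i + 1)) l := by rw [exp_add, exp_add]; ring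
      _ ≤ _ := by
          refine mul_le_mul_of_nonneg_right (le_trans (exp_le_exp.2 ?_) (H.leQ l)) hb
          nlinarith

lemma Reg.ha (k : Tp Y n) : ∃ l : Tp Y' n, cp pr k ≤ exp (5 * (n * η)) * cp qr l ∧ ∀ i : ℕ,
    cp pr k * aT p (kgrid n g i) k ≤
      exp (5 * (n * η)) * (cp qr l * bT q (kgrid n g (i + 1)) l) := by
  have hn' : (0 : ℝ) < n := by exact_mod_cast H.hn
  have hnη : 0 < n * η := mul_pos hn' H.η0
  have hP0 := cp_nonneg pr (fun b => (H.pr0 b).le) k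
  rcases lt_or_ge (dist (fr k) pr) δ with hk | hk
  · obtain ⟨l, hl1, hl2⟩ := H.Nf
    have hP1 : cp pr k ≤ 1 := by
      refine (H.Ple k).trans (exp_le_one_iff.2 ?_)
      have := Dv_nonneg H.pr0 H.pr1 (fr_mem H.hn k)
      have := mul_nonneg hn'.le this
      linarith
    have hQ : exp (3 * (n * η)) ≤ exp (5 * (n * η)) * cp qr l := by
      refine le_trans ?_ (mul_le_mul_of_nonneg_left (H.leQ l) (exp_pos _).le)
      rw [← exp_add, exp_le_exp]
      nlinarith
    refine ⟨l, hP1.trans ((one_le_exp (by linarith)).trans hQ), fun i => ?_⟩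
    have hw := H.weak k l i (e := ε) (κ := 0) (by linarith [H.G1, H.ε0])
      (fun s h0 h1 => by linarith [H.F1f k l hk hl1 s h0 h1])
    have hb := (bT_mem H.qm (kgrid n g (i + 1)) l).1
    calc _ ≤ aT p (kgrid n g i) k := mul_le_of_le_one_left (aT_mem H.pm _ _).1 hP1
      _ ≤ exp (3 * (n * η)) * bT q (kgrid n g (i + 1)) l := by
        convert hw using 3; ring
      _ ≤ _ := by
        rw [← mul_assoc (exp (5 * (n * η)))]; exact mul_le_mul_of_nonneg_right hQ hb
  · obtain ⟨-, l, h1, h2⟩ := H.far k hk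
    have e1 : 1 ≤ exp (n * η) := one_le_exp hnη.le
    have e2 : 1 ≤ exp (5 * (n * η)) := one_le_exp (by linarith)
    have hQ0 := cp_nonneg qr (fun b => (H.qr0 b).le) l
    refine ⟨l, (le_mul_of_one_le_left hP0 e1).trans (h1.trans (le_mul_of_one_le_left hQ0 e2)),
      fun i => ?_⟩
    have hb := (bT_mem H.qm (kgrid n g (i + 1)) l).1
    have ha := (aT_mem H.pm (kgrid n g i) k).1
    exact (le_mul_of_one_le_left (mul_nonneg hP0 ha) e1).trans ((h2 i).trans
      (le_mul_of_one_le_left (mul_nonneg hQ0 hb) e2))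

lemma Reg.hA (l : Tp Y' n) (j : ℕ) (hj : j * g < Am q (fr l) 1 - ε / 2) :
    ∃ (k : Tp Y n) (w : ℝ), 0 ≤ w ∧ w ≤ 1 ∧
      exp (n * η) * exp (5 * (n * η)) * (cp qr l * (1 - bT q (kgrid n g (j + 1)) l)) ≤
        w * cp pr k * (1 - aT p (kgrid n g j) k) ∧
      w * cp pr k ≤ exp (5 * (n * η)) * cp qr l ∧
      ∀ i : ℕ, w * cp pr k * aT p (kgrid n g i) k ≤
        exp (5 * (n * η)) * (cp qr l * bT q (kgrid n g (i + 1)) l) := by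
  have hn' : (0 : ℝ) < n := by exact_mod_cast H.hn
  have hnη : 0 < n * η := mul_pos hn' H.η0
  have hg := H.g0
  have l2 : (0 : ℝ) < log 2 := log_pos (by norm_num)
  have l4 : log 4 = 2 * log 2 := by
    rw [show (4 : ℝ) = 2 ^ 2 by norm_num, log_pow]; push_cast; ring
  obtain ⟨β', hb0, hb1, k, κ, hκ, hD, hM, hps⟩ := H.F4f l ((j + 1 : ℕ) * g) (by positivity) (by
    push_cast; nlinarith [H.G1, H.η0, H.ε0])
  set D := Dv pr (fr k) with hDd
  set D' := Dv qr (fr l) with hDd'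
  have hε4 : 0 < ε4 := by linarith [H.G4, H.η0]
  have hP0 := cp_nonneg pr (fun b => (H.pr0 b).le) k
  have hQ0 := cp_nonneg qr (fun b => (H.qr0 b).le) l
  have hwP : exp (-(n * (D' + κ - D))) * cp pr k ≤ exp (-(n * (D' + κ))) := by
    refine (mul_le_mul_of_nonneg_left (H.Ple k) (exp_pos _).le).trans ?_
    rw [← exp_add, exp_le_exp, ← hDd]; linarith
  refine ⟨k, exp (-(n * (D' + κ - D))), (exp_pos _).le, exp_le_one_iff.2 ?_, ?_, ?_, fun i => ?_⟩
  · have : 0 ≤ n * (D' + κ - D) := mul_nonneg hn'.le (by linarith)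
    linarith
  · obtain ⟨y, hyt, hy⟩ := aT_ex p (kgrid n g j) k
    obtain ⟨y', hyt', hy'⟩ := bT_ex q (kgrid n g (j + 1)) l
    rw [← hy, ← hy', one_sub_tail H.pm, one_sub_tail H.qm]
    have u1 := col_head_le H.hn H.qm y' (one_le_kgrid n g (j + 1)) (kgrid_le n hg.le (j + 1)) hb0 hb1
    obtain ⟨β, hβ0, hβ1, u2⟩ := col_le_head H.hn H.pm H.B1 H.Bp H.η0 H.η1 H.h4 H.h5 y H.U1 H.hd
      (le_kgrid n g j)
    rw [hyt] at u2
    rw [hyt'] at u1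
    have h3 := hM β hβ0 hβ1
    calc _ ≤ exp (n * η) * exp (5 * (n * η)) * (exp (-(n * D')) *
          (2 * exp (-(n * (MM q (fr l) β' - β' * ((j + 1 : ℕ) * g)))))) := by
          refine mul_le_mul_of_nonneg_left ?_ (by positivity)
          exact mul_le_mul (H.Qle l) u1 (headk_nonneg _ _) (exp_pos _).le
      _ = exp (n * η + 5 * (n * η) + (-(n * D') +
          (log 2 + (-(n * (MM q (fr l) β' - β' * ((j + 1 : ℕ) * g))))))) := by
          rw [exp_add, exp_add, exp_add, exp_add, exp_log (by norm_num)]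
      _ ≤ exp (-(n * (D' + κ - D)) + -(n * (D + η)) +
          -(n * (MM p (fr k) β - β * (j * g) + ζ))) := by
          rw [exp_le_exp]
          have h5 := H.h5
          have hz := H.Z4
          have e1 : β * g ≤ g := mul_le_of_le_one_left hg.le hβ1
          push_cast at h3 ⊢
          have e2 : κ + MM p (fr k) β - β * (j * g) + ζ + 8 * η ≤
              MM q (fr l) β' - β' * ((j + 1) * g) := by nlinarith
          have e3 := mul_le_mul_of_nonneg_left e2 hn'.le
          linarith
      _ = exp (-(n * (D' + κ - D))) * exp (-(n * (D + η))) *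
          exp (-(n * (MM p (fr k) β - β * (j * g) + ζ))) := by rw [exp_add, exp_add]
      _ ≤ _ := by
          refine mul_le_mul ?_ u2 (exp_pos _).le (by positivity)
          exact mul_le_mul_of_nonneg_left (H.leP k) (exp_pos _).le
  · refine hwP.trans ?_
    refine le_trans ?_ (mul_le_mul_of_nonneg_left (H.leQ l) (exp_pos _).le)
    rw [← exp_add, exp_le_exp, ← hDd']
    nlinarith [mul_nonneg hn'.le hκ]
  · have hw := H.weak k l i (e := ε4) (κ := κ) H.G4
      (fun s h0 h1 => by nlinarith [hps s h0 h1])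
    have hb := (bT_mem H.qm (kgrid n g (i + 1)) l).1
    calc _ ≤ exp (-(n * (D' + κ))) * (exp (n * (κ + 3 * η)) * bT q (kgrid n g (i + 1)) l) :=
          mul_le_mul hwP hw (aT_mem H.pm _ _).1 (exp_pos _).le
      _ = exp (-(n * (D' + κ)) + n * (κ + 3 * η)) * bT q (kgrid n g (i + 1)) l := by
          rw [exp_add]; ring
      _ ≤ exp (5 * (n * η)) * cp qr l * bT q (kgrid n g (i + 1)) l := by
          refine mul_le_mul_of_nonneg_right ?_ hb
          refine le_trans ?_ (mul_le_mul_of_nonneg_left (H.leQ l) (exp_pos _).le)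
          rw [← exp_add, exp_le_exp, ← hDd']
          nlinarith
      _ = _ := by ring

lemma Reg.mass : ∃ s : Finset (Tp Y n), (∀ k ∈ s, dist (fr k) pr < δ) ∧ 1 / 2 ≤ ∑ k ∈ s, cp pr k := by
  have hn' : (0 : ℝ) < n := by exact_mod_cast H.hn
  have hnη : 0 < n * η := mul_pos hn' H.η0
  refine ⟨univ.filter fun k => dist (fr k) pr < δ, fun k hk => (mem_filter.1 hk).2, ?_⟩
  have h1 := sum_cp (n := n) pr H.pr1
  rw [← sum_filter_add_sum_filter_not univ (fun k : Tp Y n => dist (fr k) pr < δ)] at h1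
  have h2 : ∑ k ∈ univ.filter (fun k : Tp Y n => ¬ dist (fr k) pr < δ), cp pr k ≤ 1 / 2 := by
    have b1 : ∀ k ∈ univ.filter (fun k : Tp Y n => ¬ dist (fr k) pr < δ),
        cp pr k ≤ exp (-(n * ε)) := fun k hk => by
      refine (H.Ple k).trans (exp_le_exp.2 ?_)
      have := (H.far k (not_lt.1 (mem_filter.1 hk).2)).1
      have := mul_le_mul_of_nonneg_left this hn'.le
      linarith
    have b2 := sum_le_card_nsmul _ _ _ b1
    rw [nsmul_eq_mul] at b2
    have b3 : ((univ.filter (fun k : Tp Y n => ¬ dist (fr k) pr < δ)).card : ℝ) ≤ exp (n * η) := by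
      refine le_trans ?_ (card_Tp.trans H.Ppol)
      exact_mod_cast card_le_univ _
    have b4 : exp (n * η) * exp (-(n * ε)) ≤ 1 / 4 := by
      rw [← exp_add, show (1 / 4 : ℝ) = exp (-log 4) by
        rw [exp_neg, exp_log (by norm_num)]; norm_num, exp_le_exp]
      nlinarith [H.h5, mul_le_mul_of_nonneg_left H.e10 hn'.le]
    have b5 := mul_le_mul_of_nonneg_right b3 (exp_pos (-(n * ε))).le
    linarith
  linarith

theorem Reg.crit : Crit (kronPow (fmat pr p) n) (kronPow (fmat qr q) n) := by
  classical
  have hn' : (0 : ℝ) < n := by exact_mod_cast H.hn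
  have hnη : 0 < n * η := mul_pos hn' H.η0
  have : Nonempty (Tp Y' n) := let ⟨l, _⟩ := H.Nf; ⟨l⟩
  obtain ⟨v, v1, v2, v3, v4⟩ := lp_main (T := Tp Y n) (T' := Tp Y' n) (J := Fin J) (cp pr) (cp qr)
    (fun j => aT p (kgrid n g j)) (fun j => bT q (kgrid n g (j.1 + 1)))
    (fun l j => (j.1 : ℝ) * g < Am q (fr l) 1 - ε / 2) (exp (5 * (n * η))) (exp (n * η))
    (exp_pos _).le (by simpa using H.hE) (cp_nonneg pr fun b => (H.pr0 b).le) (sum_cp pr H.pr1)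
    (fun l => (exp_pos _).trans_le (H.leQ l)) (sum_cp qr H.qr1)
    (fun j k => (aT_mem H.pm _ k).1) (fun j k => (aT_mem H.pm _ k).2)
    (fun j k => (bT_mem H.qm _ k).1) (fun j k => (bT_mem H.qm _ k).2)
    (fun k => by
      obtain ⟨l, h1, h2⟩ := H.ha k
      exact ⟨l, h1, fun j _ => h2 j⟩)
    (fun l j hj => by
      obtain ⟨k, w, h1, h2, h3, h4, h5⟩ := H.hA l j hj
      exact ⟨k, w, h1, h2, h3, h4, fun i _ => h5 i⟩)
    (fun l => by
      rcases lt_or_ge (dist (fr l) qr) δ with hl | hl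
      · right
        refine ⟨fun k => dist (fr k) pr < δ, H.mass, fun k hk i hi => ?_, fun k hk => ?_⟩
        · exact H.strong k l i (H.F1f k l hk hl) (not_lt.1 hi)
        · obtain ⟨-, z, h1, h2⟩ := H.far k (not_lt.1 hk)
          exact ⟨z, h1, fun j _ => h2 j⟩
      · left
        obtain ⟨k, h1, h2⟩ := H.F2f l hl
        refine ⟨k, ?_, fun i hi => H.strong k l i h2 (not_lt.1 hi)⟩
        refine (mul_le_mul_of_nonneg_left (H.Qle l) (by positivity)).trans (le_trans ?_ (H.leP k))
        rw [← exp_add, ← exp_add, exp_le_exp]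
        have := mul_le_mul_of_nonneg_left (show Dv pr (fr k) + 10 * η ≤ Dv qr (fr l) by
          linarith [H.e10]) hn'.le
        nlinarith)
  refine crit_of_types pr p qr q H.pr0 H.qr0 (fun y => (H.pm y).1) (fun y => (H.pm y).2)
    (fun y => (H.qm y).1) (fun y => (H.qm y).2) (kgrid n g) J (by simp [kgrid]) ?_ _ _
    (fun j y => le_aT p _ y) (fun j y => bT_le q _ y) v v1 v2 v3 v4
  have hX : (0 : ℝ) < Fintype.card X := by
    have : Nonempty Y := by
      by_contra h
      rw [not_nonempty_iff] at h
      have := H.pr1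
      simp at this
    obtain ⟨x, -⟩ := simplex_pos (H.pm (Classical.arbitrary Y))
    exact_mod_cast Fintype.card_pos_iff.2 ⟨x⟩
  have : ((Fintype.card (Fin n → X) : ℕ) : ℝ) ≤ kgrid n g J := by
    refine le_trans ?_ (le_kgrid n g J)
    rw [Fintype.card_fun, Fintype.card_fin]
    push_cast
    rw [← exp_log hX, ← exp_nat_mul, exp_le_exp]
    exact mul_le_mul_of_nonneg_left H.JJ hn'.le
  exact_mod_cast this

end Asm
end CM

set_option linter.unusedSectionVars false
namespace CM
open Real Finset

section Ev
variable {X Y X' Y' : Type} [Fintype X] [Fintype Y] [DecidableEq Y] [Fintype X'] [Fintype Y']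
  [DecidableEq Y'] {pr : Y → ℝ} {p : Y → X → ℝ} {qr : Y' → ℝ} {q : Y' → X' → ℝ}

lemma Ps_eq (pm : ∀ y, p y ∈ stdSimplex ℝ X) (θ : Y → ℝ) (s : ℝ) :
    Ps p θ s = (1 - s) * av θ (fun y => Ht (p y) s) := by
  unfold Ps av
  rw [mul_sum]
  refine sum_congr rfl fun y _ => ?_
  have := Ht_mul (pm y).2 s
  simp only
  rw [← this]; ring

lemma RR_unif (pm : ∀ y, p y ∈ stdSimplex ℝ X) {e : ℝ} (he : 0 < e) :
    ∃ s, 0 < s ∧ s < 1 ∧ ∀ θ ∈ stdSimplex ℝ Y, RR p θ s ≤ RR p θ 1 + e := by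
  have h1 : ∀ y, ∀ᶠ s in nhdsWithin (1 : ℝ) (Set.Iio 1),
      psi (p y) s + s * am (p y) s < psi (p y) 1 + 1 * am (p y) 1 + e := fun y => by
    have hc : Continuous fun s => psi (p y) s + s * am (p y) s :=
      (psi_cont (pm y).1 (simplex_pos (pm y))).add
        (continuous_id.mul (am_cont (pm y).1 (simplex_pos (pm y))))
    exact (hc.continuousAt.eventually_lt continuousAt_const (by linarith)).filter_mono
      nhdsWithin_le_nhds
  have h2 := Filter.eventually_all.2 h1
  have h3 : ∀ᶠ s in nhdsWithin (1 : ℝ) (Set.Iio 1), s ∈ Set.Ioo (0 : ℝ) 1 :=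
    Ioo_mem_nhdsLT one_pos
  obtain ⟨s, hs, hs1⟩ := (h2.and h3).exists
  refine ⟨s, hs1.1, hs1.2, fun θ hθ => ?_⟩
  have key : ∀ t, RR p θ t = ∑ y, θ y * (psi (p y) t + t * am (p y) t) := fun t => by
    unfold RR Ps Am av
    rw [mul_sum, ← sum_add_distrib]
    exact sum_congr rfl fun y _ => by ring
  rw [key, key]
  calc _ ≤ ∑ y, θ y * (psi (p y) 1 + 1 * am (p y) 1 + e) :=
        sum_le_sum fun y _ => mul_le_mul_of_nonneg_left (hs y).le (hθ.1 y)
    _ = _ := by simp only [mul_add, sum_add_distrib, ← sum_mul, hθ.2, one_mul]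

lemma pol_eventually (C : ℝ) (hC : 0 < C) (m : ℕ) {η : ℝ} (hη : 0 < η) :
    ∀ᶠ n : ℕ in Filter.atTop, C * ((n : ℝ) + 1) ^ m ≤ exp (n * η) := by
  have h := isLittleO_pow_exp_pos_mul_atTop m hη
  have hc : 0 < 1 / (C * exp η) := by positivity
  have h2 : Filter.Tendsto (fun n : ℕ => (n : ℝ) + 1) Filter.atTop Filter.atTop :=
    Filter.tendsto_atTop_add_const_right _ _ tendsto_natCast_atTop_atTop
  filter_upwards [h2.eventually (h.def hc)] with n hn
  rw [norm_of_nonneg (by positivity), norm_of_nonneg (exp_pos _).le] at hn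
  have := mul_le_mul_of_nonneg_left hn hC.le
  refine this.trans (le_of_eq ?_)
  rw [mul_add, exp_add, mul_one, mul_comm η]
  field_simp

lemma lin_eventually (C : ℝ) {a : ℝ} (ha : 0 < a) :
    ∀ᶠ n : ℕ in Filter.atTop, C ≤ n * a :=
  (tendsto_natCast_atTop_atTop.atTop_mul_const ha).eventually_ge_atTop C

lemma div_eventually (C : ℝ) {r : ℝ} (hr : 0 < r) :
    ∀ᶠ n : ℕ in Filter.atTop, C / n < r :=
  (tendsto_const_div_atTop_nhds_zero_nat C).eventually_lt_const hr

theorem crit_eventually (S : Setup pr p qr q) :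
    ∃ N, ∀ n ≥ N, Crit (kronPow (fmat pr p) n) (kronPow (fmat qr q) n) := by
  obtain ⟨δ, hδ, f1⟩ := F1 S
  obtain ⟨ε2, hε2, f2⟩ := F2 S hδ
  obtain ⟨ε3, hε3, f3⟩ := F3 S hδ
  obtain ⟨ε, hε, e1, e2, e3⟩ : ∃ ε, 0 < ε ∧ ε ≤ δ ∧ ε ≤ ε2 ∧ ε ≤ ε3 :=
    ⟨min δ (min ε2 ε3), by positivity, min_le_left _ _,
      (min_le_right _ _).trans (min_le_left _ _), (min_le_right _ _).trans (min_le_right _ _)⟩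
  obtain ⟨ε4, hε4, f4⟩ := F4 S (e0 := ε / 4) (by positivity)
  obtain ⟨s2, s20, s21, hRR⟩ := RR_unif S.qm (e := ε / 4) (by positivity)
  obtain ⟨c, hc, hcs⟩ : ∃ c, 0 < c ∧ c * s2 = (1 - s2) * (ε / 4) :=
    ⟨(1 - s2) * (ε / 4) / s2, div_pos (mul_pos (by linarith) (by positivity)) s20,
      div_mul_cancel₀ _ s20.ne'⟩
  have hlX : 0 ≤ log (Fintype.card X) := log_natCast_nonneg _
  obtain ⟨U, U1, hU⟩ : ∃ U, 1 ≤ U ∧ log (Fintype.card X) / U ≤ ε4 / 8 := by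
    have h0 : 0 ≤ log (Fintype.card X) * 8 / ε4 := by positivity
    refine ⟨1 + log (Fintype.card X) * 8 / ε4, by linarith, ?_⟩
    rw [div_le_iff₀ (by positivity), mul_add]
    have : ε4 / 8 * (log (Fintype.card X) * 8 / ε4) = log (Fintype.card X) := by field_simp
    linarith
  obtain ⟨g, hg, g1, g2⟩ : ∃ g, 0 < g ∧ g ≤ ε / 8 ∧ g ≤ ε4 / 8 :=
    ⟨min (ε / 8) (ε4 / 8), by positivity, min_le_left _ _, min_le_right _ _⟩
  obtain ⟨η, hη, η1, η2, η3, η4, η5⟩ : ∃ η, 0 < η ∧ η ≤ 1 ∧ η ≤ ε / 24 ∧ η ≤ ε4 / 64 ∧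
      η ≤ ε4 / (8 * (U + 2)) ∧ η ≤ c / 4 := by
    have hU2 : 0 < U + 2 := by linarith
    refine ⟨min 1 (min (ε / 24) (min (ε4 / 64) (min (ε4 / (8 * (U + 2))) (c / 4)))),
      by positivity, min_le_left _ _, ?_, ?_, ?_, ?_⟩
    · exact (min_le_right _ _).trans (min_le_left _ _)
    · exact (min_le_right _ _).trans ((min_le_right _ _).trans (min_le_left _ _))
    · exact (min_le_right _ _).trans ((min_le_right _ _).trans
        ((min_le_right _ _).trans (min_le_left _ _)))
    · exact (min_le_right _ _).trans ((min_le_right _ _).trans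
        ((min_le_right _ _).trans (min_le_right _ _)))
  have η4' : (U + 2) * η ≤ ε4 / 8 := by
    rw [le_div_iff₀ (by linarith)] at η4; linarith
  obtain ⟨J, hJ⟩ : ∃ J : ℕ, log (Fintype.card X) ≤ J * g := by
    obtain ⟨J, hJ⟩ := exists_nat_ge (log (Fintype.card X) / g)
    exact ⟨J, (div_le_iff₀ hg).1 hJ⟩
  obtain ⟨B, B1, Bp, Bq⟩ : ∃ B : ℝ, 1 ≤ B ∧ (∀ y x, |log (p y x)| ≤ B) ∧
      ∀ y x, |log (q y x)| ≤ B := by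
    have n1 : 0 ≤ ∑ y, ∑ x, |log (p y x)| := sum_nonneg fun y _ => sum_nonneg fun x _ => abs_nonneg _
    have n2 : 0 ≤ ∑ y, ∑ x, |log (q y x)| := sum_nonneg fun y _ => sum_nonneg fun x _ => abs_nonneg _
    refine ⟨1 + ∑ y, ∑ x, |log (p y x)| + ∑ y, ∑ x, |log (q y x)|, by linarith, fun y x => ?_,
      fun y x => ?_⟩
    · have a1 := single_le_sum (f := fun x => |log (p y x)|) (fun x _ => abs_nonneg _) (mem_univ x)
      have a2 := single_le_sum (f := fun y => ∑ x, |log (p y x)|)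
        (fun y _ => sum_nonneg fun x _ => abs_nonneg _) (mem_univ y)
      linarith
    · have a1 := single_le_sum (f := fun x => |log (q y x)|) (fun x _ => abs_nonneg _) (mem_univ x)
      have a2 := single_le_sum (f := fun y => ∑ x, |log (q y x)|)
        (fun y _ => sum_nonneg fun x _ => abs_nonneg _) (mem_univ y)
      linarith
  obtain ⟨r0, hr0, hr⟩ := Metric.continuousAt_iff.1 ((Dv_cont qr).continuousAt (x := qr)) η hη
  have E1 := lin_eventually (log 4) (a := η ^ 2 / (4 * B ^ 2)) (by positivity)
  have E2 := lin_eventually (log 4) hη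
  have E3 := pol_eventually (8 * ((J : ℝ) + 1) ^ 2) (by positivity)
    (Fintype.card Y + Fintype.card Y') hη
  have E4 := div_eventually ((Fintype.card Y : ℝ) + 1) (r := min ε ε4) (by positivity)
  have E5 := div_eventually ((Fintype.card Y' : ℝ) + 1) (r := min ε r0) (by positivity)
  obtain ⟨N, hN⟩ := Filter.eventually_atTop.1
    (E1.and (E2.and (E3.and (E4.and (E5.and (Filter.eventually_gt_atTop 0))))))
  refine ⟨N, fun n hn => ?_⟩
  obtain ⟨h4, h5, h6, h7, h8, hn0⟩ := hN n hn
  rw [lt_min_iff] at h7 h8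
  have conv : ∀ (θ : Y → ℝ) (θ' : Y' → ℝ) (e s : ℝ), ε ≤ e → s ≤ 1 →
      av θ (fun y => Ht (p y) s) + e ≤ av θ' (fun y => Ht (q y) s) →
      Ps p θ s + (1 - s) * ε ≤ Ps q θ' s := fun θ θ' e s he hs h => by
    rw [Ps_eq S.pm, Ps_eq S.qm, ← mul_add]
    exact mul_le_mul_of_nonneg_left (by linarith) (by linarith)
  have H : Reg pr p qr q n J B η ε ε4 g δ c s2 U (ε4 / 4) :=
    { pr0 := S.pr0, pr1 := S.pr1, pm := S.pm, qr0 := S.qr0, qr1 := S.qr1, qm := S.qm,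
      hn := hn0, B1 := B1, Bp := Bp, Bq := Bq, η0 := hη, η1 := η1, h4 := h4, h5 := h5,
      g0 := hg
      G1 := by linarith
      G4 := by linarith
      Z4 := by linarith
      e10 := by linarith
      s20 := s20, s21 := s21
      cη := by linarith
      cs := hcs.le
      RRu := hRR
      U1 := U1
      hd := by linarith
      pol := h6
      JJ := hJ
      F1f := fun k l hk hl s a b => conv _ _ _ _ e1 b (f1 _ _ hk hl s a b)
      F2f := fun l hl => by
        obtain ⟨θ, hθ, h⟩ := f2 _ (fr_mem hn0 l) hl
        obtain ⟨k, hk⟩ := round_type hn0 θ hθ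
        obtain ⟨h1, h2⟩ := h (fr k) (by linarith)
        exact ⟨k, by linarith, fun s a b => conv _ _ _ _ e2 b (h2 s a b)⟩
      F3f := fun k hk => by
        obtain ⟨θ, hθ, h⟩ := f3 _ (fr_mem hn0 k) hk
        obtain ⟨l, hl⟩ := round_type hn0 θ hθ
        exact ⟨l, fun s a b => by linarith [h (fr l) (by linarith) s a b]⟩
      F4f := fun l R hR hl => by
        obtain ⟨β', b0, b1, θ, hθ, h⟩ := f4 _ (fr_mem hn0 l) R hR hl
        obtain ⟨k, hk⟩ := round_type hn0 θ hθ
        obtain ⟨κ, h1⟩ := h (fr k) (by linarith)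
        exact ⟨β', b0, b1, k, κ, h1⟩
      Nf := by
        obtain ⟨l, hl⟩ := round_type hn0 qr S.qrm
        refine ⟨l, by linarith, ?_⟩
        have := hr (show dist (fr l) qr < r0 by linarith)
        rw [Dv_self, dist_zero_right] at this
        exact (le_abs_self _).trans this.le }
  exact H.crit

end Ev
end CM

set_option linter.unusedSectionVars false
namespace CM
open Real Finset

section Red
variable {X Y X' Y' : Type} [Fintype X] [Fintype Y] [Fintype X'] [Fintype Y']

/-- Columns of positive mass. -/
abbrev PosY (P : Matrix X Y ℝ) : Type := {y : Y // 0 < margY P y}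

open Classical in
lemma sum_posY (P : Matrix X Y ℝ) (f : Y → ℝ) :
    ∑ y ∈ univ.filter (fun y => 0 < margY P y), f y = ∑ y : PosY P, f y.1 :=
  (sum_subtype _ (fun y => by simp) f)

lemma embeds_core {P : Matrix X Y ℝ} (hP : ∀ x y, 0 ≤ P x y) :
    Embeds (fmat (fun y : PosY P => margY P y.1) (fun y => condX P y.1)) P := by
  refine ⟨Function.Embedding.refl X, Function.Embedding.subtype _, fun x y => ?_, fun x y h => ?_⟩
  · simp only [fmat, Matrix.of_apply, Function.Embedding.refl_apply, Function.Embedding.subtype_apply]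
    exact (margY_mul_condX hP _ _).symm
  · refine ⟨⟨x, rfl⟩, ⟨⟨y, ?_⟩, rfl⟩⟩
    have h1 : 0 < P x y := lt_of_le_of_ne (hP x y) (Ne.symm h)
    exact h1.trans_le (single_le_sum (f := fun x => P x y) (fun x _ => hP x y) (mem_univ x))

lemma sum_margY_pos {P : Matrix X Y ℝ} (hP : IsJointProb P) : ∑ y : PosY P, margY P y.1 = 1 := by
  classical
  rw [← sum_posY P (margY P), sum_filter]
  have h1 : ∑ y, margY P y = 1 := by
    unfold margY; rw [sum_comm]; exact hP.2
  rw [← h1]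
  refine sum_congr rfl fun y _ => ?_
  split_ifs with h
  · rfl
  · exact le_antisymm (margY_nonneg hP.1 y) (not_lt.1 h)

lemma setup_of {P : Matrix X Y ℝ} {Q : Matrix X' Y' ℝ} (hP : IsJointProb P) (hQ : IsJointProb Q)
    (hbulk : ∀ (t : ℝ) (τ : Measure ℝ≥0∞), (t, τ) ∈ Dbulk → Hbulk t τ P < Hbulk t τ Q)
    (hneg : ∀ τ ∈ DnegInf, HnegInf τ P < HnegInf τ Q)
    (hzero : ∀ α : ℝ≥0∞, α ≤ 1 → HzeroA α P < HzeroA α Q)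
    (hpos : HposInf P < HposInf Q) :
    Setup (fun y : PosY P => margY P y.1) (fun y => condX P y.1)
      (fun y : PosY Q => margY Q y.1) (fun y => condX Q y.1) where
  pr0 y := y.2
  pr1 := sum_margY_pos hP
  pm y := condX_mem hP.1 y.2
  qr0 y := y.2
  qr1 := sum_margY_pos hQ
  qm y := condX_mem hQ.1 y.2
  bulk t τ h := by
    have := hbulk t τ h
    rw [Hbulk_eq, Hbulk_eq, div_lt_div_iff_of_pos_right log2_pos] at this
    rw [sum_posY P fun y => margY P y * exp (t * En τ (condX P y)),
      sum_posY Q fun y => margY Q y * exp (t * En τ (condX Q y))] at this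
    exact this
  neg τ h := by
    have := hneg τ h
    rw [HnegInf_eq, HnegInf_eq] at this
    obtain ⟨y0, hy0⟩ := exists_marg_pos hP
    obtain ⟨_, ⟨y, hy, rfl⟩, h2⟩ := exists_lt_of_csInf_lt
      (Set.Nonempty.image _ (⟨y0, hy0⟩ : Set.Nonempty {y | 0 < margY P y})) this
    refine ⟨⟨y, hy⟩, fun y' => ?_⟩
    have h3 := h2.trans_le (csInf_le ((Set.toFinite _).image _).bddBelow ⟨y'.1, y'.2, rfl⟩)
    exact (div_lt_div_iff_of_pos_right log2_pos).1 h3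
  zero s h0 h1 := by
    have := hzero (ENNReal.ofReal s) (by simpa using h1)
    unfold HzeroA at this
    rw [sum_posY P fun y => margY P y * renyi (ENNReal.ofReal s) (condX P y),
      sum_posY Q fun y => margY Q y * renyi (ENNReal.ofReal s) (condX Q y)] at this
    have := mul_lt_mul_of_pos_left this log2_pos
    rw [mul_sum, mul_sum] at this
    have e : ∀ y : PosY P, margY P y.1 * Ht (condX P y.1) s
        = log 2 * (margY P y.1 * renyi (ENNReal.ofReal s) (condX P y.1)) := fun y => by
      rw [← renyi_fin (condX_mem hP.1 y.2) h0]; ring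
    have e' : ∀ y : PosY Q, margY Q y.1 * Ht (condX Q y.1) s
        = log 2 * (margY Q y.1 * renyi (ENNReal.ofReal s) (condX Q y.1)) := fun y => by
      rw [← renyi_fin (condX_mem hQ.1 y.2) h0]; ring
    unfold av
    simp only [e, e']
    exact this
  pos := by
    unfold HposInf at hpos
    obtain ⟨y0, hy0⟩ := exists_marg_pos hQ
    obtain ⟨_, ⟨y', hy', rfl⟩, h2⟩ := exists_lt_of_lt_csSup
      (Set.Nonempty.image _ (⟨y0, hy0⟩ : Set.Nonempty {y | 0 < margY Q y})) hpos
    refine ⟨⟨y', hy'⟩, fun y => ?_⟩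
    have h3 := (le_csSup ((Set.toFinite _).image _).bddAbove ⟨y.1, y.2, rfl⟩).trans_lt h2
    have := mul_lt_mul_of_pos_left h3 log2_pos
    rwa [renyi_zero (condX_mem hP.1 y.2).1, renyi_zero (condX_mem hQ.1 hy').1] at this

theorem main {P : Matrix X Y ℝ} {Q : Matrix X' Y' ℝ} (hP : IsJointProb P) (hQ : IsJointProb Q)
    (hbulk : ∀ (t : ℝ) (τ : Measure ℝ≥0∞), (t, τ) ∈ Dbulk → Hbulk t τ P < Hbulk t τ Q)
    (hneg : ∀ τ ∈ DnegInf, HnegInf τ P < HnegInf τ Q)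
    (hzero : ∀ α : ℝ≥0∞, α ≤ 1 → HzeroA α P < HzeroA α Q)
    (hpos : HposInf P < HposInf Q) :
    (∃ N : ℕ, ∀ m ≥ N, CondMajorizes (kronPow P m) (kronPow Q m)) ∧
    (∃ (dR nR : ℕ) (R : Matrix (Fin dR) (Fin nR) ℝ), IsJointProb R ∧
      CondMajorizes (kron P R) (kron Q R)) := by
  classical
  obtain ⟨N, hN⟩ := crit_eventually (setup_of hP hQ hbulk hneg hzero hpos)
  obtain ⟨y0, hy0⟩ := exists_marg_pos hQ
  have : Nonempty (PosY Q) := ⟨⟨y0, hy0⟩⟩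
  have : Nonempty Y' := ⟨y0⟩
  have hC : ∀ m ≥ N, Crit (kronPow P m) (kronPow Q m) := fun m hm =>
    Crit.embeds (Embeds.kronPow (embeds_core hP.1) m) (Embeds.kronPow (embeds_core hQ.1) m) (hN m hm)
  refine ⟨⟨N, fun m hm => (hC m hm).condMajorizes fun x y => ?_⟩,
    catalytic_of_crit P Q hP hQ N (hC (N + 1) (by omega))⟩
  simp only [kronPow, Matrix.of_apply]
  exact prod_nonneg fun i _ => hP.1 _ _

end Red
end CM

/-- Large-sample and catalytic conditional majorization: strict ordering of all
the conditional entropies `H_{t,τ}` for `(t,τ) ∈ 𝒟_bulk`, `H_{-∞,τ}` for `τ ∈ 𝒟_{-∞}`,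
`H_{0,α}` for `α ∈ [0,1]`, and `H_{+∞,0}` implies asymptotic and catalytic conditional
majorization. -/
theorem large_sample_and_catalytic
    (d n d' n' : ℕ) (P : Matrix (Fin d) (Fin n) ℝ) (Q : Matrix (Fin d') (Fin n') ℝ)
    (hP : IsJointProb P) (hQ : IsJointProb Q)
    (hbulk : ∀ (t : ℝ) (τ : Measure ℝ≥0∞), (t, τ) ∈ Dbulk → Hbulk t τ P < Hbulk t τ Q)
    (hneg : ∀ τ ∈ DnegInf, HnegInf τ P < HnegInf τ Q)
    (hzero : ∀ α : ℝ≥0∞, α ≤ 1 → HzeroA α P < HzeroA α Q)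
    (hpos : HposInf P < HposInf Q) :
    (∃ N : ℕ, ∀ m ≥ N, CondMajorizes (kronPow P m) (kronPow Q m)) ∧
    (∃ (dR nR : ℕ) (R : Matrix (Fin dR) (Fin nR) ℝ), IsJointProb R ∧
      CondMajorizes (kron P R) (kron Q R)) := by
  exact CM.main hP hQ hbulk hneg hzero hpos
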